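/- arXiv:1309.7404 — 2 statements merged into one kernel-verified Lean document; each statement's English description precedes it below -/
import Mathlib

section
/- For every positive integer J, the set of pairs (b,λ) ∈ ℂ × ℂ such that (b,λ) ∈ Z_J^{QES} and λ is an eigenvalue of L_{−J}(b) is infinite. -/
open Complex Filter Polynomial

/-- The quasi-exactly solvable candidate eigenfunction `p(z) exp(z³/3 - b z)`. -/
noncomputable def qesFun (b : ℂ) (p : Polynomial ℂ) : ℂ → ℂ :=
  fun z => p.eval z * Complex.exp (z ^ 3 / 3 - b * z)

/-- `y` satisfies the quartic ODE `-y'' + (z⁴ - 2 b z² + 2 J z) y = λ y`. -/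
def SatisfiesQuarticODE (J b lam : ℂ) (y : ℂ → ℂ) : Prop :=
  ∀ z : ℂ,
    -(deriv (deriv y) z) + (z ^ 4 - 2 * b * z ^ 2 + 2 * J * z) * y z = lam * y z

/-- `y` is an eigenfunction of `L_J(b)` with eigenvalue `λ`:
an entire function, not identically zero, satisfying the ODE and tending to `0`
along the rays `arg z = ±π/3`. -/
def IsQuarticEigenfunction (J b lam : ℂ) (y : ℂ → ℂ) : Prop :=
  Differentiable ℂ y ∧ y ≠ 0 ∧ SatisfiesQuarticODE J b lam y ∧
  Tendsto (fun r : ℝ => y (r * Complex.exp (Complex.I * (Real.pi / 3))))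
    atTop (nhds 0) ∧
  Tendsto (fun r : ℝ => y (r * Complex.exp (-Complex.I * (Real.pi / 3))))
    atTop (nhds 0)

/-- `λ` is an eigenvalue of `L_J(b)`. -/
def IsQuarticEigenvalue (J b lam : ℂ) : Prop :=
  ∃ y : ℂ → ℂ, IsQuarticEigenfunction J b lam y

/-- `p` witnesses that `(b, λ)` lies in the QES spectral locus of `L_J`. -/
def QESWitness (J b lam : ℂ) (p : Polynomial ℂ) : Prop :=
  p ≠ 0 ∧ SatisfiesQuarticODE J b lam (qesFun b p)

/-- The quasi-exactly solvable part of the spectral locus of `L_J`. -/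
def qesSpectralLocus (J : ℂ) : Set (ℂ × ℂ) :=
  {q : ℂ × ℂ | ∃ p : Polynomial ℂ, QESWitness J q.1 q.2 p}

/-- The real QES spectral locus of `L_J`. -/
def qesRealLocus (J : ℂ) : Set (ℝ × ℝ) :=
  {q : ℝ × ℝ | ((q.1 : ℂ), (q.2 : ℂ)) ∈ qesSpectralLocus J}

/-- `Γ_{n,m}`: points of the real QES spectral locus of `L_{n+1}` whose
polynomial has exactly `n - 2m` (distinct) real zeros. -/
def qesGamma (n m : ℕ) : Set (ℝ × ℝ) :=
  {q : ℝ × ℝ | ∃ p : Polynomial ℂ, QESWitness ((n : ℂ) + 1) q.1 q.2 p ∧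
    {z : ℂ | p.eval z = 0 ∧ z.im = 0}.ncard = n - 2 * m}

lemma lc_factor (n : ℕ) : ∀ f : ℂ → ℂ, Differentiable ℂ f → {z | f z = 0}.Finite →
    {z | f z = 0}.ncard = n →
    ∃ (P : Polynomial ℂ) (g : ℂ → ℂ), P.Monic ∧ Differentiable ℂ g ∧ (∀ z, g z ≠ 0) ∧
      ∀ z, f z = P.eval z * g z := by
  induction n using Nat.strong_induction_on with
  | _ n ih =>
  intro f hf hfin hn
  by_cases h0 : ∀ z, f z ≠ 0
  · exact ⟨1, f, monic_one, hf, h0, by simp⟩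
  push Not at h0
  obtain ⟨a, ha⟩ := h0
  obtain ⟨p, hp⟩ := hf.analyticAt a
  have hp0 : p ≠ 0 := by
    intro h
    have h1 := (hp.locally_zero_iff).2 h
    have h2 : {z | f z = 0} ∈ nhds a := h1
    exact (infinite_of_mem_nhds a h2) hfin
  set g := (Function.swap dslope a)^[p.order] f with hg
  have hfg : ∀ z, f z = (z - a) ^ p.order * g z := fun z => hp.eq_pow_order_mul_iterate_dslope z
  have hga : g a ≠ 0 := hp.iterate_dslope_fslope_ne_zero hp0
  have hgd : Differentiable ℂ g := by
    have : ∀ k : ℕ, Differentiable ℂ ((Function.swap dslope a)^[k] f) := by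
      intro k
      induction k with
      | zero => exact hf
      | succ k ihk =>
        rw [Function.iterate_succ_apply']
        rw [← differentiableOn_univ]
        exact (Complex.differentiableOn_dslope (by simp)).2 (differentiableOn_univ.2 ihk)
    exact this _
  have hss : {z | g z = 0} ⊂ {z | f z = 0} := by
    refine ⟨fun z hz => ?_, fun h => hga (h ha)⟩
    have hz' : g z = 0 := hz
    simp [hfg z, hz']
  have hgfin := hfin.subset hss.1
  obtain ⟨P, q, hP, hq, hq0, hPq⟩ := ih _ (by rw [← hn]; exact Set.ncard_lt_ncard hss hfin) g hgd hgfin rfl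
  refine ⟨(X - C a) ^ p.order * P, q, ((monic_X_sub_C a).pow _).mul hP, hq, hq0, fun z => ?_⟩
  rw [hfg, hPq]; simp [mul_assoc]

/-- growth of order at most 3/2 -/
def lcGr (f : ℂ → ℂ) : Prop := ∃ C : ℝ, 0 ≤ C ∧ ∀ z, ‖f z‖ ≤ Real.exp (C * (1 + ‖z‖ * √‖z‖))

lemma lc_linear (Q : ℂ → ℂ) (hQ : Differentiable ℂ Q) (C : ℝ) (hC : 0 ≤ C)
    (h : ∀ z, (Q z).re ≤ C * (1 + ‖z‖ * √‖z‖)) : ∃ α β : ℂ, ∀ z, Q z = α * z + β := by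
  have key : ∀ w, deriv (deriv Q) w = 0 := by
    intro w
    have hb : ∀ R : ℝ, 1 ≤ R → ‖w‖ ≤ R → ‖deriv (deriv Q) w‖ ≤
        2 * (4 * ((C + 1) * (1 + 3 * R * √(3*R))) + 5 * ‖Q 0‖) / R ^ 2 := by
      intro R hR hw
      have hR0 : 0 < R := by linarith
      have h1 := Complex.norm_iteratedDeriv_le_of_forall_mem_sphere_norm_le (c := w) (R := R)
        (C := 4 * ((C + 1) * (1 + 3 * R * √(3*R))) + 5 * ‖Q 0‖) (f := Q) 2 hR0
        hQ.diffContOnCl ?_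
      · simpa [iteratedDeriv_succ, iteratedDeriv_zero] using h1
      · intro z hz
        have hz1 : ‖z‖ ≤ 2 * R := by
          have : ‖z - w‖ = R := by simpa [dist_eq_norm] using hz
          calc ‖z‖ = ‖(z - w) + w‖ := by ring_nf
            _ ≤ _ := norm_add_le _ _
            _ ≤ 2 * R := by linarith
        have hM : 0 < (C + 1) * (1 + 3 * R * √(3*R)) := by positivity
        have h2 := Complex.borelCaratheodory (f := Q) (R := 3 * R) (z := z) hM
          hQ.differentiableOn ?_ (by linarith) (by simp; linarith)
        · refine h2.trans ?_
          have h3 : R ≤ 3 * R - ‖z‖ := by linarith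
          have h4 : 0 < 3 * R - ‖z‖ := by linarith
          rw [← add_div, div_le_iff₀ h4]
          have e1 : 2 * ((C + 1) * (1 + 3 * R * √(3*R))) * ‖z‖ ≤
              2 * ((C + 1) * (1 + 3 * R * √(3*R))) * (2 * R) := by gcongr
          have e2 : ‖Q 0‖ * (3 * R + ‖z‖) ≤ ‖Q 0‖ * (3 * R + 2 * R) := by gcongr
          have e3 : (4 * ((C + 1) * (1 + 3 * R * √(3*R))) + 5 * ‖Q 0‖) * R ≤
            (4 * ((C + 1) * (1 + 3 * R * √(3*R))) + 5 * ‖Q 0‖) * (3 * R - ‖z‖) := by gcongr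
          linarith
        · intro x hx
          have hx' : ‖x‖ ≤ 3 * R := by
            have : ‖x‖ < 3 * R := by simpa using hx
            exact this.le
          show (Q x).re ≤ _
          refine (h x).trans ?_
          gcongr
          linarith
    have ht : Tendsto (fun R : ℝ => 2 * (4 * ((C + 1) * (1 + 3 * R * √(3*R))) + 5 * ‖Q 0‖) / R ^ 2)
        atTop (nhds 0) := by
      have t1 : Tendsto (fun R : ℝ => (R ^ 2)⁻¹) atTop (nhds 0) :=
        (tendsto_pow_atTop (by norm_num)).inv_tendsto_atTop
      have t2 : Tendsto (fun R : ℝ => (√R)⁻¹) atTop (nhds 0) :=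
        Real.tendsto_sqrt_atTop.inv_tendsto_atTop
      have t3 := ((t1.const_mul (8 * (C+1) + 10 * ‖Q 0‖)).add (t2.const_mul (24 * (C + 1) * √3)))
      simp only [mul_zero, add_zero] at t3
      refine t3.congr' ?_
      filter_upwards [eventually_gt_atTop 0] with R hR
      rw [Real.sqrt_mul (by norm_num)]
      have hs : √R ≠ 0 := (Real.sqrt_pos.2 hR).ne'
      have hs2 : R = √R * √R := (Real.mul_self_sqrt hR.le).symm
      generalize √R = s at *
      subst hs2
      field_simp
      ring
    have : ‖deriv (deriv Q) w‖ ≤ 0 := by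
      refine ge_of_tendsto ht ?_
      filter_upwards [eventually_ge_atTop 1, eventually_ge_atTop ‖w‖] with R h1 h2
      exact hb R h1 h2
    simpa using this
  have hQ' : Differentiable ℂ (deriv Q) := hQ.deriv
  have h1 : ∀ z, deriv Q z = deriv Q 0 := fun z => is_const_of_deriv_eq_zero hQ' key z 0
  have h2 : ∀ z, Q z - deriv Q 0 * z = Q 0 - deriv Q 0 * 0 := by
    intro z
    refine is_const_of_deriv_eq_zero (f := fun z => Q z - deriv Q 0 * z) (by fun_prop) ?_ z 0
    intro x
    have := ((hQ x).hasDerivAt.sub ((hasDerivAt_id x).const_mul (deriv Q 0))).deriv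
    simp only [mul_one, h1 x, sub_self] at this
    exact this
  exact ⟨deriv Q 0, Q 0, fun z => by linear_combination h2 z⟩

lemma lc_exp (g : ℂ → ℂ) (hg : Differentiable ℂ g) (h0 : ∀ z, g z ≠ 0) :
    ∃ Q : ℂ → ℂ, Differentiable ℂ Q ∧ ∀ z, g z = Complex.exp (Q z) := by
  have hd : Differentiable ℂ (fun z => deriv g z / g z) := hg.deriv.div hg h0
  obtain ⟨Q, hQ0, hQ⟩ := hd.isExactOn_univ.with_val_at 0 (Complex.log (g 0))
  have hQ' : ∀ z, HasDerivAt Q (deriv g z / g z) z := fun z => hQ z trivial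
  refine ⟨Q, fun z => (hQ' z).differentiableAt, fun z => ?_⟩
  have hder : ∀ z, HasDerivAt (fun z => g z * Complex.exp (-Q z)) 0 z := by
    intro z
    have := (hg z).hasDerivAt.mul ((hQ' z).neg.cexp)
    convert! this using 1
    field_simp [h0 z]
    simp
  have hc := is_const_of_deriv_eq_zero (f := fun z => g z * Complex.exp (-Q z))
    (fun z => (hder z).differentiableAt) (fun z => (hder z).deriv) z 0
  simp only [hQ0, Complex.exp_neg, Complex.exp_log (h0 0)] at hc
  rw [mul_inv_cancel₀ (h0 0)] at hc
  exact (mul_inv_eq_one₀ (Complex.exp_ne_zero _)).1 hc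

theorem lc_entire (f : ℂ → ℂ) (hf : Differentiable ℂ f) (hgr : lcGr f)
    (hdec : ∀ K : ℝ, Tendsto (fun x : ℝ => Real.exp (K * x) * ‖f x‖) atTop (nhds 0))
    (hfin : {z | f z = 0}.Finite) : False := by
  obtain ⟨P, g, hP, hg, hg0, hfg⟩ := lc_factor _ f hf hfin rfl
  have hP1 : ∀ᶠ z in Bornology.cobounded ℂ, 1 ≤ ‖P.eval z‖ := by
    by_cases hd : 0 < P.degree
    · exact (P.tendsto_norm_atTop hd tendsto_norm_cobounded_atTop).eventually_ge_atTop 1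
    · have : P = 1 := by
        refine (Polynomial.Monic.degree_le_zero_iff_eq_one hP).1 (not_lt.1 hd)
      simp [this]
  obtain ⟨C, hC, hCf⟩ := hgr
  obtain ⟨Q, hQ, hgQ⟩ := lc_exp g hg hg0
  have hRe : ∃ C', 0 ≤ C' ∧ ∀ z, (Q z).re ≤ C' * (1 + ‖z‖ * √‖z‖) := by
    rw [← comap_norm_atTop, eventually_comap] at hP1
    obtain ⟨R, hR⟩ := eventually_atTop.1 hP1
    obtain ⟨D, hD⟩ := (isCompact_closedBall (0:ℂ) R).exists_bound_of_continuousOn hQ.continuous.continuousOn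
    refine ⟨max C |D|, le_max_of_le_left hC, fun z => ?_⟩
    have hone : 1 ≤ 1 + ‖z‖ * √‖z‖ := by
      have : 0 ≤ ‖z‖ * √‖z‖ := by positivity
      linarith
    by_cases hz : ‖z‖ ≤ R
    · calc (Q z).re ≤ ‖Q z‖ := Complex.re_le_norm _
        _ ≤ D := hD z (by simpa using hz)
        _ ≤ |D| := le_abs_self _
        _ ≤ max C |D| := le_max_right _ _
        _ ≤ _ := le_mul_of_one_le_right (le_max_of_le_left hC) hone
    · have h1 := hR ‖z‖ (not_le.1 hz).le z rfl
      have h2 := hCf z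
      rw [hfg, norm_mul, hgQ, Complex.norm_exp] at h2
      have h3 : Real.exp (Q z).re ≤ Real.exp (C * (1 + ‖z‖ * √‖z‖)) :=
        le_trans (le_mul_of_one_le_left (Real.exp_pos _).le h1) h2
      refine (Real.exp_le_exp.1 h3).trans ?_
      gcongr
      exact le_max_left _ _
  obtain ⟨C', hC', hRe⟩ := hRe
  obtain ⟨α, β, hαβ⟩ := lc_linear Q hQ C' hC' hRe
  have h1 := hdec (-α.re)
  have h2 : ∀ᶠ x : ℝ in atTop, Real.exp β.re ≤ Real.exp (-α.re * x) * ‖f x‖ := by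
    have : Tendsto (fun x : ℝ => (x : ℂ)) atTop (Bornology.cobounded ℂ) := by
      rw [← tendsto_norm_atTop_iff_cobounded]
      simpa using tendsto_abs_atTop_atTop
    filter_upwards [this.eventually hP1] with x hx
    rw [hfg, hgQ, hαβ, norm_mul, Complex.norm_exp]
    have : (α * x + β).re = α.re * x + β.re := by simp
    rw [this, Real.exp_add]
    have e : Real.exp (-α.re * x) * Real.exp (α.re * x) = 1 := by rw [← Real.exp_add]; simp
    calc Real.exp β.re = 1 * (1 * Real.exp β.re) := by ring
      _ ≤ ‖P.eval (x:ℂ)‖ * (1 * Real.exp β.re) := by gcongr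
      _ = _ := by rw [← e]; ring
  have := ge_of_tendsto h1 h2
  linarith [Real.exp_pos β.re]

/-- the two ray directions -/
structure lcRay (ω : ℂ) : Prop where
  re : ω.re = 1 / 2
  im : ω.im ^ 2 = 3 / 4

lemma lcRay.cube {ω : ℂ} (h : lcRay ω) : ω ^ 3 = -1 := by
  obtain ⟨h1, h2⟩ := h
  apply Complex.ext
  · simp [pow_succ, h1]; nlinarith
  · simp [pow_succ, h1]; linear_combination (-ω.im) * h2

lemma lcRay.nrm {ω : ℂ} (h : lcRay ω) : ‖ω‖ = 1 := by
  obtain ⟨h1, h2⟩ := h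
  rw [Complex.norm_def, Complex.normSq_apply, h1]
  rw [show (1/2 * (1/2) + ω.im * ω.im : ℝ) = 1 by nlinarith]
  simp

/-- the integrand -/
noncomputable def lcf (b : ℂ) (k : ℕ) (t : ℂ) : ℂ := t ^ k * Complex.exp (2 * (t ^ 3 / 3 - b * t))

/-- the ray moment -/
noncomputable def lcM (ω : ℂ) (k : ℕ) (b : ℂ) : ℂ :=
  ∫ s in Set.Ioi (0 : ℝ), lcf b k (s * ω) * ω

lemma lcf_bound {ω : ℂ} (h : lcRay ω) (b : ℂ) (k : ℕ) (s : ℝ) (hs : 0 ≤ s) :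
    ‖lcf b k (s * ω)‖ ≤ k.factorial * Real.exp 3 * Real.exp (5 * (‖b‖ * √‖b‖)) * Real.exp (-s) := by
  have e1 : (2 * ((s * ω) ^ 3 / 3 - b * (s * ω))).re ≤ -2 * s ^ 3 / 3 + 2 * s * ‖b‖ := by
    rw [mul_pow, h.cube]
    have h1 : (2 * ((s:ℂ) ^ 3 * -1 / 3 - b * (s * ω))) = ((-2 * s ^ 3 / 3 : ℝ) : ℂ) + ((2 * s : ℝ) : ℂ) * (- (b * ω)) := by
      push_cast; ring
    rw [h1, Complex.add_re, Complex.ofReal_re, Complex.re_ofReal_mul]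
    have h2 : (-(b * ω)).re ≤ ‖b‖ := by
      refine (Complex.re_le_norm _).trans ?_
      rw [norm_neg, norm_mul, h.nrm, mul_one]
    have := mul_le_mul_of_nonneg_left h2 (show 0 ≤ 2 * s by linarith)
    linarith
  have e2 : 2 * s * ‖b‖ ≤ s ^ 3 / 3 + 5 * (‖b‖ * √‖b‖) := by
    have hu : ‖b‖ = √‖b‖ * √‖b‖ := (Real.mul_self_sqrt (norm_nonneg b)).symm
    have hu0 : 0 ≤ √‖b‖ := Real.sqrt_nonneg _
    generalize √‖b‖ = u at *
    rw [hu]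
    rcases le_total s (5 / 2 * u) with h1 | h1
    · have := mul_le_mul_of_nonneg_right h1 (mul_nonneg hu0 hu0)
      have : 0 ≤ s ^ 3 := by positivity
      nlinarith
    · have h2 : (5 / 2 * u) * (5 / 2 * u) ≤ s * s := by gcongr
      have := mul_le_mul_of_nonneg_left h2 hs
      have : 0 ≤ u ^ 3 := by positivity
      have : 0 ≤ s * (u * u) := by positivity
      nlinarith
  have e3 : s - s ^ 3 / 3 ≤ 3 - s := by
    nlinarith [mul_nonneg (show 0 ≤ s + 3 by linarith) (sq_nonneg (s - 3 / 2))]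
  have e4 : s ^ k ≤ k.factorial * Real.exp s := by
    have := Real.pow_div_factorial_le_exp s hs k
    rwa [div_le_iff₀ (by positivity), mul_comm] at this
  rw [lcf, norm_mul, Complex.norm_exp, norm_pow, norm_mul, h.nrm, mul_one, Complex.norm_real,
    Real.norm_of_nonneg hs]
  calc s ^ k * Real.exp _ ≤ (k.factorial * Real.exp s) * Real.exp (- s ^ 3 / 3 + 5 * (‖b‖ * √‖b‖)) := by
        gcongr
        linarith
    _ = k.factorial * Real.exp (s - s ^ 3 / 3 + 5 * (‖b‖ * √‖b‖)) := by
        rw [mul_assoc, ← Real.exp_add]; ring_nf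
    _ ≤ k.factorial * Real.exp (3 - s + 5 * (‖b‖ * √‖b‖)) := by gcongr
    _ = _ := by rw [mul_assoc, mul_assoc, ← Real.exp_add, ← Real.exp_add]; ring_nf

lemma lcf_cont (b : ℂ) (k : ℕ) : Continuous (lcf b k) := by unfold lcf; fun_prop

lemma lcf_diff (b : ℂ) (k : ℕ) : Differentiable ℂ (lcf b k) := by unfold lcf; fun_prop

lemma lcf_meas (ω b : ℂ) (k : ℕ) : MeasureTheory.AEStronglyMeasurable
    (fun s : ℝ => lcf b k (s * ω) * ω) (MeasureTheory.volume.restrict (Set.Ioi 0)) := by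
  have := lcf_cont b k
  exact Continuous.aestronglyMeasurable (by fun_prop)

lemma lcf_int {ω : ℂ} (h : lcRay ω) (b : ℂ) (k : ℕ) :
    MeasureTheory.IntegrableOn (fun s : ℝ => lcf b k (s * ω) * ω) (Set.Ioi 0) := by
  refine MeasureTheory.Integrable.mono' ((integrableOn_exp_neg_Ioi 0).const_mul
    (k.factorial * Real.exp 3 * Real.exp (5 * (‖b‖ * √‖b‖)))) (lcf_meas ω b k) ?_
  filter_upwards [MeasureTheory.ae_restrict_mem measurableSet_Ioi] with s hs
  rw [norm_mul, h.nrm, mul_one]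
  exact lcf_bound h b k s (le_of_lt hs)

lemma lcM_bound {ω : ℂ} (h : lcRay ω) (b : ℂ) (k : ℕ) :
    ‖lcM ω k b‖ ≤ k.factorial * Real.exp 3 * Real.exp (5 * (‖b‖ * √‖b‖)) := by
  have := MeasureTheory.norm_integral_le_of_norm_le (μ := MeasureTheory.volume.restrict (Set.Ioi (0:ℝ)))
    (f := fun s : ℝ => lcf b k (s * ω) * ω)
    ((integrableOn_exp_neg_Ioi 0).const_mul
    (k.factorial * Real.exp 3 * Real.exp (5 * (‖b‖ * √‖b‖)))) ?_
  · rw [MeasureTheory.integral_const_mul, integral_exp_neg_Ioi_zero, mul_one] at this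
    exact this
  · filter_upwards [MeasureTheory.ae_restrict_mem measurableSet_Ioi] with s hs
    rw [norm_mul, h.nrm, mul_one]
    exact lcf_bound h b k s (le_of_lt hs)

lemma lcM_diff {ω : ℂ} (h : lcRay ω) (k : ℕ) : Differentiable ℂ (lcM ω k) := by
  intro b
  have := hasDerivAt_integral_of_dominated_loc_of_deriv_le
    (μ := MeasureTheory.volume.restrict (Set.Ioi (0:ℝ)))
    (F := fun b (s : ℝ) => lcf b k (s * ω) * ω)
    (F' := fun b (s : ℝ) => (-2 * lcf b (k+1) (s * ω)) * ω) (x₀ := b)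
    (bound := fun s => (2 * ((k+1).factorial * Real.exp 3 * Real.exp (5 * ((‖b‖+1) * √(‖b‖+1))))) * Real.exp (-s))
    (Metric.ball_mem_nhds b one_pos) ?_ ?_ ?_ ?_ ?_ ?_
  · exact this.2.differentiableAt
  · exact Eventually.of_forall fun x => lcf_meas ω x k
  · exact lcf_int h b k
  · have := lcf_cont b (k+1)
    exact Continuous.aestronglyMeasurable (by fun_prop)
  · filter_upwards [MeasureTheory.ae_restrict_mem measurableSet_Ioi] with s hs x hx
    have hx' : ‖x‖ ≤ ‖b‖ + 1 := by
      have h1 : ‖x - b‖ < 1 := by simpa [dist_eq_norm] using hx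
      calc ‖x‖ = ‖b + (x - b)‖ := by ring_nf
        _ ≤ _ := norm_add_le _ _
        _ ≤ _ := by linarith
    rw [norm_mul, h.nrm, mul_one, norm_mul, norm_neg]
    have := lcf_bound h x (k+1) s (le_of_lt hs)
    simp only [Complex.norm_ofNat]
    calc 2 * ‖lcf x (k+1) (s * ω)‖ ≤ 2 * ((k+1).factorial * Real.exp 3 * Real.exp (5 * (‖x‖ * √‖x‖)) * Real.exp (-s)) := by gcongr
      _ ≤ 2 * ((k+1).factorial * Real.exp 3 * Real.exp (5 * ((‖b‖+1) * √(‖b‖+1))) * Real.exp (-s)) := by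
        gcongr
      _ = _ := by ring
  · exact (integrableOn_exp_neg_Ioi 0).const_mul _
  · refine Eventually.of_forall fun s x hx => ?_
    have h1 : HasDerivAt (fun x : ℂ => 2 * (((s:ℂ) * ω) ^ 3 / 3 - x * (s * ω))) (2 * (-(1 * (s * ω)))) x :=
      (((hasDerivAt_id x).mul_const _).const_sub _).const_mul 2
    have h2 := ((h1.cexp).const_mul (((s:ℂ) * ω) ^ k)).mul_const ω
    convert! h2 using 1
    simp only [lcf]
    ring

lemma lc_prim_tendsto (F f : ℂ → ℂ) (hF : ∀ z, HasDerivAt F (f z) z) (hf : Continuous f) (a ω : ℂ)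
    (hi : MeasureTheory.IntegrableOn (fun s : ℝ => f (a + s * ω) * ω) (Set.Ioi 0)) :
    Tendsto (fun R : ℝ => F (a + R * ω)) atTop
      (nhds (F a + ∫ s in Set.Ioi (0 : ℝ), f (a + s * ω) * ω)) := by
  have h1 := MeasureTheory.intervalIntegral_tendsto_integral_Ioi 0 hi tendsto_id
  refine (h1.const_add (F a)).congr fun R => ?_
  have h2 : ∀ s ∈ Set.uIcc 0 R, HasDerivAt (fun s : ℝ => F (a + s * ω)) (f (a + s * ω) * ω) s := by
    intro s _
    have h3 : HasDerivAt (fun s : ℝ => a + (s:ℂ) * ω) ω s := by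
      have := ((Complex.ofRealCLM.hasDerivAt (x := s)).mul_const ω).const_add a
      simpa using this
    exact (hF _).comp_of_eq s h3 rfl
  rw [id, intervalIntegral.integral_eq_sub_of_hasDerivAt h2]
  · simp
  · exact Continuous.intervalIntegrable (by fun_prop) _ _

lemma lc_re {ω : ℂ} (h : lcRay ω) (a u R : ℝ) :
    (2 * (((u:ℂ) + R * ω) ^ 3 / 3 - ((a ^ 2 : ℝ) : ℂ) * (u + R * ω))).re =
    2 / 3 * (u ^ 3 + 3 / 2 * u ^ 2 * R - 3 / 2 * u * R ^ 2 - R ^ 3) - 2 * a ^ 2 * (u + R / 2) := by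
  have h1 := h.re
  have h2 := h.im
  have e : (2 * (((u:ℂ) + R * ω) ^ 3 / 3 - ((a ^ 2 : ℝ) : ℂ) * (u + R * ω))) =
    ((2 / 3 : ℝ) : ℂ) * (((u:ℂ) + R * ω) ^ 3) - ((2 * a ^ 2 : ℝ) : ℂ) * (u + R * ω) := by
    push_cast; ring
  rw [e, Complex.sub_re, Complex.re_ofReal_mul, Complex.re_ofReal_mul]
  simp [pow_succ, h1]
  linear_combination (-2 * R ^ 2 * u - R ^ 3) * h2

lemma lc_norm {ω : ℂ} (h : lcRay ω) (u R : ℝ) (hu : 0 ≤ u) (hR : 0 ≤ R) :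
    ‖(u:ℂ) + R * ω‖ ≤ u + R := by
  refine (norm_add_le _ _).trans ?_
  rw [norm_mul, h.nrm, mul_one, Complex.norm_real, Complex.norm_real, Real.norm_of_nonneg hu,
    Real.norm_of_nonneg hR]

lemma lc_pow_le (s : ℝ) (hs : 0 ≤ s) (k : ℕ) : s ^ k ≤ k.factorial * Real.exp s := by
  have := Real.pow_div_factorial_le_exp s hs k
  rwa [div_le_iff₀ (by positivity), mul_comm] at this

lemma lc_shift_bound {ω : ℂ} (h : lcRay ω) (a : ℝ) (ha : 1 ≤ a) (k : ℕ) (s : ℝ) (hs : 0 ≤ s) :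
    ‖lcf ((a ^ 2 : ℝ) : ℂ) k (a + s * ω)‖ ≤
      (k.factorial * Real.exp 3 * a ^ k * Real.exp (-4 / 3 * a ^ 3)) * Real.exp (-s) := by
  rw [lcf, norm_mul, norm_pow, Complex.norm_exp, lc_re h]
  have h1 : ‖(a:ℂ) + s * ω‖ ^ k ≤ a ^ k * (k.factorial * Real.exp (1 + s)) := by
    calc ‖(a:ℂ) + s * ω‖ ^ k ≤ (a + s) ^ k := by
          gcongr; exact lc_norm h a s (by linarith) hs
      _ ≤ (a * (1 + s)) ^ k := by gcongr; nlinarith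
      _ = a ^ k * (1 + s) ^ k := mul_pow _ _ _
      _ ≤ _ := by gcongr; exact lc_pow_le _ (by linarith) k
  have h2 : 2 / 3 * (a ^ 3 + 3 / 2 * a ^ 2 * s - 3 / 2 * a * s ^ 2 - s ^ 3) - 2 * a ^ 2 * (a + s / 2)
      ≤ -4 / 3 * a ^ 3 + (2 - 2 * s) := by
    have : 0 ≤ a * s ^ 2 := by positivity
    nlinarith [mul_nonneg (show 0 ≤ s + 2 by linarith) (sq_nonneg (s - 1))]
  calc _ ≤ (a ^ k * (k.factorial * Real.exp (1 + s))) * Real.exp (-4 / 3 * a ^ 3 + (2 - 2 * s)) := by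
        gcongr
    _ = a ^ k * k.factorial * (Real.exp (1 + s) * Real.exp (-4 / 3 * a ^ 3 + (2 - 2 * s))) := by ring
    _ = a ^ k * k.factorial * (Real.exp 3 * Real.exp (-4 / 3 * a ^ 3) * Real.exp (-s)) := by
        rw [← Real.exp_add, ← Real.exp_add, ← Real.exp_add]; ring_nf
    _ = _ := by ring

lemma lc_shift_lim {ω : ℂ} (h : lcRay ω) (a : ℝ) (ha : 1 ≤ a) (k : ℕ) (F : ℂ → ℂ)
    (hF : ∀ z, HasDerivAt F (lcf ((a ^ 2 : ℝ) : ℂ) k z) z) :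
    Tendsto (fun R : ℝ => F (a + R * ω) - F (R * ω)) atTop (nhds 0) := by
  have hb : ∀ᶠ R : ℝ in atTop, ‖F (a + R * ω) - F (R * ω)‖ ≤
      (k.factorial * Real.exp (a + 2 / 3 * a ^ 3) * a) * Real.exp (-R) := by
    filter_upwards [eventually_ge_atTop 0, eventually_ge_atTop (3 / 2 * (2 + a ^ 2))] with R hR hR2
    have hd : ∀ u ∈ Set.Icc 0 a, HasDerivWithinAt (fun u : ℝ => F (u + R * ω))
        (lcf ((a ^ 2 : ℝ) : ℂ) k (u + R * ω)) (Set.Icc 0 a) u := by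
      intro u _
      have h3 : HasDerivAt (fun s : ℝ => (s:ℂ) + R * ω) 1 u := by
        have := ((Complex.ofRealCLM.hasDerivAt (x := u))).add_const (R * ω)
        simpa using this
      have := (hF (u + R * ω)).comp_of_eq u h3 rfl
      simp only [mul_one] at this
      exact this.hasDerivWithinAt
    have := Convex.norm_image_sub_le_of_norm_hasDerivWithin_le
      (C := k.factorial * Real.exp (a + 2 / 3 * a ^ 3) * Real.exp (-R)) hd ?_ (convex_Icc 0 a)
      (Set.left_mem_Icc.2 (by linarith)) (Set.right_mem_Icc.2 (by linarith))
    · simp only [Complex.ofReal_zero, zero_add, sub_zero] at this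
      refine this.trans (le_of_eq ?_)
      rw [Real.norm_of_nonneg (by linarith)]
      ring
    · rintro u ⟨hu0, hua⟩
      rw [lcf, norm_mul, norm_pow, Complex.norm_exp, lc_re h]
      have h1 : ‖(u:ℂ) + R * ω‖ ^ k ≤ k.factorial * Real.exp (a + R) := by
        calc ‖(u:ℂ) + R * ω‖ ^ k ≤ (a + R) ^ k := by
              gcongr; exact (lc_norm h u R hu0 hR).trans (by linarith)
          _ ≤ _ := lc_pow_le _ (by linarith) k
      have h2 : 2 / 3 * (u ^ 3 + 3 / 2 * u ^ 2 * R - 3 / 2 * u * R ^ 2 - R ^ 3)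
          - 2 * a ^ 2 * (u + R / 2) ≤ 2 / 3 * a ^ 3 - 2 * R := by
        have i1 : u ^ 3 ≤ a ^ 3 := by gcongr
        have i2 : u ^ 2 * R ≤ a ^ 2 * R := by gcongr
        have i3 : 0 ≤ u * R ^ 2 := by positivity
        have i4 : 0 ≤ a ^ 2 * u := by positivity
        have i5 : 0 ≤ a ^ 2 * R := by positivity
        have i6 : 3 / 2 * (2 + a ^ 2) ≤ R * R := by nlinarith [sq_nonneg a]
        have i7 := mul_le_mul_of_nonneg_left i6 hR
        nlinarith
      calc _ ≤ (k.factorial * Real.exp (a + R)) * Real.exp (2 / 3 * a ^ 3 - 2 * R) := by gcongr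
        _ = _ := by rw [mul_assoc, mul_assoc, ← Real.exp_add, ← Real.exp_add]; ring_nf
  have ht : Tendsto (fun R : ℝ => (k.factorial * Real.exp (a + 2 / 3 * a ^ 3) * a) * Real.exp (-R))
      atTop (nhds 0) := by
    simpa using (Real.tendsto_exp_neg_atTop_nhds_zero).const_mul
      (k.factorial * Real.exp (a + 2 / 3 * a ^ 3) * a)
  exact squeeze_zero_norm' hb ht

lemma lc_shift {ω : ℂ} (h : lcRay ω) (a : ℝ) (ha : 1 ≤ a) (k : ℕ) (F : ℂ → ℂ)
    (hF : ∀ z, HasDerivAt F (lcf ((a ^ 2 : ℝ) : ℂ) k z) z) :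
    ‖F 0 + lcM ω k ((a ^ 2 : ℝ) : ℂ) - F a‖ ≤
      k.factorial * Real.exp 3 * a ^ k * Real.exp (-4 / 3 * a ^ 3) := by
  have hc := lcf_cont ((a ^ 2 : ℝ) : ℂ) k
  have hae : ∀ᵐ s : ℝ ∂(MeasureTheory.volume.restrict (Set.Ioi 0)),
      ‖lcf ((a ^ 2 : ℝ) : ℂ) k (a + s * ω) * ω‖ ≤
      (k.factorial * Real.exp 3 * a ^ k * Real.exp (-4 / 3 * a ^ 3)) * Real.exp (-s) := by
    filter_upwards [MeasureTheory.ae_restrict_mem measurableSet_Ioi] with s hs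
    rw [norm_mul, h.nrm, mul_one]
    exact lc_shift_bound h a ha k s (le_of_lt hs)
  have hdom : MeasureTheory.Integrable (fun s : ℝ =>
      (k.factorial * Real.exp 3 * a ^ k * Real.exp (-4 / 3 * a ^ 3)) * Real.exp (-s))
      (MeasureTheory.volume.restrict (Set.Ioi 0)) := (integrableOn_exp_neg_Ioi 0).const_mul _
  have hi : MeasureTheory.IntegrableOn
      (fun s : ℝ => lcf ((a ^ 2 : ℝ) : ℂ) k (a + s * ω) * ω) (Set.Ioi 0) := by
    have hcc : Continuous (fun s : ℝ => lcf ((a ^ 2 : ℝ) : ℂ) k (a + s * ω) * ω) :=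
      (hc.comp (by fun_prop : Continuous fun s : ℝ => (a : ℂ) + s * ω)).mul continuous_const
    have hm : MeasureTheory.AEStronglyMeasurable
      (fun s : ℝ => lcf ((a ^ 2 : ℝ) : ℂ) k (a + s * ω) * ω)
      (MeasureTheory.volume.restrict (Set.Ioi 0)) := hcc.aestronglyMeasurable
    exact MeasureTheory.Integrable.mono' hdom hm hae
  have t1 := lc_prim_tendsto F _ hF hc 0 ω (by simp only [zero_add]; exact lcf_int h _ k)
  have t2 := lc_prim_tendsto F _ hF hc a ω hi
  simp only [zero_add] at t1
  have t3 := lc_shift_lim h a ha k F hF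
  have e := tendsto_nhds_unique (t2.sub t1) t3
  have e2 : F 0 + lcM ω k ((a ^ 2 : ℝ) : ℂ) - F a =
      ∫ s in Set.Ioi (0 : ℝ), lcf ((a ^ 2 : ℝ) : ℂ) k (a + s * ω) * ω := by
    unfold lcM
    linear_combination -e
  rw [e2]
  have := MeasureTheory.norm_integral_le_of_norm_le hdom hae
  rwa [MeasureTheory.integral_const_mul, integral_exp_neg_Ioi_zero, mul_one] at this

lemma lc_decay_bound {ω ω' : ℂ} (h : lcRay ω) (h' : lcRay ω') (a : ℝ) (ha : 1 ≤ a) (k : ℕ) :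
    ‖lcM ω k ((a ^ 2 : ℝ) : ℂ) - lcM ω' k ((a ^ 2 : ℝ) : ℂ)‖ ≤
      2 * (k.factorial * Real.exp 3 * a ^ k * Real.exp (-4 / 3 * a ^ 3)) := by
  obtain ⟨F, hF⟩ := (lcf_diff ((a ^ 2 : ℝ) : ℂ) k).isExactOn_univ
  have hF' := fun z => hF z trivial
  have e1 := lc_shift h a ha k F hF'
  have e2 := lc_shift h' a ha k F hF'
  calc _ = ‖(F 0 + lcM ω k ((a ^ 2 : ℝ) : ℂ) - F a) - (F 0 + lcM ω' k ((a ^ 2 : ℝ) : ℂ) - F a)‖ := by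
        congr 1; ring
    _ ≤ _ := norm_sub_le _ _
    _ ≤ _ := by linarith

/-- the class of entire functions with order 3/2 growth and superexponential decay -/
structure lcD (f : ℂ → ℂ) : Prop where
  diff : Differentiable ℂ f
  gr : lcGr f
  dec : ∀ K : ℝ, Tendsto (fun x : ℝ => Real.exp (K * x) * ‖f x‖) atTop (nhds 0)

lemma lcGr.add {f g : ℂ → ℂ} (hf : lcGr f) (hg : lcGr g) : lcGr (fun z => f z + g z) := by
  obtain ⟨C, hC, h1⟩ := hf
  obtain ⟨D, hD, h2⟩ := hg
  refine ⟨C + D + 1, by positivity, fun z => ?_⟩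
  have hx : 1 ≤ 1 + ‖z‖ * √‖z‖ := by
    have : 0 ≤ ‖z‖ * √‖z‖ := by positivity
    linarith
  specialize h1 z
  specialize h2 z
  generalize 1 + ‖z‖ * √‖z‖ = x at *
  have hx0 : 0 ≤ x := by linarith
  have e1 : Real.exp (C * x) ≤ Real.exp ((C + D) * x) := by gcongr; linarith
  have e2 : Real.exp (D * x) ≤ Real.exp ((C + D) * x) := by gcongr; linarith
  have e3 : 2 ≤ Real.exp x := by linarith [Real.add_one_le_exp x]
  calc ‖f z + g z‖ ≤ ‖f z‖ + ‖g z‖ := norm_add_le _ _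
    _ ≤ 2 * Real.exp ((C + D) * x) := by linarith
    _ ≤ Real.exp x * Real.exp ((C + D) * x) := by gcongr
    _ = _ := by rw [← Real.exp_add]; ring_nf

lemma lcGr.mul {f g : ℂ → ℂ} (hf : lcGr f) (hg : lcGr g) : lcGr (fun z => f z * g z) := by
  obtain ⟨C, hC, h1⟩ := hf
  obtain ⟨D, hD, h2⟩ := hg
  refine ⟨C + D, by positivity, fun z => ?_⟩
  rw [norm_mul, add_mul, Real.exp_add]
  exact mul_le_mul (h1 z) (h2 z) (norm_nonneg _) (Real.exp_pos _).le

lemma lcGr_const (c : ℂ) : lcGr (fun _ => c) := by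
  refine ⟨‖c‖, norm_nonneg _, fun z => ?_⟩
  have hx : 1 ≤ 1 + ‖z‖ * √‖z‖ := by
    have : 0 ≤ ‖z‖ * √‖z‖ := by positivity
    linarith
  have := le_mul_of_one_le_right (norm_nonneg c) hx
  linarith [Real.add_one_le_exp (‖c‖ * (1 + ‖z‖ * √‖z‖))]

lemma lcGr_id : lcGr (fun z => z) := by
  refine ⟨1, zero_le_one, fun z => ?_⟩
  have hx : ‖z‖ ≤ 1 + ‖z‖ * √‖z‖ := by
    have hu : ‖z‖ = √‖z‖ * √‖z‖ := (Real.mul_self_sqrt (norm_nonneg z)).symm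
    have hu0 : 0 ≤ √‖z‖ := Real.sqrt_nonneg _
    generalize √‖z‖ = u at *
    rw [hu]
    rcases le_total u 1 with h | h
    · nlinarith [mul_nonneg hu0 (mul_nonneg hu0 hu0)]
    · nlinarith [mul_nonneg hu0 (mul_nonneg hu0 (sub_nonneg.2 h))]
  linarith [Real.add_one_le_exp (1 * (1 + ‖z‖ * √‖z‖))]

lemma lcD.add {f g : ℂ → ℂ} (hf : lcD f) (hg : lcD g) : lcD (fun z => f z + g z) := by
  refine ⟨hf.diff.add hg.diff, hf.gr.add hg.gr, fun K => ?_⟩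
  have := (hf.dec K).add (hg.dec K)
  simp only [add_zero] at this
  refine squeeze_zero (fun x => by positivity) (fun x => ?_) this
  rw [← mul_add]
  gcongr
  exact norm_add_le _ _

lemma lcD.mul {f g : ℂ → ℂ} (hf : lcD f) (hg : lcD g) : lcD (fun z => f z * g z) := by
  refine ⟨hf.diff.mul hg.diff, hf.gr.mul hg.gr, fun K => ?_⟩
  have := (hf.dec K).mul (hg.dec 0)
  simp only [mul_zero, zero_mul, Real.exp_zero, one_mul] at this
  refine this.congr fun x => ?_
  rw [norm_mul, mul_assoc]

lemma lcD.const_mul {f : ℂ → ℂ} (hf : lcD f) (c : ℂ) : lcD (fun z => c * f z) := by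
  refine ⟨hf.diff.const_mul c, (lcGr_const c).mul hf.gr, fun K => ?_⟩
  have := (hf.dec K).const_mul ‖c‖
  simp only [mul_zero] at this
  refine this.congr fun x => ?_
  rw [norm_mul]; ring

lemma lcD.id_mul {f : ℂ → ℂ} (hf : lcD f) : lcD (fun z => z * f z) := by
  refine ⟨differentiable_id.mul hf.diff, lcGr_id.mul hf.gr, fun K => ?_⟩
  refine squeeze_zero' (Eventually.of_forall fun x => by positivity) ?_ (hf.dec (K + 1))
  filter_upwards [eventually_ge_atTop 0] with x hx
  rw [norm_mul, Complex.norm_real, Real.norm_of_nonneg hx, add_mul, Real.exp_add, one_mul, mul_assoc]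
  gcongr
  linarith [Real.add_one_le_exp x]

lemma lcD_zero : lcD (fun _ => 0) :=
  ⟨differentiable_const _, lcGr_const 0, fun K => by simp⟩

lemma lcD.sum {ι : Type*} (s : Finset ι) (f : ι → ℂ → ℂ) (hf : ∀ i ∈ s, lcD (f i)) :
    lcD (fun z => ∑ i ∈ s, f i z) := by
  classical
  induction s using Finset.induction_on with
  | empty => simpa using lcD_zero
  | insert a s ha ih =>
    simp only [Finset.sum_insert ha]
    exact (hf a (by simp)).add (ih fun i hi => hf i (by simp [hi]))

lemma lcD_moment {ω ω' : ℂ} (h : lcRay ω) (h' : lcRay ω') (k : ℕ) :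
    lcD (fun b => lcM ω k b - lcM ω' k b) := by
  have hg : ∀ {ω : ℂ}, lcRay ω → lcGr (lcM ω k) := by
    intro ω h
    have h1 : lcGr (fun z => ((k.factorial * Real.exp 3 : ℝ) : ℂ) *
      ((Real.exp (5 * (‖z‖ * √‖z‖)) : ℝ) : ℂ)) := by
      refine (lcGr_const _).mul ⟨5, by norm_num, fun z => ?_⟩
      rw [Complex.norm_real, Real.norm_of_nonneg (Real.exp_pos _).le]
      gcongr
      linarith
    obtain ⟨C, hC, h2⟩ := h1
    refine ⟨C, hC, fun z => (lcM_bound h z k).trans ((le_of_eq ?_).trans (h2 z))⟩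
    rw [norm_mul, Complex.norm_real, Complex.norm_real, Real.norm_of_nonneg (by positivity),
      Real.norm_of_nonneg (Real.exp_pos _).le]
  refine ⟨(lcM_diff h k).sub (lcM_diff h' k), ?_, fun K => ?_⟩
  · have := (hg h).add ((lcGr_const (-1)).mul (hg h'))
    convert this using 2
    ring
  · have ht : Tendsto (fun x : ℝ => 2 * (k.factorial * Real.exp 3 * k.factorial) * Real.exp (-√x))
        atTop (nhds 0) := by
      have := (Real.tendsto_exp_neg_atTop_nhds_zero.comp Real.tendsto_sqrt_atTop).const_mul
        (2 * (k.factorial * Real.exp 3 * k.factorial))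
      simpa using this
    refine squeeze_zero' (Eventually.of_forall fun x => by positivity) ?_ ht
    filter_upwards [eventually_ge_atTop 1,
      Real.tendsto_sqrt_atTop.eventually_ge_atTop (|K| + 2)] with x hx hx2
    have hx0 : √x ^ 2 = x := Real.sq_sqrt (by linarith)
    have h1 : 1 ≤ √x := Real.one_le_sqrt.2 hx
    have := lc_decay_bound h h' (√x) h1 k
    rw [hx0] at this
    nth_rewrite 1 [← hx0]
    generalize √x = a at *
    calc _ ≤ Real.exp (K * a ^ 2) * (2 * (k.factorial * Real.exp 3 * a ^ k * Real.exp (-4 / 3 * a ^ 3))) := by gcongr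
      _ ≤ Real.exp (K * a ^ 2) * (2 * (k.factorial * Real.exp 3 * (k.factorial * Real.exp a) * Real.exp (-4 / 3 * a ^ 3))) := by
        gcongr; exact lc_pow_le a (by linarith) k
      _ = 2 * (k.factorial * Real.exp 3 * k.factorial) * (Real.exp (K * a ^ 2) * (Real.exp a * Real.exp (-4 / 3 * a ^ 3))) := by ring
      _ ≤ _ := by
        rw [← Real.exp_add, ← Real.exp_add]
        gcongr
        have i1 : K ≤ |K| := le_abs_self K
        have i2 : (K + 2) * a ^ 2 ≤ a * a ^ 2 := by gcongr; linarith
        have i3 : a ≤ a ^ 2 := by nlinarith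
        have i4 : 0 ≤ a ^ 3 := by positivity
        nlinarith

/-- rapid decay along a ray -/
def lcDec (ω : ℂ) (f : ℂ → ℂ) : Prop := ∀ δ : ℝ, δ < 2 / 3 →
  (fun r : ℝ => f (r * ω)) =O[atTop] (fun r : ℝ => Real.exp (-δ * r ^ 3))

lemma lcDec.add {ω : ℂ} {f g : ℂ → ℂ} (hf : lcDec ω f) (hg : lcDec ω g) :
    lcDec ω (fun z => f z + g z) := fun δ hδ => (hf δ hδ).add (hg δ hδ)

lemma lcDec.const_mul {ω : ℂ} {f : ℂ → ℂ} (hf : lcDec ω f) (c : ℂ) :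
    lcDec ω (fun z => c * f z) := fun δ hδ => (hf δ hδ).const_mul_left c

lemma lcDec.id_mul {ω : ℂ} (h : lcRay ω) {f : ℂ → ℂ} (hf : lcDec ω f) :
    lcDec ω (fun z => z * f z) := by
  intro δ hδ
  obtain ⟨δ', h1, h2⟩ := exists_between hδ
  have e1 : (fun r : ℝ => (r : ℂ) * ω) =O[atTop] (fun r : ℝ => Real.exp ((δ' - δ) * r ^ 3)) := by
    refine Asymptotics.IsBigO.of_bound (1 / (δ' - δ)) ?_
    filter_upwards [eventually_ge_atTop 1] with r hr
    rw [norm_mul, h.nrm, mul_one, Complex.norm_real, Real.norm_of_nonneg (by linarith),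
      Real.norm_of_nonneg (Real.exp_pos _).le, one_div, ← div_eq_inv_mul, le_div_iff₀ (by linarith)]
    have := Real.add_one_le_exp ((δ' - δ) * r ^ 3)
    have i1 : r ≤ r ^ 3 := le_self_pow₀ hr (by norm_num)
    have := mul_le_mul_of_nonneg_right i1 (show 0 ≤ δ' - δ by linarith)
    linarith
  have := e1.mul (hf δ' h2)
  refine this.congr_right fun r => ?_
  rw [← Real.exp_add]; ring_nf

lemma lcDec.poly_mul {ω : ℂ} (h : lcRay ω) {f : ℂ → ℂ} (hf : lcDec ω f) (p : Polynomial ℂ) :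
    lcDec ω (fun z => p.eval z * f z) := by
  induction p using Polynomial.induction_on' with
  | add p q hp hq =>
    have := hp.add hq
    simpa only [eval_add, add_mul] using this
  | monomial n a =>
    induction n with
    | zero => simpa using hf.const_mul a
    | succ n ih =>
      have := ih.id_mul h
      refine (congrArg (lcDec ω) ?_).mp this
      funext z
      simp only [eval_monomial]
      ring

lemma lc_exp_ray {ω : ℂ} (h : lcRay ω) (b : ℂ) (c δ : ℝ) (hδ : δ < c / 3) :
    (fun r : ℝ => Complex.exp (c * ((r * ω) ^ 3 / 3 - b * (r * ω)))) =O[atTop]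
      (fun r : ℝ => Real.exp (-δ * r ^ 3)) := by
  refine Asymptotics.IsBigO.of_bound 1 ?_
  filter_upwards [eventually_ge_atTop 1, eventually_ge_atTop (|c| * ‖b‖ / (c / 3 - δ))] with r hr hr2
  rw [one_mul, Complex.norm_exp, Real.norm_of_nonneg (Real.exp_pos _).le]
  rw [Real.exp_le_exp]
  have e1 : (c * ((r * ω) ^ 3 / 3 - b * (r * ω)) : ℂ) =
      ((-c * r ^ 3 / 3 : ℝ) : ℂ) + ((r : ℝ) : ℂ) * (-(c * b * ω)) := by
    rw [mul_pow, h.cube]; push_cast; ring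
  rw [e1, Complex.add_re, Complex.ofReal_re, Complex.re_ofReal_mul]
  have e2 : (-(c * b * ω)).re ≤ |c| * ‖b‖ := by
    refine (Complex.re_le_norm _).trans ?_
    rw [norm_neg, norm_mul, norm_mul, h.nrm, mul_one, Complex.norm_real, Real.norm_eq_abs]
  have hε : 0 < c / 3 - δ := by linarith
  rw [div_le_iff₀ hε] at hr2
  have e3 : |c| * ‖b‖ ≤ r ^ 2 * (c / 3 - δ) := by
    refine hr2.trans ?_
    gcongr
    exact le_self_pow₀ hr (by norm_num)
  have := mul_le_mul_of_nonneg_left (e2.trans e3) (show 0 ≤ r by linarith)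
  nlinarith

lemma lc_exp_dec {ω : ℂ} (h : lcRay ω) (b : ℂ) :
    lcDec ω (fun z => Complex.exp (2 * (z ^ 3 / 3 - b * z))) := by
  intro δ hδ
  simpa using lc_exp_ray h b 2 δ hδ

lemma lc_prim_dec {ω : ℂ} (h : lcRay ω) (F f : ℂ → ℂ) (L : ℂ) (hF : ∀ z, HasDerivAt F (f z) z)
    (hf : lcDec ω f) (hL : Tendsto (fun R : ℝ => F (R * ω)) atTop (nhds L)) :
    lcDec ω (fun z => F z - L) := by
  intro δ hδ
  set δ' := max δ (1 / 3) with hδ'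
  have hpos : 0 < δ' := lt_of_lt_of_le (by norm_num) (le_max_right _ _)
  have hlt : δ' < 2 / 3 := max_lt hδ (by norm_num)
  obtain ⟨C, hC, hb⟩ := (hf δ' hlt).exists_pos
  obtain ⟨r0, hr0⟩ := eventually_atTop.1 hb.bound
  refine Asymptotics.IsBigO.of_bound (C / (3 * δ')) ?_
  filter_upwards [eventually_ge_atTop 1, eventually_ge_atTop r0] with r hr1 hrr
  have hder : ∀ s : ℝ, HasDerivAt (fun s : ℝ => F (s * ω) - F (r * ω)) (f (s * ω) * ω) s := by
    intro s
    have h3 : HasDerivAt (fun s : ℝ => (s:ℂ) * ω) ω s := by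
      have := ((Complex.ofRealCLM.hasDerivAt (x := s)).mul_const ω)
      simpa using this
    exact ((hF _).comp_of_eq s h3 rfl).sub_const _
  have hB : ∀ s : ℝ, HasDerivAt (fun s : ℝ => C / (3 * δ') * (Real.exp (-δ' * r ^ 3) - Real.exp (-δ' * s ^ 3)))
      (C * s ^ 2 * Real.exp (-δ' * s ^ 3)) s := by
    intro s
    have h1 : HasDerivAt (fun s : ℝ => -δ' * s ^ 3) (-δ' * (3 * s ^ 2)) s := by
      simpa using (hasDerivAt_pow 3 s).const_mul (-δ')
    have h2 := (h1.exp.const_sub (Real.exp (-δ' * r ^ 3))).const_mul (C / (3 * δ'))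
    convert! h2 using 1
    field_simp
  have key : ∀ R : ℝ, r ≤ R → ‖F (R * ω) - F (r * ω)‖ ≤ C / (3 * δ') * Real.exp (-δ' * r ^ 3) := by
    intro R hR
    have := image_norm_le_of_norm_deriv_right_le_deriv_boundary (a := r) (b := R)
      (f := fun s : ℝ => F (s * ω) - F (r * ω)) (f' := fun s : ℝ => f (s * ω) * ω)
      (fun s _ => (hder s).continuousAt.continuousWithinAt) (fun s _ => (hder s).hasDerivWithinAt)
      (B := fun s : ℝ => C / (3 * δ') * (Real.exp (-δ' * r ^ 3) - Real.exp (-δ' * s ^ 3)))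
      (B' := fun s => C * s ^ 2 * Real.exp (-δ' * s ^ 3)) (by simp) hB ?_ (Set.right_mem_Icc.2 hR)
    · refine this.trans ?_
      gcongr
      linarith [Real.exp_pos (-δ' * R ^ 3)]
    · intro s hs
      rw [norm_mul, h.nrm, mul_one]
      have h1 := hr0 s (hrr.trans hs.1)
      rw [Real.norm_of_nonneg (Real.exp_pos _).le] at h1
      refine h1.trans ?_
      have hs1 : 1 ≤ s := hr1.trans hs.1
      have : 1 ≤ s ^ 2 := one_le_pow₀ hs1
      have h3 : C ≤ C * s ^ 2 := le_mul_of_one_le_right hC.le this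
      gcongr
  have hlim : ‖L - F (r * ω)‖ ≤ C / (3 * δ') * Real.exp (-δ' * r ^ 3) := by
    refine le_of_tendsto ((hL.sub_const _).norm) ?_
    filter_upwards [eventually_ge_atTop r] with R hR using key R hR
  rw [norm_sub_rev, Real.norm_of_nonneg (Real.exp_pos _).le]
  refine hlim.trans ?_
  gcongr
  exact le_max_left _ _

/-- The chain of iterated primitives. -/
def lcChain (ω ω' b μ : ℂ) (n k : ℕ) : Prop :=
  ∃ g0 g1 g2 g0' : ℂ → ℂ, (∀ z, HasDerivAt g0 (g0' z) z) ∧ (∀ z, HasDerivAt g1 (g0 z) z) ∧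
    (∀ z, HasDerivAt g2 (g1 z) z) ∧ (lcDec ω g0 ∧ lcDec ω g1 ∧ lcDec ω g2) ∧
    (lcDec ω' g0 ∧ lcDec ω' g1 ∧ lcDec ω' g2) ∧ (∃ z, g2 z ≠ 0) ∧
    ∀ z, g0' z - 2 * (z ^ 2 - b) * g0 z + ((-2 * (n + 2) + 4 * k) * z + μ) * g1 z
      + 2 * k * (n + 1 - k) * g2 z = 0

lemma lc_comb_dec {ω : ℂ} (h : lcRay ω) (b c μ e : ℂ) {g0 g1 g2 : ℂ → ℂ}
    (h0 : lcDec ω g0) (h1 : lcDec ω g1) (h2 : lcDec ω g2) :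
    lcDec ω (fun z => e * (g0 z - 2 * (z ^ 2 - b) * g1 z + (c * z + μ) * g2 z)) := by
  have q1 := lcDec.poly_mul h h1 (C (-2) * (X ^ 2 - C b))
  have q2 := lcDec.poly_mul h h2 (C c * X + C μ)
  have := ((h0.add q1).add q2).const_mul e
  convert this using 2 with z
  simp
  ring_nf
  simp

lemma lc_comb_deriv (b c μ : ℂ) {g0 g1 g2 g0' : ℂ → ℂ} (z : ℂ)
    (h0 : HasDerivAt g0 (g0' z) z) (h1 : HasDerivAt g1 (g0 z) z) (h2 : HasDerivAt g2 (g1 z) z) :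
    HasDerivAt (fun z => g0 z - 2 * (z ^ 2 - b) * g1 z + (c * z + μ) * g2 z)
      (g0' z - 2 * (z ^ 2 - b) * g0 z + ((c - 4) * z + μ) * g1 z + c * g2 z) z := by
  have a1 : HasDerivAt (fun z : ℂ => 2 * (z ^ 2 - b)) (4 * z) z := by
    have := (((hasDerivAt_id z).pow 2).sub_const b).const_mul 2
    refine HasDerivAt.congr_deriv (this) ?_
    simp; ring
  have a2 : HasDerivAt (fun z : ℂ => c * z + μ) c z := by
    simpa using ((hasDerivAt_id z).const_mul c).add_const μ
  have := (h0.sub (a1.mul h1)).add (a2.mul h2)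
  refine HasDerivAt.congr_deriv (this) ?_
  ring

lemma lcChain.step {ω ω' b μ : ℂ} (h : lcRay ω) (h' : lcRay ω') {n k : ℕ} (hk : k + 1 ≤ n)
    (H : lcChain ω ω' b μ n k) : lcChain ω ω' b μ n (k + 1) := by
  obtain ⟨g0, g1, g2, g0', d0, d1, d2, ⟨e0, e1, e2⟩, ⟨f0, f1, f2⟩, ⟨z0, hz0⟩, ode⟩ := H
  obtain ⟨m, rfl⟩ := Nat.exists_eq_add_of_le hk
  set c : ℂ := -2 * (((k + 1 + m : ℕ) : ℂ) + 2) + 4 * ((k + 1 : ℕ) : ℂ) with hc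
  set d : ℂ := 2 * ((k : ℂ) + 1) * (m + 1) with hd
  have hd0 : d ≠ 0 := by
    have a1 : (k : ℂ) + 1 ≠ 0 := by exact_mod_cast Nat.succ_ne_zero k
    have a2 : (m : ℂ) + 1 ≠ 0 := by exact_mod_cast Nat.succ_ne_zero m
    simp [hd, a1, a2]
  set g3 : ℂ → ℂ := fun z => (-(1 / d)) * (g0 z - 2 * (z ^ 2 - b) * g1 z + (c * z + μ) * g2 z)
    with hg3
  have d3 : ∀ z, HasDerivAt g3 (g2 z) z := by
    intro z
    have := (lc_comb_deriv b c μ z (d0 z) (d1 z) (d2 z)).const_mul (-(1 / d))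
    refine HasDerivAt.congr_deriv (this) ?_
    have o := ode z
    have : g0' z - 2 * (z ^ 2 - b) * g0 z + ((c - 4) * z + μ) * g1 z + c * g2 z = - d * g2 z := by
      rw [hc, hd]
      push_cast at o ⊢
      linear_combination o
    rw [this]
    field_simp
  refine ⟨g1, g2, g3, g0, d1, d2, d3, ⟨e1, e2, lc_comb_dec h b c μ _ e0 e1 e2⟩,
    ⟨f1, f2, lc_comb_dec h' b c μ _ f0 f1 f2⟩, ?_, ?_⟩
  · by_contra hcon
    push Not at hcon
    have : g3 = fun _ => 0 := funext hcon
    have q := d3 z0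
    rw [this] at q
    exact hz0 (q.unique (hasDerivAt_const z0 (0 : ℂ)))
  · intro z
    have : d * g3 z = -(g0 z - 2 * (z ^ 2 - b) * g1 z + (c * z + μ) * g2 z) := by
      simp only [hg3]; field_simp
    have hd' : 2 * ((k + 1 : ℕ) : ℂ) * (((k + 1 + m : ℕ) : ℂ) + 1 - ((k + 1 : ℕ) : ℂ)) = d := by
      rw [hd]; push_cast; ring
    rw [hd', this, hc]; ring

lemma lcChain.all {ω ω' b μ : ℂ} (h : lcRay ω) (h' : lcRay ω') {n : ℕ}
    (H : lcChain ω ω' b μ n 0) : ∀ k ≤ n, lcChain ω ω' b μ n k := by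
  intro k
  induction k with
  | zero => intro _; exact H
  | succ k ih => intro hk; exact (ih (by omega)).step h h' hk

lemma lcDec.tendsto {ω : ℂ} {f : ℂ → ℂ} (hf : lcDec ω f) :
    Tendsto (fun r : ℝ => f (r * ω)) atTop (nhds 0) := by
  refine (hf (1 / 2) (by norm_num)).trans_tendsto ?_
  refine Real.tendsto_exp_atBot.comp ?_
  exact (tendsto_pow_atTop (by norm_num)).const_mul_atTop_of_neg (by norm_num)

lemma lcDec.tendsto_exp {ω : ℂ} (h : lcRay ω) (b : ℂ) {f : ℂ → ℂ} (hf : lcDec ω f) :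
    Tendsto (fun r : ℝ => f (r * ω) * exp (-((r * ω) ^ 3 / 3 - b * (r * ω)))) atTop (nhds 0) := by
  have e1 := lc_exp_ray h b (-1) (-5 / 12) (by norm_num)
  have e2 := (hf (1 / 2) (by norm_num)).mul e1
  have e3 : Tendsto (fun r : ℝ => Real.exp (-(1 / 2) * r ^ 3) * Real.exp (-(-5 / 12) * r ^ 3))
      atTop (nhds 0) := by
    have : Tendsto (fun r : ℝ => Real.exp (-(1 / 12) * r ^ 3)) atTop (nhds 0) :=
      Real.tendsto_exp_atBot.comp
        ((tendsto_pow_atTop (by norm_num)).const_mul_atTop_of_neg (by norm_num))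
    refine this.congr fun r => ?_
    rw [← Real.exp_add]; ring_nf
  refine (e2.trans_tendsto e3).congr fun r => ?_
  congr 2
  push_cast; ring

lemma lc_h_deriv (b z : ℂ) (c : ℂ) :
    HasDerivAt (fun z => exp (c * (z ^ 3 / 3 - b * z)))
      (c * (z ^ 2 - b) * exp (c * (z ^ 3 / 3 - b * z))) z := by
  have : HasDerivAt (fun z : ℂ => c * (z ^ 3 / 3 - b * z)) (c * (z ^ 2 - b)) z := by
    have := ((((hasDerivAt_id z).pow 3).div_const 3).sub
      ((hasDerivAt_id z).const_mul b)).const_mul c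
    refine HasDerivAt.congr_deriv (this) ?_
    simp
  refine HasDerivAt.congr_deriv (this.cexp) ?_
  ring

lemma lc_mul_deriv (b c : ℂ) {f f' : ℂ → ℂ} (z : ℂ) (hf : HasDerivAt f (f' z) z) :
    HasDerivAt (fun z => f z * exp (c * (z ^ 3 / 3 - b * z)))
      ((f' z + c * (z ^ 2 - b) * f z) * exp (c * (z ^ 3 / 3 - b * z))) z := by
  refine HasDerivAt.congr_deriv (hf.mul (lc_h_deriv b z c)) ?_
  ring

lemma lc_comb2 (b c : ℂ) {f f' f'' : ℂ → ℂ} (z : ℂ) (hf : HasDerivAt f (f' z) z)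
    (hf' : HasDerivAt f' (f'' z) z) :
    HasDerivAt (fun z => f' z + c * (z ^ 2 - b) * f z)
      (f'' z + c * (z ^ 2 - b) * f' z + c * (2 * z) * f z) z := by
  have a1 : HasDerivAt (fun z : ℂ => c * (z ^ 2 - b)) (c * (2 * z)) z := by
    have := (((hasDerivAt_id z).pow 2).sub_const b).const_mul c
    refine HasDerivAt.congr_deriv (this) ?_
    simp
  refine HasDerivAt.congr_deriv (hf'.add (a1.mul hf)) ?_
  ring

lemma lc_second (b c : ℂ) {f f' f'' : ℂ → ℂ} (hf : ∀ z, HasDerivAt f (f' z) z)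
    (hf' : ∀ z, HasDerivAt f' (f'' z) z) (z : ℂ) :
    deriv (deriv (fun z => f z * exp (c * (z ^ 3 / 3 - b * z)))) z =
      (f'' z + 2 * c * (z ^ 2 - b) * f' z + (c * (2 * z) + c ^ 2 * (z ^ 2 - b) ^ 2) * f z) *
        exp (c * (z ^ 3 / 3 - b * z)) := by
  have e1 : deriv (fun z => f z * exp (c * (z ^ 3 / 3 - b * z))) =
      fun z => (f' z + c * (z ^ 2 - b) * f z) * exp (c * (z ^ 3 / 3 - b * z)) :=
    funext fun z => (lc_mul_deriv b c z (hf z)).deriv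
  rw [e1]
  have := lc_mul_deriv (f := fun z => f' z + c * (z ^ 2 - b) * f z)
    (f' := fun z => f'' z + c * (z ^ 2 - b) * f' z + c * (2 * z) * f z) b c z
    (lc_comb2 b c z (hf z) (hf' z))
  rw [this.deriv]
  ring

lemma lc_witness (n : ℕ) (b μ : ℂ) (p : Polynomial ℂ) (hp : p ≠ 0)
    (ode : ∀ z, p.derivative.derivative.eval z + 2 * (z ^ 2 - b) * p.derivative.eval z
      - (2 * n * z - μ) * p.eval z = 0) : QESWitness ((n : ℂ) + 1) b (μ - b ^ 2) p := by
  refine ⟨hp, fun z => ?_⟩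
  have e : qesFun b p = fun z => p.eval z * exp (1 * (z ^ 3 / 3 - b * z)) := by
    funext z; simp [qesFun]
  rw [e, lc_second b 1 (fun z => p.hasDerivAt z) (fun z => p.derivative.hasDerivAt z) z]
  linear_combination (-exp (1 * (z ^ 3 / 3 - b * z))) * ode z

lemma lc_eigen {ω ω' b μ : ℂ} (h : lcRay ω) (h' : lcRay ω') {n : ℕ}
    (H : lcChain ω ω' b μ n n) : ∃ y : ℂ → ℂ, Differentiable ℂ y ∧ y ≠ 0 ∧
      SatisfiesQuarticODE (-((n : ℂ) + 1)) b (μ - b ^ 2) y ∧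
      Tendsto (fun r : ℝ => y (r * ω)) atTop (nhds 0) ∧
      Tendsto (fun r : ℝ => y (r * ω')) atTop (nhds 0) := by
  obtain ⟨g0, g1, g2, g0', d0, d1, d2, ⟨e0, e1, e2⟩, ⟨f0, f1, f2⟩, ⟨z0, hz0⟩, ode⟩ := H
  set W : ℂ → ℂ := fun z => g0 z - 2 * (z ^ 2 - b) * g1 z + ((2 * n) * z + μ) * g2 z with hW
  have dW : ∀ z, HasDerivAt W 0 z := by
    intro z
    have := lc_comb_deriv b (2 * n) μ z (d0 z) (d1 z) (d2 z)
    refine HasDerivAt.congr_deriv (this) ?_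
    have o := ode z
    linear_combination o
  have W0 : ∀ z, W z = 0 := by
    have cst : ∀ z w, W z = W w := is_const_of_deriv_eq_zero
      (fun z => (dW z).differentiableAt) (fun z => (dW z).deriv)
    intro z
    have t := (lc_comb_dec h b (2 * n) μ 1 e0 e1 e2).tendsto
    have t2 : Tendsto (fun r : ℝ => W z) atTop (nhds 0) := by
      refine t.congr fun r => ?_
      rw [one_mul, cst z (r * ω)]
    exact tendsto_nhds_unique tendsto_const_nhds t2
  refine ⟨fun z => g2 z * exp ((-1) * (z ^ 3 / 3 - b * z)), ?_, ?_, ?_, ?_, ?_⟩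
  · intro z
    exact (lc_mul_deriv b (-1) z (d2 z)).differentiableAt
  · intro hcon
    have := congrFun hcon z0
    simp [hz0] at this
  · intro z
    rw [lc_second b (-1) d2 d1 z]
    have := W0 z
    simp only [hW] at this
    linear_combination (-exp (-1 * (z ^ 3 / 3 - b * z))) * this
  · simpa using e2.tendsto_exp h b
  · simpa using f2.tendsto_exp h' b

lemma lc_poly_limit {ω : ℂ} (h : lcRay ω) (b : ℂ) (p : Polynomial ℂ) (F : ℂ → ℂ)
    (hF : ∀ z, HasDerivAt F (p.eval z * exp (2 * (z ^ 3 / 3 - b * z))) z) :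
    Tendsto (fun R : ℝ => F (R * ω)) atTop
      (nhds (F 0 + ∑ k ∈ Finset.range (p.natDegree + 1), p.coeff k * lcM ω k b)) := by
  have key : ∀ s : ℝ, p.eval (s * ω) * exp (2 * ((s * ω) ^ 3 / 3 - b * (s * ω))) * ω =
      ∑ k ∈ Finset.range (p.natDegree + 1), p.coeff k * (lcf b k (s * ω) * ω) := by
    intro s
    rw [eval_eq_sum_range, Finset.sum_mul, Finset.sum_mul]
    refine Finset.sum_congr rfl fun k _ => ?_
    unfold lcf; ring
  have hintg : ∀ k, MeasureTheory.IntegrableOn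
      (fun s : ℝ => p.coeff k * (lcf b k (s * ω) * ω)) (Set.Ioi 0) :=
    fun k => (lcf_int h b k).const_mul _
  have := lc_prim_tendsto F (fun z => p.eval z * exp (2 * (z ^ 3 / 3 - b * z))) hF
    (by fun_prop) 0 ω (by
      simp only [zero_add, key]
      exact MeasureTheory.integrable_finsetSum _ fun k _ => hintg k)
  simp only [zero_add, key] at this
  rw [MeasureTheory.integral_finsetSum _ (fun k _ => hintg k)] at this
  simpa only [MeasureTheory.integral_const_mul, lcM] using this

set_option maxHeartbeats 1000000 in
lemma lc_base {ω ω' b μ : ℂ} (h : lcRay ω) (h' : lcRay ω') {n : ℕ} (p : Polynomial ℂ) (hp : p ≠ 0)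
    (ode : ∀ z, p.derivative.derivative.eval z + 2 * (z ^ 2 - b) * p.derivative.eval z
      - (2 * n * z - μ) * p.eval z = 0)
    (hm : ∑ k ∈ Finset.range (p.natDegree + 1), p.coeff k * (lcM ω k b - lcM ω' k b) = 0) :
    lcChain ω ω' b μ n 0 := by
  set φ : ℂ → ℂ := fun z => p.eval z * exp (2 * (z ^ 3 / 3 - b * z)) with hφ
  have dφ : Differentiable ℂ φ := by simp only [hφ]; fun_prop
  obtain ⟨F, hF⟩ : ∃ F : ℂ → ℂ, ∀ z, HasDerivAt F (φ z) z := by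
    obtain ⟨F, hF⟩ := dφ.isExactOn_univ
    exact ⟨F, fun z => hF z (Set.mem_univ z)⟩
  have l1 := lc_poly_limit h b p F hF
  have l2 := lc_poly_limit h' b p F hF
  set L := F 0 + ∑ k ∈ Finset.range (p.natDegree + 1), p.coeff k * lcM ω k b with hL
  have hLL : F 0 + ∑ k ∈ Finset.range (p.natDegree + 1), p.coeff k * lcM ω' k b = L := by
    simp only [mul_sub, Finset.sum_sub_distrib] at hm
    rw [hL]; linear_combination -hm
  rw [hLL] at l2
  have dec : ∀ w, lcRay w → ∀ q : Polynomial ℂ,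
      lcDec w (fun z => q.eval z * exp (2 * (z ^ 3 / 3 - b * z))) :=
    fun w hw q => (lc_exp_dec hw b).poly_mul hw q
  set φ1 : ℂ → ℂ := fun z => (p.derivative.eval z + 2 * (z ^ 2 - b) * p.eval z) *
    exp (2 * (z ^ 3 / 3 - b * z)) with hφ1
  have dec1 : ∀ w, lcRay w → lcDec w φ1 := by
    intro w hw
    have := dec w hw (p.derivative + C 2 * (X ^ 2 - C b) * p)
    convert this using 2 with z
    simp [hφ1]
  have D1 : ∀ z, HasDerivAt φ (φ1 z) z := fun z =>
    lc_mul_deriv (f := fun z => p.eval z) (f' := fun z => p.derivative.eval z) b 2 z (p.hasDerivAt z)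
  have D2 : ∀ z, HasDerivAt φ1 ((p.derivative.derivative.eval z
      + 2 * (z ^ 2 - b) * p.derivative.eval z + 2 * (2 * z) * p.eval z
      + 2 * (z ^ 2 - b) * (p.derivative.eval z + 2 * (z ^ 2 - b) * p.eval z)) *
      exp (2 * (z ^ 3 / 3 - b * z))) z := fun z =>
    lc_mul_deriv (f := fun z => p.derivative.eval z + 2 * (z ^ 2 - b) * p.eval z)
    (f' := fun z => p.derivative.derivative.eval z
      + 2 * (z ^ 2 - b) * p.derivative.eval z + 2 * (2 * z) * p.eval z) b 2 z
    (lc_comb2 (f := fun z => p.eval z) (f' := fun z => p.derivative.eval z)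
      (f'' := fun z => p.derivative.derivative.eval z) b 2 z (p.hasDerivAt z)
      (p.derivative.hasDerivAt z))
  refine ⟨φ1, φ, fun z => F z - L, _, D2, D1, fun z => (hF z).sub_const L,
    ⟨dec1 ω h, dec ω h p, lc_prim_dec h F φ L hF (dec ω h p) l1⟩,
    ⟨dec1 ω' h', dec ω' h' p, lc_prim_dec h' F φ L hF (dec ω' h' p) l2⟩, ?_, ?_⟩
  · by_contra hcon
    push Not at hcon
    apply hp
    refine Polynomial.funext fun z => ?_
    have q := (hF z).sub_const L
    have e : (fun z => F z - L) = fun _ => 0 := funext hcon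
    rw [e] at q
    have := q.unique (hasDerivAt_const z (0 : ℂ))
    simpa [hφ] using this
  · intro z
    simp only [hφ, hφ1]
    push_cast
    linear_combination exp (2 * (z ^ 3 / 3 - b * z)) * ode z

/-- Constant part of the QES matrix -/
def lcA (n k j : ℕ) : ℂ := (if j + 1 = k then 2 * ((n : ℂ) - j) else 0)
  - (if j = k + 2 then ((k : ℂ) + 2) * (k + 1) else 0)

/-- Linear part of the QES matrix -/
def lcB (k j : ℕ) : ℂ := if j = k + 1 then 2 * ((k : ℂ) + 1) else 0

/-- The QES matrix -/
def lcMat (n : ℕ) (b : ℂ) : Matrix (Fin (n + 1)) (Fin (n + 1)) ℂ :=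
  Matrix.of fun k j => lcA n k j + b * lcB k j

/-- Observability lemma -/
lemma lc_observe (N : ℕ) (M : Matrix (Fin (N + 1)) (Fin (N + 1)) ℂ) (m : Fin (N + 1) → ℂ)
    (hdet : (Matrix.of fun i : Fin (N + 1) => Matrix.vecMul m (M ^ (i : ℕ))).det = 0) :
    ∃ v : Fin (N + 1) → ℂ, v ≠ 0 ∧ m ⬝ᵥ v = 0 ∧ ∃ μ : ℂ, M.mulVec v = μ • v := by
  obtain ⟨a, ha0, ha⟩ := Matrix.exists_mulVec_eq_zero_iff.mpr hdet
  have h1 : ∀ i < N + 1, m ⬝ᵥ (M ^ i).mulVec a = 0 := by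
    intro i hi
    have := congrFun ha ⟨i, hi⟩
    rw [Matrix.dotProduct_mulVec]
    exact this
  have h2 : ∀ i, m ⬝ᵥ (M ^ i).mulVec a = 0 := by
    intro i
    have hd : (X ^ i %ₘ M.charpoly).natDegree < N + 1 := by
      have := Polynomial.natDegree_modByMonic_lt (X ^ i) (Matrix.charpoly_monic M) (by
        intro h
        have := Matrix.charpoly_natDegree_eq_dim M
        rw [h] at this
        simp at this)
      simpa [Matrix.charpoly_natDegree_eq_dim] using this
    rw [Matrix.pow_eq_aeval_mod_charpoly, Polynomial.aeval_eq_sum_range' hd, Matrix.sum_mulVec,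
      dotProduct_sum]
    refine Finset.sum_eq_zero fun j hj => ?_
    rw [Matrix.smul_mulVec, dotProduct_smul, h1 j (Finset.mem_range.mp hj), smul_zero]
  let W : Submodule ℂ (Fin (N + 1) → ℂ) :=
    { carrier := {v | ∀ i, m ⬝ᵥ (M ^ i).mulVec v = 0}
      add_mem' := by
        intro u v hu hv i
        rw [Matrix.mulVec_add, dotProduct_add, hu i, hv i, add_zero]
      zero_mem' := by intro i; simp
      smul_mem' := by
        intro c u hu i
        rw [Matrix.mulVec_smul, dotProduct_smul, hu i, smul_zero] }
  have hinv : ∀ v ∈ W, Matrix.mulVecLin M v ∈ W := by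
    intro v hv i
    have := hv (i + 1)
    rw [pow_succ, ← Matrix.mulVec_mulVec] at this
    exact this
  have hnt : Nontrivial W := by
    refine ⟨⟨⟨a, h2⟩, 0, fun h => ha0 ?_⟩⟩
    exact congrArg Subtype.val h
  obtain ⟨μ, hμ⟩ := Module.End.exists_eigenvalue ((Matrix.mulVecLin M).restrict hinv)
  obtain ⟨v, hv⟩ := hμ.exists_hasEigenvector
  refine ⟨v, ?_, ?_, μ, ?_⟩
  · intro h
    exact hv.2 (Subtype.ext h)
  · have := v.2 0
    simpa using this
  · have := congrArg Subtype.val hv.apply_eq_smul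
    simpa using this

/-- extension by zero -/
noncomputable def lcExt {n : ℕ} (a : Fin (n + 1) → ℂ) (j : ℕ) : ℂ :=
  if h : j < n + 1 then a ⟨j, h⟩ else 0

lemma lcExt_fin {n : ℕ} (a : Fin (n + 1) → ℂ) (j : Fin (n + 1)) : lcExt a j = a j := by
  simp only [lcExt, dif_pos j.2]

lemma lcExt_ge {n : ℕ} (a : Fin (n + 1) → ℂ) {j : ℕ} (h : n < j) : lcExt a j = 0 := by
  simp [lcExt]; omega

lemma lcExt_sum {n : ℕ} (a : Fin (n + 1) → ℂ) (c : ℕ → ℂ) :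
    ∑ j : Fin (n + 1), c j * a j = ∑ j ∈ Finset.range (n + 1), c j * lcExt a j := by
  rw [← Fin.sum_univ_eq_sum_range (fun j => c j * lcExt a j)]
  simp [lcExt_fin]

lemma lcExt_pick {n : ℕ} (a : Fin (n + 1) → ℂ) (c : ℂ) (t : ℕ) :
    ∑ j ∈ Finset.range (n + 1), (if j = t then c else 0) * lcExt a j = c * lcExt a t := by
  simp only [ite_mul, zero_mul]
  rw [Finset.sum_ite_eq']
  split_ifs with h
  · rfl
  · rw [lcExt_ge a (by simp at h; omega), mul_zero]

lemma lc_row (n : ℕ) (b : ℂ) (a : Fin (n + 1) → ℂ) (k : ℕ) :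
    ∑ j ∈ Finset.range (n + 1), (lcA n k j + b * lcB k j) * lcExt a j =
      (∑ j ∈ Finset.range (n + 1), (if j + 1 = k then 2 * ((n : ℂ) - j) else 0) * lcExt a j)
      - ((k : ℂ) + 2) * (k + 1) * lcExt a (k + 2) + b * (2 * ((k : ℂ) + 1) * lcExt a (k + 1)) := by
  rw [← lcExt_pick a (((k : ℂ) + 2) * (k + 1)) (k + 2), ← lcExt_pick a (2 * ((k : ℂ) + 1)) (k + 1),
    Finset.mul_sum, ← Finset.sum_sub_distrib, ← Finset.sum_add_distrib]
  refine Finset.sum_congr rfl fun j _ => ?_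
  unfold lcA lcB
  ring

lemma lc_rec (n : ℕ) (b μ : ℂ) (a : Fin (n + 1) → ℂ) (h : (lcMat n b).mulVec a = μ • a)
    (k : ℕ) (hk : k < n + 1) :
    (∑ j ∈ Finset.range (n + 1), (if j + 1 = k then 2 * ((n : ℂ) - j) else 0) * lcExt a j)
      - ((k : ℂ) + 2) * (k + 1) * lcExt a (k + 2) + b * (2 * ((k : ℂ) + 1) * lcExt a (k + 1))
      = μ * lcExt a k := by
  have := congrFun h ⟨k, hk⟩
  simp only [Matrix.mulVec, dotProduct, lcMat, Matrix.of_apply, Pi.smul_apply, smul_eq_mul] at this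
  rw [lcExt_sum a (fun j => lcA n k j + b * lcB k j), lc_row] at this
  have e0 : a ⟨k, hk⟩ = lcExt a k := by simp only [lcExt, dif_pos hk]
  rw [e0] at this
  exact this

lemma lc_rec0 (n : ℕ) (b μ : ℂ) (a : Fin (n + 1) → ℂ) (h : (lcMat n b).mulVec a = μ • a) :
    -2 * lcExt a 2 + 2 * b * lcExt a 1 = μ * lcExt a 0 := by
  have := lc_rec n b μ a h 0 (by omega)
  simp only [Nat.succ_ne_zero, if_false, zero_mul, Finset.sum_const_zero, Nat.cast_zero,
    zero_add] at this
  linear_combination this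

lemma lc_rec1 (n : ℕ) (b μ : ℂ) (a : Fin (n + 1) → ℂ) (h : (lcMat n b).mulVec a = μ • a) (k : ℕ) :
    2 * ((n : ℂ) - k) * lcExt a k - (k + 3) * (k + 2) * lcExt a (k + 3)
      + 2 * b * (k + 2) * lcExt a (k + 2) = μ * lcExt a (k + 1) := by
  by_cases hk : k + 1 < n + 1
  · have := lc_rec n b μ a h (k + 1) hk
    have e : ∑ j ∈ Finset.range (n + 1), (if j + 1 = k + 1 then 2 * ((n : ℂ) - j) else 0)
        * lcExt a j = 2 * ((n : ℂ) - k) * lcExt a k := by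
      rw [← lcExt_pick a]
      refine Finset.sum_congr rfl fun j _ => ?_
      by_cases hj : j = k
      · subst hj; simp
      · simp [hj]
    rw [e] at this
    push_cast at this
    rw [← this]
    ring
  · rw [lcExt_ge a (j := k + 1) (by omega), lcExt_ge a (j := k + 2) (by omega),
      lcExt_ge a (j := k + 3) (by omega)]
    by_cases hn : k = n
    · subst hn; ring
    · rw [lcExt_ge a (j := k) (by omega)]; ring

/-- The polynomial attached to a vector -/
noncomputable def lcPoly {n : ℕ} (a : Fin (n + 1) → ℂ) : Polynomial ℂ :=
  ∑ j ∈ Finset.range (n + 1), C (lcExt a j) * X ^ j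

lemma lcPoly_coeff {n : ℕ} (a : Fin (n + 1) → ℂ) (k : ℕ) : (lcPoly a).coeff k = lcExt a k := by
  unfold lcPoly
  simp only [finsetSum_coeff, coeff_C_mul, coeff_X_pow, mul_ite, mul_one, mul_zero]
  rw [Finset.sum_ite_eq]
  split_ifs with h
  · rfl
  · rw [lcExt_ge]; simp at h; omega

lemma lcPoly_ode (n : ℕ) (b μ : ℂ) (a : Fin (n + 1) → ℂ) (h : (lcMat n b).mulVec a = μ • a) :
    (lcPoly a).derivative.derivative + C 2 * (X * (X * (lcPoly a).derivative))
      - C (2 * b) * (lcPoly a).derivative - C (2 * n : ℂ) * (X * lcPoly a)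
      + C μ * lcPoly a = 0 := by
  ext k
  rcases k with _ | k
  · have := lc_rec0 n b μ a h
    simp only [coeff_add, coeff_sub, coeff_C_zero, coeff_derivative, lcPoly_coeff, coeff_zero,
      mul_coeff_zero, coeff_X_zero, zero_mul, mul_zero]
    push_cast
    linear_combination -this
  · have := lc_rec1 n b μ a h k
    rcases k with _ | k
    · simp only [coeff_add, coeff_sub, coeff_C_mul, coeff_derivative, lcPoly_coeff, coeff_zero,
        coeff_X_mul, mul_coeff_zero, coeff_X_zero, zero_mul, mul_zero]
      push_cast at this ⊢
      linear_combination -this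
    · simp only [coeff_add, coeff_sub, coeff_C_mul, coeff_derivative, lcPoly_coeff, coeff_zero,
        coeff_X_mul]
      push_cast at this ⊢
      linear_combination -this

/-- The observability determinant -/
noncomputable def lcN (ω ω' : ℂ) (n : ℕ) (b : ℂ) : ℂ :=
  (Matrix.of fun i : Fin (n + 1) =>
    Matrix.vecMul (fun k : Fin (n + 1) => lcM ω k b - lcM ω' k b) (lcMat n b ^ (i : ℕ))).det

lemma lcD_obs {ω ω' : ℂ} (h : lcRay ω) (h' : lcRay ω') (n i : ℕ) (j : Fin (n + 1)) :
    lcD (fun b => Matrix.vecMul (fun k : Fin (n + 1) => lcM ω k b - lcM ω' k b)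
      (lcMat n b ^ i) j) := by
  induction i generalizing j with
  | zero => simpa using lcD_moment h h' j
  | succ i ih =>
    have : lcD (fun b => ∑ k : Fin (n + 1),
        (lcA n k j * (Matrix.vecMul (fun k : Fin (n + 1) => lcM ω k b - lcM ω' k b)
          (lcMat n b ^ i) k) + b * (lcB k j * (Matrix.vecMul
          (fun k : Fin (n + 1) => lcM ω k b - lcM ω' k b) (lcMat n b ^ i) k)))) := by
      refine lcD.sum Finset.univ _ fun k _ => ?_
      exact ((ih k).const_mul _).add ((ih k).const_mul _).id_mul
    convert this using 2 with b
    rw [pow_succ, ← Matrix.vecMul_vecMul]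
    conv_lhs => rw [Matrix.vecMul, dotProduct]
    refine Finset.sum_congr rfl fun k _ => ?_
    rw [lcMat, Matrix.of_apply]
    ring

lemma lcD_N {ω ω' : ℂ} (h : lcRay ω) (h' : lcRay ω') (n : ℕ) : lcD (lcN ω ω' n) := by
  have key : ∀ σ : Equiv.Perm (Fin (n + 1)), lcD (fun b => ((Equiv.Perm.sign σ : ℤ) : ℂ) *
      ∏ i : Fin (n + 1), Matrix.vecMul (fun k : Fin (n + 1) => lcM ω k b - lcM ω' k b)
        (lcMat n b ^ ((σ i : Fin (n + 1)) : ℕ)) i) := by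
    intro σ
    refine lcD.const_mul ?_ _
    have := Finset.prod_induction_nonempty (s := (Finset.univ : Finset (Fin (n + 1))))
      (fun i => (fun b => Matrix.vecMul (fun k : Fin (n + 1) => lcM ω k b - lcM ω' k b)
        (lcMat n b ^ ((σ i : Fin (n + 1)) : ℕ)) i)) lcD (fun f g hf hg => hf.mul hg)
        Finset.univ_nonempty (fun i _ => lcD_obs h h' n _ i)
    convert this using 1
    funext b
    rw [Finset.prod_apply]
  have := lcD.sum Finset.univ _ fun σ _ => key σ
  convert this using 1
  funext b
  rw [lcN, Matrix.det_apply']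
  rfl

lemma lc_crossing {ω ω' : ℂ} (h : lcRay ω) (h' : lcRay ω') (n : ℕ) (b : ℂ)
    (hN : lcN ω ω' n b = 0) : ∃ lam : ℂ, (∃ p, QESWitness ((n : ℂ) + 1) b lam p) ∧
    ∃ y : ℂ → ℂ, Differentiable ℂ y ∧ y ≠ 0 ∧
      SatisfiesQuarticODE (-((n : ℂ) + 1)) b lam y ∧
      Tendsto (fun r : ℝ => y (r * ω)) atTop (nhds 0) ∧
      Tendsto (fun r : ℝ => y (r * ω')) atTop (nhds 0) := by
  obtain ⟨a, ha0, hma, μ, hμ⟩ := lc_observe n _ _ hN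
  have hp : lcPoly a ≠ 0 := by
    intro h0
    apply ha0
    funext j
    have := congrArg (fun q => q.coeff j) h0
    simpa [lcPoly_coeff, lcExt_fin] using this
  have ode : ∀ z, (lcPoly a).derivative.derivative.eval z
      + 2 * (z ^ 2 - b) * (lcPoly a).derivative.eval z
      - (2 * n * z - μ) * (lcPoly a).eval z = 0 := by
    intro z
    have := congrArg (eval z) (lcPoly_ode n b μ a hμ)
    simp only [eval_add, eval_sub, eval_mul, eval_C, eval_X, eval_zero] at this
    linear_combination this
  have hdeg : (lcPoly a).natDegree ≤ n := by
    rw [natDegree_le_iff_coeff_eq_zero]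
    intro k hk
    rw [lcPoly_coeff, lcExt_ge a hk]
  have hm : ∑ k ∈ Finset.range ((lcPoly a).natDegree + 1),
      (lcPoly a).coeff k * (lcM ω k b - lcM ω' k b) = 0 := by
    rw [Finset.sum_subset (Finset.range_mono (show (lcPoly a).natDegree + 1 ≤ n + 1 by omega))]
    · rw [← hma, dotProduct, lcExt_sum a (fun k => lcM ω k b - lcM ω' k b)]
      refine Finset.sum_congr rfl fun k _ => ?_
      rw [lcPoly_coeff, mul_comm]
    · intro k _ hk
      rw [coeff_eq_zero_of_natDegree_lt (by simpa using hk), zero_mul]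
  refine ⟨μ - b ^ 2, ⟨_, lc_witness n b μ _ hp ode⟩, ?_⟩
  exact lc_eigen h h' ((lc_base h h' _ hp ode hm).all h h' n le_rfl)

lemma lc_ray1 : lcRay (Complex.exp (Complex.I * (Real.pi / 3))) := by
  have e : Complex.I * (Real.pi / 3) = ((Real.pi / 3 : ℝ) : ℂ) * Complex.I := by
    push_cast; ring
  rw [e]
  refine ⟨?_, ?_⟩
  · rw [Complex.exp_ofReal_mul_I_re, Real.cos_pi_div_three]
  · rw [Complex.exp_ofReal_mul_I_im, Real.sin_pi_div_three, div_pow, Real.sq_sqrt (by norm_num)]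
    norm_num

lemma lc_ray2 : lcRay (Complex.exp (-Complex.I * (Real.pi / 3))) := by
  have e : -Complex.I * (Real.pi / 3) = ((-(Real.pi / 3) : ℝ) : ℂ) * Complex.I := by
    push_cast; ring
  rw [e]
  refine ⟨?_, ?_⟩
  · rw [Complex.exp_ofReal_mul_I_re, Real.cos_neg, Real.cos_pi_div_three]
  · rw [Complex.exp_ofReal_mul_I_im, Real.sin_neg, Real.sin_pi_div_three, neg_sq, div_pow,
      Real.sq_sqrt (by norm_num)]
    norm_num

theorem level_crossing_points_infinite (J : ℕ) (hJ : 0 < J) :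
    {q : ℂ × ℂ | q ∈ qesSpectralLocus (J : ℂ) ∧
      IsQuarticEigenvalue (-(J : ℂ)) q.1 q.2}.Infinite := by
  intro hfin
  obtain ⟨n, rfl⟩ := Nat.exists_eq_add_of_lt hJ
  have hD := lcD_N lc_ray1 lc_ray2 n
  refine lc_entire _ hD.diff hD.gr hD.dec ((hfin.image Prod.fst).subset ?_)
  intro b hb
  obtain ⟨lam, hp, hy⟩ := lc_crossing lc_ray1 lc_ray2 n b hb
  have e : ((0 + n + 1 : ℕ) : ℂ) = (n : ℂ) + 1 := by push_cast; ring
  refine ⟨(b, lam), ⟨?_, ?_⟩, rfl⟩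
  · rw [e]; exact hp
  · rw [e]; exact hy
end

section
/- For every odd positive integer J, there exists a sequence of pairwise distinct points (b_k, λ_k), k = 1, 2, 3, …, with b_k < 0 and λ_k ∈ ℝ, such that each (b_k, λ_k) ∈ Z_J^{QES} and λ_k is an eigenvalue of L_{−J}(b_k), and b_k / (−((3/4)·π·k)^{2/3}) → 1 as k → ∞. -/
open Complex Filter Polynomial

/-- A second-order operator on polynomials raising degrees by at most one. -/
noncomputable def opG {R : Type*} [CommRing R] [Algebra ℝ R] (s k : ℝ) (e m : R) (p : R[X]) : R[X] :=
  C e * derivative (derivative p) + C (algebraMap ℝ R (2 * s)) * ((X ^ 2 + 1) * derivative p)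
    + (C m - C (algebraMap ℝ R k) * X) * p

theorem opG_add {R : Type*} [CommRing R] [Algebra ℝ R] (s k : ℝ) (e m : R) (p q : R[X]) :
    opG s k e m (p + q) = opG s k e m p + opG s k e m q := by
  simp only [opG, derivative_add]; ring

theorem opG_C_mul {R : Type*} [CommRing R] [Algebra ℝ R] (s k : ℝ) (e m a : R) (p : R[X]) :
    opG s k e m (C a * p) = C a * opG s k e m p := by
  simp only [opG, derivative_C_mul]; ring

theorem opG_map {R S : Type*} [CommRing R] [Algebra ℝ R] [CommRing S] [Algebra ℝ S] (φ : R →ₐ[ℝ] S)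
    (s k : ℝ) (e m : R) (p : R[X]) :
    (opG s k e m p).map (φ : R →+* S) = opG s k (φ e) (φ m) (p.map (φ : R →+* S)) := by
  simp only [opG, Polynomial.map_add, Polynomial.map_mul, Polynomial.map_sub, Polynomial.map_C,
    Polynomial.map_X, Polynomial.map_pow, Polynomial.map_one, derivative_map]
  simp

theorem opG_monomial {R : Type*} [CommRing R] [Algebra ℝ R] (s k : ℝ) (e m a : R) (d : ℕ) :
    ∃ q : R[X], q.degree < (d + 1 : ℕ) ∧ opG s k e m (monomial d a) =
      C (algebraMap ℝ R (2 * s * d - k) * a) * X ^ (d + 1) + q := by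
  have h1 : X * derivative (monomial d a) = C (d : R) * monomial d a := by
    rcases d with _ | d
    · simp
    · rw [derivative_monomial, X_mul_monomial, C_mul_monomial]
      simp [mul_comm]
  have h2 : X * monomial d a = C a * X ^ (d + 1) := by
    rw [X_mul_monomial, C_mul_X_pow_eq_monomial]
  refine ⟨C e * derivative (derivative (monomial d a)) +
    C (algebraMap ℝ R (2 * s)) * derivative (monomial d a) + C m * monomial d a, ?_, ?_⟩
  · have h0 : (monomial d a).natDegree ≤ d := natDegree_monomial_le a
    have h3 : (derivative (monomial d a)).natDegree ≤ d := (natDegree_derivative_le _).trans (by omega)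
    have h4 : (derivative (derivative (monomial d a))).natDegree ≤ d :=
      (natDegree_derivative_le _).trans (by omega)
    have : (C e * derivative (derivative (monomial d a)) +
      C (algebraMap ℝ R (2 * s)) * derivative (monomial d a) + C m * monomial d a).natDegree ≤ d := by
      refine natDegree_add_le_of_degree_le (natDegree_add_le_of_degree_le ?_ ?_) ?_
      · exact (natDegree_C_mul_le _ _).trans h4
      · exact (natDegree_C_mul_le _ _).trans h3
      · exact (natDegree_C_mul_le _ _).trans h0
    refine lt_of_le_of_lt (degree_le_natDegree) ?_
    exact_mod_cast Nat.lt_succ_of_le this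
  · have : opG s k e m (monomial d a) = C e * derivative (derivative (monomial d a)) +
      C (algebraMap ℝ R (2 * s)) * derivative (monomial d a) + C m * monomial d a
      + C (algebraMap ℝ R (2 * s)) * (X * (X * derivative (monomial d a)))
      - C (algebraMap ℝ R k) * (X * monomial d a) := by
      simp only [opG]; ring
    rw [this, h1, mul_left_comm X, h2]
    simp only [map_sub, map_mul, map_natCast, sub_mul]
    ring

theorem opG_division {R : Type*} [CommRing R] [Algebra ℝ R] (s k : ℝ) (e m : R) (n : ℕ)
    (h : ∀ d < n, 2 * s * (d : ℝ) - k ≠ 0) :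
    ∀ d ≤ n, ∀ f : R[X], f.degree < (d + 1 : ℕ) →
      ∃ (r : R[X]) (c : R), r.degree < (d : ℕ) ∧ opG s k e m r = f + C c := by
  intro d
  induction d with
  | zero =>
    intro _ f hf
    refine ⟨0, - f.coeff 0, by simp, ?_⟩
    have : f = C (f.coeff 0) := eq_C_of_degree_le_zero (by
      rw [degree_le_iff_coeff_zero]
      intro j hj
      rw [degree_lt_iff_coeff_zero] at hf
      have hj' : 0 < j := by exact_mod_cast hj
      exact hf j (by omega))
    rw [this]; simp [opG]
  | succ d ih =>
    intro hd f hf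
    set a := f.coeff (d + 1) with ha
    obtain ⟨q, hq, hq2⟩ := opG_monomial s k e m (algebraMap ℝ R (2 * s * d - k)⁻¹ * a) d
    have hu : algebraMap ℝ R (2 * s * d - k) * (algebraMap ℝ R (2 * s * d - k)⁻¹ * a) = a := by
      rw [← mul_assoc, ← map_mul, mul_inv_cancel₀ (h d (by omega))]; simp
    rw [hu] at hq2
    have hf1 : (f - C a * X ^ (d + 1) - q).degree < ((d + 1 : ℕ) : WithBot ℕ) := by
      refine lt_of_le_of_lt (degree_sub_le _ _) (max_lt ?_ hq)
      rw [degree_lt_iff_coeff_zero] at hf ⊢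
      intro j hj
      rcases Nat.eq_or_lt_of_le hj with rfl | hj
      · simp [ha]
      · have := hf j (by omega)
        rw [coeff_sub, this, coeff_C_mul_X_pow]
        simp; omega
    obtain ⟨r, c, hr, hrc⟩ := ih (by omega) _ hf1
    refine ⟨r + monomial d (algebraMap ℝ R (2 * s * d - k)⁻¹ * a), c, ?_, ?_⟩
    · refine lt_of_le_of_lt (degree_add_le _ _) (max_lt (hr.trans ?_) ?_)
      · exact_mod_cast Nat.lt_succ_self d
      · refine lt_of_le_of_lt (degree_monomial_le _ _) ?_
        exact_mod_cast Nat.lt_succ_self d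
    · rw [opG_add, hrc, hq2]; ring


/-- The universal QES polynomial, together with reduction of second solutions. -/
theorem universal_qes (n : ℕ) :
    ∃ (P r : (MvPolynomial (Fin 2) ℝ)[X]) (r' : (MvPolynomial (Fin 2) ℝ)[X])
      (D A B : MvPolynomial (Fin 2) ℝ),
      (∃ q : (MvPolynomial (Fin 2) ℝ)[X], q.degree < n ∧ P = X ^ n + q) ∧
      r.degree < n ∧ r'.degree < n ∧
      opG 1 (2 * n) (MvPolynomial.X 0) (MvPolynomial.X 1) P = C D ∧
      opG (-1) (2 * n + 4) (MvPolynomial.X 0) (MvPolynomial.X 1) r + 2 * derivative P = C A ∧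
      opG (-1) (2 * n + 4) (MvPolynomial.X 0) (MvPolynomial.X 1) r'
        + (2 * derivative P * X + P) = C B := by
  set e : MvPolynomial (Fin 2) ℝ := MvPolynomial.X 0
  set m : MvPolynomial (Fin 2) ℝ := MvPolynomial.X 1
  obtain ⟨f, hf, hf2⟩ := opG_monomial 1 (2 * n) e m 1 n
  have hf3 : opG 1 (2 * n) e m (X ^ n) = f := by
    rw [← monomial_one_right_eq_X_pow, hf2]; simp
  obtain ⟨q, D, hq, hqD⟩ := opG_division 1 (2 * n) e m n
    (by intro d hd; have : (d : ℝ) < n := by exact_mod_cast hd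
        intro h; linarith) n le_rfl (-f) (by rwa [degree_neg])
  have hT : ∀ d < n, 2 * (-1 : ℝ) * (d : ℝ) - (2 * n + 4) ≠ 0 := by
    intro d hd h
    have : (0 : ℝ) ≤ d := by positivity
    have : (0 : ℝ) ≤ n := by positivity
    linarith
  have hPd : (X ^ n + q).natDegree ≤ n := by
    refine natDegree_add_le_of_degree_le (natDegree_X_pow_le n) ?_
    exact natDegree_le_iff_degree_le.mpr hq.le
  have hPd' : (derivative (X ^ n + q)).natDegree ≤ n - 1 := (natDegree_derivative_le _).trans (by omega)
  have conv : ∀ g : (MvPolynomial (Fin 2) ℝ)[X], g.natDegree ≤ n → g.degree < ((n + 1 : ℕ) : WithBot ℕ) := by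
    intro g hg
    refine lt_of_le_of_lt (degree_le_natDegree) ?_
    exact_mod_cast Nat.lt_succ_of_le hg
  obtain ⟨r, A, hr, hrA⟩ := opG_division (-1) (2 * n + 4) e m n hT n le_rfl (-(2 * derivative (X ^ n + q)))
    (conv _ (by
      rw [natDegree_neg]
      refine natDegree_mul_le.trans ?_
      have : (2 : (MvPolynomial (Fin 2) ℝ)[X]).natDegree = 0 := natDegree_ofNat 2
      omega))
  obtain ⟨r', B, hr', hrB⟩ := opG_division (-1) (2 * n + 4) e m n hT n le_rfl
    (-(2 * derivative (X ^ n + q) * X + (X ^ n + q)))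
    (conv _ (by
      rw [natDegree_neg]
      refine natDegree_add_le_of_degree_le ?_ hPd
      rcases Nat.eq_zero_or_pos n with h0 | h0
      · have : derivative (X ^ n + q) = 0 := by
          have := natDegree_eq_zero.mp (show (X ^ n + q).natDegree = 0 by omega)
          obtain ⟨c, hc⟩ := this
          rw [← hc, derivative_C]
        rw [this]; simp
      · refine natDegree_mul_le.trans ?_
        have h1 : (2 : (MvPolynomial (Fin 2) ℝ)[X]).natDegree = 0 := natDegree_ofNat 2
        have h2 := natDegree_mul_le (p := (2 : (MvPolynomial (Fin 2) ℝ)[X])) (q := derivative (X ^ n + q))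
        have h3 := natDegree_X_le (R := MvPolynomial (Fin 2) ℝ)
        omega))
  refine ⟨X ^ n + q, r, r', D, A, B, ⟨q, hq, rfl⟩, hr, hr', ?_, ?_, ?_⟩
  · rw [opG_add, hf3, hqD]; ring
  · rw [hrA]; ring
  · rw [hrB]; ring
  
/-- A rational function `q / (x²+1)^h` vanishing at both infinities cannot have derivative of one
strict sign. -/
theorem no_monotone (h : ℕ) (q : ℝ[X]) (hq : q.degree < (2 * h : ℕ)) (c : ℝ) (f : ℝ → ℝ) (hf : ∀ x, 0 < f x)
    (H : ∀ x, ((x ^ 2 + 1) * (derivative q).eval x - 2 * h * x * q.eval x) = c * f x) : c = 0 := by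
  have key : ∀ (q : ℝ[X]), q.degree < (2 * h : ℕ) → ∀ c : ℝ, 0 < c → 
    (∀ x, ((x ^ 2 + 1) * (derivative q).eval x - 2 * h * x * q.eval x) = c * f x) → False := by
    intro q hq c hc H
    set Q : ℝ[X] := (X ^ 2 + 1) ^ h with hQ
    have hdX : (X ^ 2 + 1 : ℝ[X]).natDegree = 2 := by compute_degree!
    have hmon : (X ^ 2 + 1 : ℝ[X]).Monic := by monicity!
    have hQd : Q.degree = (2 * h : ℕ) := by
      rw [degree_eq_natDegree (hmon.pow h).ne_zero, (hmon.natDegree_pow h), hdX, mul_comm]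
    have hlt : q.degree < Q.degree := by rw [hQd]; exact hq
    have t1 := div_tendsto_atTop_zero_of_degree_lt q Q hlt
    have t2 : Tendsto (fun x => eval x q / eval x Q) atBot (nhds 0) := by
      have := (isLittleO_atBot_of_degree_lt q Q hlt).tendsto_div_nhds_zero
      exact this
    have hQe : ∀ x, eval x Q = (x ^ 2 + 1) ^ h := by intro x; simp [hQ]
    have hd : ∀ x, HasDerivAt (fun x => eval x q / eval x Q)
        (c * f x / (x ^ 2 + 1) ^ (h + 1)) x := by
      intro x
      have hp : (0 : ℝ) < x ^ 2 + 1 := by positivity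
      have hd2 : HasDerivAt (fun y : ℝ => eval y Q) (2 * h * x * (x ^ 2 + 1) ^ h / (x ^ 2 + 1)) x := by
        have h1 : HasDerivAt (fun y : ℝ => (y ^ 2 + 1) ^ h) (h * (x ^ 2 + 1) ^ (h - 1) * (2 * x)) x := by
          exact (((hasDerivAt_pow 2 x).add_const 1).pow h).congr_deriv (by simp)
        have h2 : (fun y : ℝ => eval y Q) = fun y : ℝ => (y ^ 2 + 1) ^ h := funext hQe
        rw [h2]
        refine h1.congr_deriv ?_
        rcases h with _ | h
        · simp
        · rw [eq_div_iff hp.ne', Nat.add_sub_cancel]; push_cast; ring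
      have h0 := (q.hasDerivAt x).div hd2 (by rw [hQe]; positivity)
      refine HasDerivAt.congr_deriv h0 ?_
      rw [hQe, ← H x]
      field_simp
      ring
    have hmono : StrictMono (fun x => eval x q / eval x Q) := by
      apply strictMono_of_deriv_pos
      intro x
      rw [(hd x).deriv]
      have := hf x
      positivity
    have e1 : (fun x => eval x q / eval x Q) 0 ≤ 0 := hmono.monotone.ge_of_tendsto t1 0
    have e2 : 0 ≤ (fun x => eval x q / eval x Q) (-1) := hmono.monotone.le_of_tendsto t2 (-1)
    have e3 := hmono (show (-1 : ℝ) < 0 by norm_num)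
    linarith
  rcases lt_trichotomy c 0 with hc | hc | hc
  · exfalso
    refine key (-q) (by rwa [degree_neg]) (-c) (by linarith) ?_
    intro x
    have := H x
    simp only [derivative_neg, eval_neg]
    linarith
  · exact hc
  · exact (key q hq c hc H).elim


theorem ode_zero (h : ℕ) (q : ℝ[X]) (hq : q.degree < (2 * h : ℕ))
    (H : (X ^ 2 + 1) * derivative q - C (2 * h : ℝ) * X * q = 0) : q = 0 := by
  by_contra hne
  set d := q.natDegree with hd
  have hlt : d < 2 * h := by
    rw [degree_eq_natDegree hne] at hq; exact_mod_cast hq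
  have h1 := congrArg (fun p => coeff p (d + 1)) H
  have h2 : (X ^ 2 + 1) * derivative q - C (2 * h : ℝ) * X * q =
      X * (X * derivative q) + derivative q - C (2 * h : ℝ) * (X * q) := by ring
  have h3 : coeff (X * derivative q) d = d * q.coeff d := by
    rcases d with _ | d
    · simp
    · rw [coeff_X_mul, coeff_derivative]; push_cast; ring
  have h4 : q.coeff (d + 1 + 1) = 0 := coeff_eq_zero_of_natDegree_lt (by omega)
  simp only [h2, coeff_sub, coeff_add, coeff_X_mul, coeff_C_mul, h3, coeff_derivative, h4, coeff_zero] at h1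
  have h5 : q.coeff d ≠ 0 := by
    rw [hd]; exact leadingCoeff_ne_zero.mpr hne
  have h6 : ((d : ℝ) - 2 * h) * q.coeff d = 0 := by linear_combination h1
  rcases mul_eq_zero.mp h6 with h7 | h7
  · have : (d : ℝ) < 2 * h := by exact_mod_cast hlt
    linarith
  · exact h5 h7

theorem base_poly (h : ℕ) (q : ℝ[X]) (hq : q.degree < (2 * h : ℕ)) (d : ℝ)
    (H : opG 1 (2 * (2 * h : ℕ)) 0 0 (X ^ (2 * h) + q) = C d) :
    d = 0 ∧ X ^ (2 * h) + q = (X ^ 2 + 1) ^ h := by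
  have hdX : (X ^ 2 + 1 : ℝ[X]).natDegree = 2 := by compute_degree!
  have hmon : (X ^ 2 + 1 : ℝ[X]).Monic := by monicity!
  have hQn : ((X ^ 2 + 1 : ℝ[X]) ^ h).natDegree = 2 * h := by
    rw [(hmon.natDegree_pow h), hdX, mul_comm]
  have hQd : ((X ^ 2 + 1 : ℝ[X]) ^ h).degree = (2 * h : ℕ) := by
    rw [degree_eq_natDegree (hmon.pow h).ne_zero, hQn]
  set w := X ^ (2 * h) + q - (X ^ 2 + 1) ^ h with hw
  have hwd : w.degree < (2 * h : ℕ) := by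
    have e1 : (X ^ (2 * h) + q).degree = ((2 * h : ℕ) : WithBot ℕ) := by
      rw [degree_add_eq_left_of_degree_lt] <;> simp only [degree_X_pow]; exact hq
    have e2 : (X ^ (2 * h) + q).leadingCoeff = ((X ^ 2 + 1 : ℝ[X]) ^ h).leadingCoeff := by
      rw [(hmon.pow h).leadingCoeff, leadingCoeff_add_of_degree_lt']
      · simp
      · rw [degree_X_pow]; exact hq
    rw [← e1]
    refine degree_sub_lt_left (e1.trans hQd.symm) ?_ e2
    intro h0; rw [h0, degree_zero] at e1; exact WithBot.bot_ne_coe e1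
  have hop : opG 1 (2 * (2 * h : ℕ)) (0 : ℝ) 0 ((X ^ 2 + 1) ^ h) = 0 := by
    simp only [opG]
    rcases h with _ | h
    · simp
    · rw [derivative_pow]
      have hC2 : (C (2 : ℝ) : ℝ[X]) = 2 := map_ofNat C 2
      simp [hC2]
      ring
  have hw2 : opG 1 (2 * (2 * h : ℕ)) (0 : ℝ) 0 w = C d := by
    have : opG 1 (2 * (2 * h : ℕ)) (0 : ℝ) 0 (w + (X ^ 2 + 1) ^ h) = C d := by
      rw [hw, sub_add_cancel]; exact H
    rwa [opG_add, hop, add_zero] at this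
  have hd : d / 2 = 0 := by
    refine no_monotone h w hwd (d / 2) (fun _ => 1) (fun _ => one_pos) ?_
    intro x
    have := congrArg (eval x) hw2
    simp [opG] at this
    linarith
  have hd0 : d = 0 := by linarith
  refine ⟨hd0, ?_⟩
  have : w = 0 := by
    refine ode_zero h w hwd ?_
    rw [hd0] at hw2
    have h2 : (C (2 : ℝ)) * ((X ^ 2 + 1) * derivative w - C (2 * h : ℝ) * X * w) = 0 := by
      rw [← C_0, ← hw2]
      simp [opG]
      ring
    rcases mul_eq_zero.mp h2 with h3 | h3
    · simp at h3
    · exact h3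
  rw [hw] at this
  exact sub_eq_zero.mp this

theorem base_deriv (h : ℕ) (q : ℝ[X][X]) (hq : q.degree < (2 * h : ℕ)) (D : ℝ[X])
    (H : opG 1 (2 * (2 * h : ℕ)) 0 X (X ^ (2 * h) + q) = C D) :
    D.eval 0 = 0 ∧ (derivative D).eval 0 ≠ 0 := by
  set ψ : ℝ[X] →ₐ[ℝ] ℝ := Polynomial.aeval 0 with hψ
  have hψe : ∀ p, ψ p = p.eval 0 := fun p => by rw [hψ, coe_aeval_eq_eval]
  have H0 := congrArg (Polynomial.map (ψ : ℝ[X] →+* ℝ)) H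
  rw [opG_map] at H0
  simp only [Polynomial.map_add, Polynomial.map_pow, map_X, map_C] at H0
  have hX : ψ X = 0 := by rw [hψe]; simp
  rw [hX, map_zero] at H0
  have hq0 : (q.map (ψ : ℝ[X] →+* ℝ)).degree < (2 * h : ℕ) := lt_of_le_of_lt degree_map_le hq
  obtain ⟨hD, hP⟩ := base_poly h _ hq0 _ H0
  have hD' : D.eval 0 = 0 := by rw [← hψe]; exact hD
  refine ⟨hD', ?_⟩
  obtain ⟨D1, hD1⟩ : (X : ℝ[X]) ∣ D := X_dvd_iff.mpr (by rw [coeff_zero_eq_eval_zero]; exact hD')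
  have hdvd : C (X : ℝ[X]) ∣ q - (q.map (ψ : ℝ[X] →+* ℝ)).map C := by
    rw [C_dvd_iff_dvd_coeff]
    intro i
    rw [X_dvd_iff, coeff_zero_eq_eval_zero]
    simp [hψe]
  obtain ⟨Q, hQ⟩ := hdvd
  have hQd : Q.degree < (2 * h : ℕ) := by
    rw [degree_lt_iff_coeff_zero] at hq ⊢
    intro i hi
    have h1 := congrArg (fun p => coeff p i) hQ
    simp only [coeff_sub, coeff_map, coeff_C_mul, hq i hi, map_zero, sub_zero] at h1
    rcases mul_eq_zero.mp h1.symm with h2 | h2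
    · exact absurd h2 X_ne_zero
    · exact h2
  set P := X ^ (2 * h) + q with hPdef
  have hPdec : P = ((X ^ 2 + 1 : ℝ[X]) ^ h).map C + C X * Q := by
    rw [← hP, ← hQ, hPdef]
    simp [Polynomial.map_add]
  have e1 : opG 1 (2 * (2 * h : ℕ)) (0 : ℝ[X]) 0 (((X ^ 2 + 1 : ℝ[X]) ^ h).map C) = 0 := by
    have := congrArg (Polynomial.map ((Polynomial.CAlgHom : ℝ →ₐ[ℝ] ℝ[X]) : ℝ →+* ℝ[X])) H0
    rw [opG_map, hP, hD] at this
    simpa using this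
  have e2 : C X * (opG 1 (2 * (2 * h : ℕ)) (0 : ℝ[X]) 0 Q + P) = C X * C D1 := by
    rw [← C_mul, ← hD1, ← H]
    have : opG 1 (2 * (2 * h : ℕ)) (0 : ℝ[X]) X P = opG 1 (2 * (2 * h : ℕ)) (0 : ℝ[X]) 0 P + C X * P := by
      simp only [opG, C_0]; ring
    rw [this]
    conv_rhs => rw [hPdec, opG_add, e1, opG_C_mul, ← hPdec]
    ring
  have e3 := mul_left_cancel₀ (by simp) e2
  have e4 := congrArg (Polynomial.map (ψ : ℝ[X] →+* ℝ)) e3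
  rw [Polynomial.map_add, opG_map, hPdef] at e4
  simp only [Polynomial.map_add, Polynomial.map_pow, map_X, map_C] at e4
  rw [hP, map_zero] at e4
  intro hder
  have hD10 : ψ D1 = 0 := by
    rw [hψe]
    rw [hD1] at hder
    simpa using hder
  have hQ0 : (Q.map (ψ : ℝ[X] →+* ℝ)).degree < (2 * h : ℕ) := lt_of_le_of_lt degree_map_le hQd
  have := no_monotone h _ hQ0 (-1/2) (fun x => (x ^ 2 + 1) ^ h) (fun x => by positivity) (by
    intro x
    have := congrArg (eval x) e4
    simp [opG, hD10] at this
    simp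
    linarith)
  norm_num at this


/-- An analytic implicit function for a polynomial in two variables. -/
theorem implicit_branch (D : MvPolynomial (Fin 2) ℝ) (D1 : ℝ) (hD1 : D1 ≠ 0)
    (h0 : MvPolynomial.aeval ![(0 : ℝ), 0] D = 0)
    (h1 : HasDerivAt (fun m : ℝ => MvPolynomial.aeval ![(0 : ℝ), m] D) D1 0) :
    ∃ g : ℝ → ℝ, AnalyticAt ℝ g 0 ∧ ∀ᶠ e in nhds (0 : ℝ), MvPolynomial.aeval ![e, g e] D = 0 := by
  set F : ℝ × ℝ → ℝ := fun z => MvPolynomial.aeval ![z.1, z.2] D with hF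
  have hFa : AnalyticAt ℝ F (0, 0) := by
    apply AnalyticAt.aeval_mvPolynomial
    intro i
    fin_cases i
    · exact analyticAt_fst
    · exact analyticAt_snd
  have hc : ContDiffAt ℝ ⊤ F (0, 0) := hFa.contDiffAt
  have hinr : fderiv ℝ F (0, 0) ∘L .inr ℝ ℝ ℝ = D1 • ContinuousLinearMap.id ℝ ℝ := by
    have h2 : HasDerivAt (fun m : ℝ => ((0 : ℝ), m)) ((0 : ℝ), (1 : ℝ)) 0 :=
      (hasDerivAt_const _ _).prodMk (hasDerivAt_id _)
    have h3 := (hFa.differentiableAt.hasFDerivAt).comp_hasDerivAt (0 : ℝ) h2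
    have h4 := h3.unique h1
    ext
    simpa using h4
  have hinv : (fderiv ℝ F (0, 0) ∘L .inr ℝ ℝ ℝ).IsInvertible := by
    rw [hinr]
    refine ⟨ContinuousLinearEquiv.unitsEquivAut ℝ (Units.mk0 D1 hD1), ?_⟩
    ext; simp
  refine ⟨hc.implicitFunction (by simp) hinv, ?_, ?_⟩
  · exact (hc.contDiffAt_implicitFunction (by simp) hinv).analyticAt
  · have := hc.eventually_apply_implicitFunction (by simp) hinv
    filter_upwards [this] with e he
    rw [show F (0, 0) = 0 from h0] at he
    exact he

/-- The real branch of the QES locus for large negative `b`. -/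
theorem qes_branch (h : ℕ) :
    ∃ (e0 : ℝ) (m α β : ℝ → ℝ) (P r : ℝ → ℝ[X]), 0 < e0 ∧
      ContinuousOn α (Set.Ioo 0 e0) ∧ ContinuousOn β (Set.Ioo 0 e0) ∧
      ((∀ e ∈ Set.Ioo 0 e0, β e ≠ 0) ∨ (∀ e ∈ Set.Ioo 0 e0, α e = 1 ∧ β e = 0)) ∧
      ∀ e ∈ Set.Ioo 0 e0, (P e).degree = (2 * h : ℕ) ∧ (r e).degree < (2 * h : ℕ) ∧
        opG 1 (2 * (2 * h : ℕ)) e (m e) (P e) = 0 ∧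
        opG (-1) (2 * (2 * h : ℕ) + 4) e (m e) (r e) + 2 * derivative (P e) * (C (α e) + C (β e) * X)
          + C (β e) * P e = 0 := by
  obtain ⟨P, r, r', D, A, B, ⟨q, hq, hPq⟩, hr, hr', hD, hA, hB⟩ := universal_qes (2 * h)
  set χ : MvPolynomial (Fin 2) ℝ →ₐ[ℝ] ℝ[X] := MvPolynomial.aeval ![0, X] with hχ
  have hbase := congrArg (Polynomial.map (χ : MvPolynomial (Fin 2) ℝ →+* ℝ[X])) hD
  rw [opG_map, hPq] at hbase
  simp only [Polynomial.map_add, Polynomial.map_pow, map_X, map_C] at hbase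
  have hχ0 : χ (MvPolynomial.X 0) = 0 := by simp [hχ]
  have hχ1 : χ (MvPolynomial.X 1) = X := by simp [hχ]
  rw [hχ0, hχ1] at hbase
  obtain ⟨hd0, hd1⟩ := base_deriv h _ (lt_of_le_of_lt degree_map_le hq) _ hbase
  have hχe : ∀ m : ℝ, MvPolynomial.aeval ![(0 : ℝ), m] D = (χ D).eval m := by
    intro m
    have : ((Polynomial.aeval m : ℝ[X] →ₐ[ℝ] ℝ).comp χ) = MvPolynomial.aeval ![(0 : ℝ), m] := by
      apply MvPolynomial.algHom_ext
      intro i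
      fin_cases i <;> simp [hχ]
    rw [← this]
    simp [coe_aeval_eq_eval]
  obtain ⟨g, hg, hgD⟩ := implicit_branch D _ hd1 (by rw [hχe]; exact hd0) (by
    have := (χ D).hasDerivAt (0 : ℝ)
    refine this.congr_of_eventuallyEq (Eventually.of_forall hχe))
  set φ : ℝ → MvPolynomial (Fin 2) ℝ →ₐ[ℝ] ℝ := fun e => MvPolynomial.aeval ![e, g e] with hφ
  have han : ∀ G : MvPolynomial (Fin 2) ℝ, AnalyticAt ℝ (fun e => φ e G) 0 := by
    intro G
    apply AnalyticAt.aeval_mvPolynomial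
    intro i
    fin_cases i
    · exact analyticAt_id
    · exact hg
  have hcont : ∀ G : MvPolynomial (Fin 2) ℝ, ∀ᶠ e in nhds (0 : ℝ), ContinuousAt (fun e => φ e G) e := by
    intro G
    filter_upwards [(han G).eventually_analyticAt] with e he using he.continuousAt
  have hφ0 : ∀ e, φ e (MvPolynomial.X 0) = e := by intro e; simp [hφ]
  have hφ1 : ∀ e, φ e (MvPolynomial.X 1) = g e := by intro e; simp [hφ]
  have hPdeg : ∀ e, (P.map (φ e : MvPolynomial (Fin 2) ℝ →+* ℝ)).degree = ((2 * h : ℕ) : WithBot ℕ) := by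
    intro e
    have : (q.map (φ e : MvPolynomial (Fin 2) ℝ →+* ℝ)).degree < (2 * h : ℕ) :=
      lt_of_le_of_lt degree_map_le hq
    rw [hPq]
    simp only [Polynomial.map_add, Polynomial.map_pow, map_X]
    rw [degree_add_eq_left_of_degree_lt] <;> simp only [degree_X_pow]; exact this
  have hPode : ∀ e, MvPolynomial.aeval ![e, g e] D = 0 →
      opG 1 (2 * (2 * h : ℕ)) e (g e) (P.map (φ e : MvPolynomial (Fin 2) ℝ →+* ℝ)) = 0 := by
    intro e he
    have := congrArg (Polynomial.map (φ e : MvPolynomial (Fin 2) ℝ →+* ℝ)) hD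
    rw [opG_map, hφ0, hφ1, map_C] at this
    rw [this]
    have h2 : φ e D = 0 := he
    simp [h2]
  have hAe : ∀ e, opG (-1) (2 * (2 * h : ℕ) + 4) e (g e) (r.map (φ e : MvPolynomial (Fin 2) ℝ →+* ℝ))
      + 2 * derivative (P.map (φ e : MvPolynomial (Fin 2) ℝ →+* ℝ)) = C (φ e A) := by
    intro e
    have := congrArg (Polynomial.map (φ e : MvPolynomial (Fin 2) ℝ →+* ℝ)) hA
    rw [Polynomial.map_add, opG_map, hφ0, hφ1, map_C] at this
    simpa [derivative_map] using this
  have hBe : ∀ e, opG (-1) (2 * (2 * h : ℕ) + 4) e (g e) (r'.map (φ e : MvPolynomial (Fin 2) ℝ →+* ℝ))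
      + (2 * derivative (P.map (φ e : MvPolynomial (Fin 2) ℝ →+* ℝ)) * X
        + P.map (φ e : MvPolynomial (Fin 2) ℝ →+* ℝ)) = C (φ e B) := by
    intro e
    have := congrArg (Polynomial.map (φ e : MvPolynomial (Fin 2) ℝ →+* ℝ)) hB
    rw [Polynomial.map_add, opG_map, hφ0, hφ1, map_C] at this
    simpa [derivative_map] using this
  rcases (han A).eventually_eq_zero_or_eventually_ne_zero with hz | hz
  · obtain ⟨e0, he0, hball⟩ := Metric.eventually_nhds_iff.mp (hz.and hgD)
    refine ⟨e0, g, fun _ => 1, fun _ => 0, fun e => P.map (φ e : MvPolynomial (Fin 2) ℝ →+* ℝ),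
      fun e => r.map (φ e : MvPolynomial (Fin 2) ℝ →+* ℝ), he0, continuousOn_const, continuousOn_const,
      Or.inr (fun _ _ => ⟨rfl, rfl⟩), ?_⟩
    intro e he
    have hb := hball (y := e) (by rw [Real.dist_eq, sub_zero, abs_of_pos he.1]; exact he.2)
    refine ⟨hPdeg e, lt_of_le_of_lt degree_map_le hr, hPode e hb.2, ?_⟩
    have := hAe e
    rw [hb.1] at this
    simpa using this
  · rw [eventually_nhdsWithin_iff] at hz
    obtain ⟨e0, he0, hball⟩ := Metric.eventually_nhds_iff.mp (hz.and (hgD.and ((hcont A).and (hcont B))))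
    have hb : ∀ e ∈ Set.Ioo 0 e0, _ := fun e he =>
      hball (y := e) (by rw [Real.dist_eq, sub_zero, abs_of_pos he.1]; exact he.2)
    refine ⟨e0, g, fun e => φ e B, fun e => - φ e A, fun e => P.map (φ e : MvPolynomial (Fin 2) ℝ →+* ℝ),
      fun e => C (φ e B) * r.map (φ e : MvPolynomial (Fin 2) ℝ →+* ℝ)
        + C (- φ e A) * r'.map (φ e : MvPolynomial (Fin 2) ℝ →+* ℝ), he0, ?_, ?_, Or.inl ?_, ?_⟩
    · intro e he; exact (hb e he).2.2.2.continuousWithinAt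
    · intro e he; exact (hb e he).2.2.1.neg.continuousWithinAt
    · intro e he
      exact neg_ne_zero.mpr ((hb e he).1 (by simpa using he.1.ne'))
    · intro e he
      refine ⟨hPdeg e, ?_, hPode e (hb e he).2.1, ?_⟩
      · refine lt_of_le_of_lt (degree_add_le _ _) (max_lt ?_ ?_)
        · rw [← smul_eq_C_mul]; exact lt_of_le_of_lt (degree_smul_le _ _) (lt_of_le_of_lt degree_map_le hr)
        · rw [← smul_eq_C_mul]; exact lt_of_le_of_lt (degree_smul_le _ _) (lt_of_le_of_lt degree_map_le hr')
      · rw [opG_add, opG_C_mul, opG_C_mul]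
        have h1 := hAe e
        have h2 := hBe e
        simp only [map_neg]
        linear_combination (C (φ e B)) * h1 - C (φ e A) * h2


/-- The primitive cube root of unity. -/
noncomputable def om : ℂ := ⟨-1 / 2, √3 / 2⟩

theorem om_sq : om ^ 2 = ⟨-1 / 2, -(√3 / 2)⟩ := by
  have h3 : √3 * √3 = 3 := Real.mul_self_sqrt (by norm_num)
  apply Complex.ext
  · simp [om, pow_two]; nlinarith
  · simp [om, pow_two]; ring

theorem om_cube : om ^ 3 = 1 := by
  have h3 : √3 * √3 = 3 := Real.mul_self_sqrt (by norm_num)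
  rw [pow_succ, om_sq]
  apply Complex.ext
  · simp [om]; nlinarith
  · simp [om]; ring

theorem exp_cubic_integrable (a x : ℝ) (ha : 0 < a) (j : ℕ) :
    MeasureTheory.IntegrableOn (fun t : ℝ => t ^ j * Real.exp (-a * t ^ 3 + x * t)) (Set.Ioi 0) := by
  refine integrable_of_isBigO_exp_neg (b := 1) one_pos (by fun_prop) ?_
  refine Asymptotics.IsBigO.of_bound 1 ?_
  filter_upwards [eventually_ge_atTop (1 : ℝ), eventually_ge_atTop ((j + |x| + 1) / a)] with t h1 h2
  rw [one_mul, Real.norm_of_nonneg (by positivity), Real.norm_of_nonneg (by positivity)]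
  have e1 : t ^ j ≤ Real.exp (j * t) := by
    rw [Real.exp_nat_mul]
    exact pow_le_pow_left₀ (by linarith) (by linarith [Real.add_one_le_exp t]) j
  calc t ^ j * Real.exp (-a * t ^ 3 + x * t) ≤ Real.exp (j * t) * Real.exp (-a * t ^ 3 + x * t) := by gcongr
    _ = Real.exp (j * t + (-a * t ^ 3 + x * t)) := (Real.exp_add _ _).symm
    _ ≤ Real.exp (-1 * t) := by
      apply Real.exp_le_exp.mpr
      rw [div_le_iff₀ ha] at h2
      have h3 : x ≤ |x| := le_abs_self x
      have h4 : (j + |x| + 1) * t ≤ t * a * t := by gcongr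
      have h5 : t * a * t * 1 ≤ t * a * t * t := by gcongr
      nlinarith

/-- The integrand of the moments. -/
noncomputable def kf (j : ℕ) (x t : ℝ) : ℂ :=
  (t : ℂ) ^ j * Complex.exp (-(2 / 3) * (t : ℂ) ^ 3 - 2 * x * om * t)

theorem norm_kf (j : ℕ) (x t : ℝ) (ht : 0 ≤ t) :
    ‖kf j x t‖ = t ^ j * Real.exp (-(2 / 3) * t ^ 3 + x * t) := by
  rw [kf, norm_mul, norm_pow, Complex.norm_exp, Complex.norm_real, Real.norm_of_nonneg ht]
  congr 2
  have h1 : (-(2 / 3) * (t : ℂ) ^ 3 - 2 * x * om * t) = ((-(2 / 3) * t ^ 3 : ℝ) : ℂ) - ((2 * x * t : ℝ) : ℂ) * om := by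
    push_cast; ring
  rw [h1, Complex.sub_re, Complex.ofReal_re, Complex.re_ofReal_mul]
  simp [om]; ring

theorem kf_cont (j : ℕ) (x : ℝ) : Continuous (kf j x) := by
  unfold kf; fun_prop

theorem kf_int (j : ℕ) (x : ℝ) : MeasureTheory.IntegrableOn (kf j x) (Set.Ioi 0) := by
  refine (exp_cubic_integrable (2 / 3) x (by norm_num) j).mono' (kf_cont j x).aestronglyMeasurable ?_
  filter_upwards [MeasureTheory.ae_restrict_mem measurableSet_Ioi] with t ht
  rw [norm_kf j x t (le_of_lt ht)]

/-- The moments. -/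
noncomputable def KK (j : ℕ) (x : ℝ) : ℂ := ∫ t in Set.Ioi (0 : ℝ), kf j x t

theorem KK_deriv (j : ℕ) (x : ℝ) : HasDerivAt (KK j) (-2 * om * KK (j + 1) x) x := by
  have h := hasDerivAt_integral_of_dominated_loc_of_deriv_le (𝕜 := ℝ)
    (μ := MeasureTheory.volume.restrict (Set.Ioi (0 : ℝ)))
    (F := fun y t => kf j y t) (F' := fun y t => -2 * om * kf (j + 1) y t) (x₀ := x)
    (s := Set.Ioo (x - 1) (x + 1))
    (bound := fun t => 2 * ‖om‖ * (t ^ (j + 1) * Real.exp (-(2 / 3) * t ^ 3 + (x + 1) * t)))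
    (Ioo_mem_nhds (by linarith) (by linarith))
    (Eventually.of_forall fun y => (kf_cont j y).aestronglyMeasurable)
    (kf_int j x)
    ((kf_cont (j + 1) x).const_mul _ |>.aestronglyMeasurable)
    (by
      filter_upwards [MeasureTheory.ae_restrict_mem measurableSet_Ioi] with t ht y hy
      have ht' : 0 ≤ t := le_of_lt ht
      rw [norm_mul, norm_mul, norm_kf _ _ _ ht']
      have : y ≤ x + 1 := hy.2.le
      simp only [norm_neg, Complex.norm_ofNat]
      gcongr)
    ((exp_cubic_integrable (2 / 3) (x + 1) (by norm_num) (j + 1)).const_mul _)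
    (by
      filter_upwards with t y _
      have h1 : HasDerivAt (fun y : ℝ => (-(2 / 3) * (t : ℂ) ^ 3 - 2 * (y : ℂ) * om * t)) (-(2 * 1 * om * t)) y := by
        exact ((((Complex.ofRealCLM.hasDerivAt (x := y)).const_mul (2 : ℂ)).mul_const om).mul_const (t : ℂ)).const_sub _
      refine ((h1.cexp).const_mul ((t : ℂ) ^ j)).congr_deriv ?_
      simp only [kf]; ring)
  have := h.2
  rw [MeasureTheory.integral_const_mul] at this
  exact this

theorem KK_two (x : ℝ) : KK 2 x = 1 / 2 - x * om * KK 0 x := by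
  have hd : ∀ t ∈ Set.Ici (0 : ℝ), HasDerivAt (kf 0 x) (-2 * kf 2 x t - 2 * x * om * kf 0 x t) t := by
    intro t _
    have h1 : HasDerivAt (fun t : ℝ => (-(2 / 3) * (t : ℂ) ^ 3 - 2 * x * om * t))
        (-(2 / 3) * (3 * (t : ℂ) ^ 2) - 2 * x * om * 1) t := by
      have h2 : HasDerivAt (fun t : ℝ => (t : ℂ)) 1 t := Complex.ofRealCLM.hasDerivAt (x := t)
      have h3 : HasDerivAt (fun t : ℝ => (t : ℂ) ^ 3) (3 * (t : ℂ) ^ 2) t := by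
        exact (h2.pow 3).congr_deriv (by simp)
      exact (h3.const_mul _).sub (h2.const_mul _)
    have h4 := h1.cexp
    have h5 : kf 0 x = fun t : ℝ => Complex.exp (-(2 / 3) * (t : ℂ) ^ 3 - 2 * x * om * t) := by
      funext t; simp [kf]
    rw [h5]
    refine h4.congr_deriv ?_
    simp only [kf]; ring
  have hi : MeasureTheory.IntegrableOn (fun t => -2 * kf 2 x t - 2 * x * om * kf 0 x t) (Set.Ioi 0) :=
    ((kf_int 2 x).const_mul _).sub ((kf_int 0 x).const_mul _)
  have ht : Tendsto (kf 0 x) atTop (nhds 0) := by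
    refine MeasureTheory.tendsto_zero_of_hasDerivAt_of_integrableOn_Ioi (a := 0)
      (fun t ht => hd t (Set.Ioi_subset_Ici_self ht)) hi (kf_int 0 x)
  have := MeasureTheory.integral_Ioi_of_hasDerivAt_of_tendsto' hd hi ht
  rw [MeasureTheory.integral_sub ((kf_int 2 x).const_mul _) ((kf_int 0 x).const_mul _),
    MeasureTheory.integral_const_mul, MeasureTheory.integral_const_mul] at this
  have h0 : kf 0 x 0 = 1 := by simp [kf]
  rw [h0] at this
  change -2 * KK 2 x - 2 * x * om * KK 0 x = 0 - 1 at this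
  linear_combination (-1 / 2) * this

/-- The Airy-type function. -/
noncomputable def YY (x : ℝ) : ℝ := (om * KK 0 x).im
/-- Its derivative. -/
noncomputable def YD (x : ℝ) : ℝ := -2 * (om ^ 2 * KK 1 x).im

theorem im_deriv {f : ℝ → ℂ} {f' : ℂ} {x : ℝ} (h : HasDerivAt f f' x) :
    HasDerivAt (fun y => (f y).im) f'.im x :=
  (Complex.imCLM.hasFDerivAt.comp_hasDerivAt x h)

theorem YY_deriv (x : ℝ) : HasDerivAt YY (YD x) x := by
  refine (im_deriv ((KK_deriv 0 x).const_mul om)).congr_deriv ?_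
  have : om * (-2 * om * KK (0 + 1) x) = ((-2 : ℝ) : ℂ) * (om ^ 2 * KK 1 x) := by push_cast; ring
  rw [this, Complex.im_ofReal_mul, YD]

theorem YD_deriv (x : ℝ) : HasDerivAt YD (-4 * x * YY x) x := by
  refine ((im_deriv ((KK_deriv 1 x).const_mul (om ^ 2))).const_mul (-2)).congr_deriv ?_
  have : om ^ 2 * (-2 * om * KK (1 + 1) x) = ((-1 : ℝ) : ℂ) + ((2 * x : ℝ) : ℂ) * (om * KK 0 x) := by
    rw [show (1 + 1 : ℕ) = 2 from rfl, KK_two]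
    push_cast
    linear_combination (-2 * (1 / 2 - x * om * KK 0 x)) * om_cube
  rw [this, Complex.add_im, Complex.im_ofReal_mul, YY]
  simp; ring

theorem YY_zero_pos : 0 < YY 0 := by
  have h1 : KK 0 0 = ((∫ t in Set.Ioi (0 : ℝ), Real.exp (-(2 / 3) * t ^ 3) : ℝ) : ℂ) := by
    rw [KK, ← integral_complex_ofReal]
    congr 1
    funext t
    simp [kf]
  have h2 : 0 < ∫ t in Set.Ioi (0 : ℝ), Real.exp (-(2 / 3) * t ^ 3) := by
    have hi := exp_cubic_integrable (2 / 3) 0 (by norm_num) 0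
    simp only [pow_zero, one_mul, zero_mul, add_zero] at hi
    rw [MeasureTheory.setIntegral_pos_iff_support_of_nonneg_ae]
    · have : Function.support (fun t : ℝ => Real.exp (-(2 / 3) * t ^ 3)) = Set.univ := by
        ext t; simp [Real.exp_ne_zero]
      rw [this]; simp
    · filter_upwards with t using (Real.exp_pos _).le
    · exact hi
  rw [YY, h1, mul_comm, Complex.im_ofReal_mul]
  have : 0 < om.im := by simp [om]
  positivity


theorem YY_energy_pos (x1 : ℝ) (hx1 : 0 ≤ x1) : 0 < YY x1 ^ 2 + YD x1 ^ 2 := by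
  set K : ℝ := 1 + 4 * x1
  set G : ℝ → ℝ := fun x => (YY x ^ 2 + YD x ^ 2) * Real.exp (K * x) with hG
  have hd : ∀ x, HasDerivAt G ((2 * YY x * YD x + 2 * YD x * (-4 * x * YY x)) * Real.exp (K * x)
      + (YY x ^ 2 + YD x ^ 2) * (Real.exp (K * x) * K)) x := by
    intro x
    have h1 : HasDerivAt (fun x => YY x ^ 2 + YD x ^ 2) (2 * YY x * YD x + 2 * YD x * (-4 * x * YY x)) x := by
      refine (((YY_deriv x).pow 2).add ((YD_deriv x).pow 2)).congr_deriv ?_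
      simp
    have h2 : HasDerivAt (fun x => Real.exp (K * x)) (Real.exp (K * x) * K) x := by
      have : HasDerivAt (fun x : ℝ => K * x) K x := by simpa using (hasDerivAt_id x).const_mul K
      exact this.exp
    exact h1.mul h2
  have hmono : MonotoneOn G (Set.Icc 0 x1) := by
    refine monotoneOn_of_deriv_nonneg (convex_Icc 0 x1)
      (fun x _ => (hd x).continuousAt.continuousWithinAt)
      (fun x _ => (hd x).differentiableAt.differentiableWithinAt) ?_
    intro x hx
    rw [interior_Icc] at hx
    rw [(hd x).deriv]
    have h3 : 0 ≤ (2 * YY x * YD x + 2 * YD x * (-4 * x * YY x)) + (YY x ^ 2 + YD x ^ 2) * K := by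
      have e1 : 0 ≤ (YY x + YD x) ^ 2 := sq_nonneg _
      have e2 : 0 ≤ (YY x - YD x) ^ 2 * (4 * x) := mul_nonneg (sq_nonneg _) (by linarith [hx.1])
      have e3 : 0 ≤ (YY x ^ 2 + YD x ^ 2) * (4 * (x1 - x)) := mul_nonneg (by positivity) (by linarith [hx.2])
      simp only [K]
      nlinarith
    have h4 := mul_nonneg h3 (Real.exp_pos (K * x)).le
    linarith
  have h5 := hmono ⟨le_rfl, hx1⟩ ⟨hx1, le_rfl⟩ hx1
  have h6 : 0 < G 0 := by
    have := YY_zero_pos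
    simp only [hG]; positivity
  have h7 : 0 < G x1 := lt_of_lt_of_le h6 h5
  exact pos_of_mul_pos_left h7 (Real.exp_pos _).le

/-- Prüfer phase of the Airy-type function. -/
theorem YY_phase : ∃ (φ R : ℝ → ℝ) (c : ℝ), ContinuousOn φ (Set.Ici 1) ∧
    (∀ x, 1 ≤ x → |φ x - 4 / 3 * (x * √x)| ≤ c + x) ∧
    ∀ x, 1 ≤ x → ((YD x / (2 * √x) : ℝ) : ℂ) + Complex.I * (YY x : ℝ) = (R x : ℂ) * Complex.exp (Complex.I * φ x) := by
  set W : ℝ → ℂ := fun x => ((YD x / (2 * √x) : ℝ) : ℂ) + Complex.I * (YY x : ℝ) with hW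
  have hre : ∀ x, (W x).re = YD x / (2 * √x) := by intro x; simp only [hW, Complex.add_re, Complex.ofReal_re, Complex.mul_re, Complex.I_re, Complex.I_im, Complex.ofReal_im]; ring
  have him : ∀ x, (W x).im = YY x := by intro x; simp only [hW, Complex.add_im, Complex.ofReal_re, Complex.mul_im, Complex.I_re, Complex.I_im, Complex.ofReal_im]; ring
  have hW0 : ∀ x, 1 ≤ x → W x ≠ 0 := by
    intro x hx h0
    have h1 := hre x
    have h2 := him x
    rw [h0] at h1 h2
    simp only [Complex.zero_re, Complex.zero_im] at h1 h2
    have hs : 0 < √x := Real.sqrt_pos.mpr (by linarith)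
    have h3 : YD x = 0 := by
      rcases div_eq_zero_iff.mp h1.symm with h | h
      · exact h
      · linarith
    have := YY_energy_pos x (by linarith)
    rw [h3, ← h2] at this
    norm_num at this
  have hWd : ∀ x, 1 ≤ x → HasDerivAt W (2 * Complex.I * (√x : ℝ) * W x - ((W x).re : ℂ) / (2 * x)) x := by
    intro x hx
    have hx0 : 0 < x := by linarith
    have hs : 0 < √x := Real.sqrt_pos.mpr hx0
    have hss : √x * √x = x := Real.mul_self_sqrt hx0.le
    have h1 : HasDerivAt (fun x => YD x / (2 * √x)) (-2 * √x * YY x - YD x / (2 * √x) / (2 * x)) x := by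
      refine HasDerivAt.congr_deriv ((YD_deriv x).div ((Real.hasDerivAt_sqrt hx0.ne').const_mul 2) (by positivity)) ?_
      rw [← hss]
      have : √(√x * √x) = √x := by rw [hss]
      rw [this]
      field_simp
      ring
    have h2 := (h1.ofReal_comp).add (((YY_deriv x).ofReal_comp).const_mul Complex.I)
    refine HasDerivAt.congr_deriv h2 ?_
    rw [hre]
    simp only [hW]
    have hsc : ((√x : ℝ) : ℂ) ≠ 0 := by exact_mod_cast hs.ne'
    have hxc : (x : ℂ) ≠ 0 := by exact_mod_cast hx0.ne'
    push_cast
    field_simp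
    linear_combination (-8 * (√x : ℂ) ^ 2 * x * YY x) * Complex.I_sq
  set hh : ℝ → ℂ := fun x => - ((W (max 1 x)).re : ℂ) / W (max 1 x) / (2 * (max 1 x : ℝ)) with hhdef
  have hWc : ContinuousOn W (Set.Ici 1) := fun x hx => (hWd x hx).continuousAt.continuousWithinAt
  have hWm : Continuous (fun x => W (max 1 x)) :=
    hWc.comp_continuous (by fun_prop) (fun x => Set.mem_Ici.mpr (le_max_left _ _))
  have hhc : Continuous hh := by
    have hmax : ∀ x : ℝ, (2 * ((max 1 x : ℝ) : ℂ)) ≠ 0 := by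
      intro x
      have : (0 : ℝ) < max 1 x := lt_of_lt_of_le one_pos (le_max_left _ _)
      exact mul_ne_zero two_ne_zero (by exact_mod_cast this.ne')
    refine Continuous.div (Continuous.div ?_ hWm (fun x => hW0 _ (le_max_left _ _))) ?_ hmax
    · exact (Complex.continuous_ofReal.comp (Complex.continuous_re.comp hWm)).neg
    · fun_prop
  have hhb : ∀ x, ‖hh x‖ ≤ 1 / 2 := by
    intro x
    have h1 : (1 : ℝ) ≤ max 1 x := le_max_left _ _
    have h2 := hW0 _ h1
    have h3 : 0 < ‖W (max 1 x)‖ := norm_pos_iff.mpr h2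
    simp only [hhdef, norm_div, norm_neg, norm_mul, Complex.norm_real, Complex.norm_ofNat]
    have h4 : ‖(W (max 1 x)).re‖ ≤ ‖W (max 1 x)‖ := Complex.abs_re_le_norm _
    have h5 : ‖(W (max 1 x)).re‖ / ‖W (max 1 x)‖ ≤ 1 := (div_le_one h3).mpr h4
    have h6 : 2 ≤ 2 * ‖max 1 x‖ := by rw [Real.norm_of_nonneg (by linarith)]; linarith
    exact div_le_div₀ (by norm_num) h5 (by norm_num) h6
  set H : ℝ → ℂ := fun x => ∫ t in (1 : ℝ)..x, hh t with hH
  have hHd : ∀ x, HasDerivAt H (hh x) x := fun x => (hhc.integral_hasStrictDerivAt 1 x).hasDerivAt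
  have hHb : ∀ x, 1 ≤ x → ‖H x‖ ≤ x := by
    intro x hx
    have := intervalIntegral.norm_integral_le_of_norm_le_const (a := 1) (b := x) (f := hh) (C := 1 / 2)
      (fun t _ => hhb t)
    rw [abs_of_nonneg (by linarith)] at this
    refine this.trans (by linarith)
  set Z : ℝ → ℂ := fun x => W x * Complex.exp (-(Complex.I * ((4 / 3 * (x * √x) : ℝ) : ℂ)) - H x) with hZ
  have hZd : ∀ x, 1 ≤ x → HasDerivAt Z 0 x := by
    intro x hx
    have hx0 : 0 < x := by linarith
    have hs : 0 < √x := Real.sqrt_pos.mpr hx0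
    have hss : √x * √x = x := Real.mul_self_sqrt hx0.le
    have h1 : HasDerivAt (fun x : ℝ => 4 / 3 * (x * √x)) (2 * √x) x := by
      refine HasDerivAt.congr_deriv (((hasDerivAt_id x).mul (Real.hasDerivAt_sqrt hx0.ne')).const_mul (4 / 3)) ?_
      simp only [id]
      field_simp
      nlinarith
    have h2 := (((h1.ofReal_comp).const_mul Complex.I).neg.sub (hHd x)).cexp
    have h3 := (hWd x hx).mul h2
    refine HasDerivAt.congr_deriv h3 ?_
    have h4 : hh x * W x = - ((W x).re : ℂ) / (2 * x) := by
      have hw := hW0 x hx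
      have hxc : (x : ℂ) ≠ 0 := by exact_mod_cast hx0.ne'
      simp only [hhdef, max_eq_right hx]
      field_simp
    push_cast
    linear_combination (-Complex.exp (-(Complex.I * (4 / 3 * (x * (√x : ℂ)))) - H x)) * h4
  have hZc : ∀ x, 1 ≤ x → Z x = Z 1 := by
    intro x hx
    refine constant_of_has_deriv_right_zero (a := 1) (b := x) ?_ ?_ x ⟨hx, le_rfl⟩
    · intro y hy; exact (hZd y hy.1).continuousAt.continuousWithinAt
    · intro y hy; exact (hZd y hy.1).hasDerivWithinAt
  have hZ1 : Z 1 ≠ 0 := mul_ne_zero (hW0 1 le_rfl) (Complex.exp_ne_zero _)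
  set c0 := Complex.log (Z 1) with hc0
  refine ⟨fun x => c0.im + 4 / 3 * (x * √x) + (H x).im, fun x => Real.exp (c0.re + (H x).re), |c0.im|, ?_, ?_, ?_⟩
  · have hHc : Continuous H := continuous_iff_continuousAt.mpr fun x => (hHd x).continuousAt
    have := Complex.continuous_im.comp hHc
    refine Continuous.continuousOn ?_
    fun_prop
  · intro x hx
    have h1 : |(H x).im| ≤ x := (Complex.abs_im_le_norm _).trans (hHb x hx)
    have h2 : c0.im + 4 / 3 * (x * √x) + (H x).im - 4 / 3 * (x * √x) = c0.im + (H x).im := by ring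
    rw [h2]
    exact (abs_add_le _ _).trans (by linarith)
  · intro x hx
    have h1 := hZc x hx
    have h2 : W x = Z 1 * Complex.exp (Complex.I * ((4 / 3 * (x * √x) : ℝ) : ℂ) + H x) := by
      rw [← h1]
      simp only [hZ]
      rw [mul_assoc, ← Complex.exp_add]
      ring_nf
      simp
    change W x = _
    rw [h2, ← Complex.exp_log hZ1, ← hc0, Complex.ofReal_exp, ← Complex.exp_add, ← Complex.exp_add]
    congr 1
    apply Complex.ext <;> simp
    ring


theorem theta_deriv (x z : ℂ) : HasDerivAt (fun z : ℂ => z ^ 3 / 3 + x * z) (z ^ 2 + x) z := by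
  refine HasDerivAt.congr_deriv (((hasDerivAt_pow 3 z).div_const 3).add ((hasDerivAt_id z).const_mul x)) ?_
  norm_num

theorem quartic_of_hasDeriv {J b lam : ℂ} {y y1 y2 : ℂ → ℂ} (h1 : ∀ z, HasDerivAt y (y1 z) z)
    (h2 : ∀ z, HasDerivAt y1 (y2 z) z)
    (h : ∀ z, -(y2 z) + (z ^ 4 - 2 * b * z ^ 2 + 2 * J * z) * y z = lam * y z) :
    SatisfiesQuarticODE J b lam y := by
  intro z
  have e1 : deriv y = y1 := funext fun z => (h1 z).deriv
  rw [e1, (h2 z).deriv]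
  exact h z

/-- The quasi-exactly solvable solution satisfies the ODE. -/
theorem qes_ode (x μ n : ℂ) (p : ℂ[X])
    (hp : ∀ z, (derivative (derivative p)).eval z + 2 * (z ^ 2 + x) * (derivative p).eval z
      + (μ - 2 * n * z) * p.eval z = 0) :
    SatisfiesQuarticODE (n + 1) (-x) (μ - x ^ 2) (qesFun (-x) p) := by
  have hq : qesFun (-x) p = fun z => p.eval z * Complex.exp (z ^ 3 / 3 + x * z) := by
    funext z; simp [qesFun, sub_eq_add_neg]
  rw [hq]
  refine quartic_of_hasDeriv
    (y1 := fun z => ((derivative p).eval z + (z ^ 2 + x) * p.eval z) * Complex.exp (z ^ 3 / 3 + x * z))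
    (y2 := fun z => ((derivative (derivative p)).eval z + 2 * (z ^ 2 + x) * (derivative p).eval z
      + (2 * z + (z ^ 2 + x) ^ 2) * p.eval z) * Complex.exp (z ^ 3 / 3 + x * z)) ?_ ?_ ?_
  · intro z
    refine HasDerivAt.congr_deriv ((p.hasDerivAt z).mul (theta_deriv x z).cexp) ?_
    ring
  · intro z
    have h0 : HasDerivAt (fun z : ℂ => z ^ 2 + x) (2 * z) z := by
      simpa using (hasDerivAt_pow 2 z).add_const x
    refine HasDerivAt.congr_deriv ((((derivative p).hasDerivAt z).add (h0.mul (p.hasDerivAt z))).mul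
      (theta_deriv x z).cexp) ?_
    simp only [Pi.add_apply, Pi.mul_apply]
    ring
  · intro z
    linear_combination (-Complex.exp (z ^ 3 / 3 + x * z)) * hp z

/-- The second solution built from `p`, `r` and a primitive `E`. -/
noncomputable def wfun (x : ℂ) (p r : ℂ[X]) (E : ℂ → ℂ) (z : ℂ) : ℂ :=
  r.eval z * Complex.exp (-(z ^ 3 / 3 + x * z)) + p.eval z * Complex.exp (z ^ 3 / 3 + x * z) * E z

theorem wfun_ode (x μ n α β : ℂ) (p r : ℂ[X]) (E : ℂ → ℂ)
    (hp : ∀ z, (derivative (derivative p)).eval z + 2 * (z ^ 2 + x) * (derivative p).eval z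
      + (μ - 2 * n * z) * p.eval z = 0)
    (hr : ∀ z, (derivative (derivative r)).eval z - 2 * (z ^ 2 + x) * (derivative r).eval z
      + (μ - (2 * n + 4) * z) * r.eval z + 2 * (derivative p).eval z * (α + β * z) + β * p.eval z = 0)
    (hE : ∀ z, HasDerivAt E ((α + β * z) * Complex.exp (-2 * (z ^ 3 / 3 + x * z))) z) :
    Differentiable ℂ (fun z => wfun x p r E (-z)) ∧
    SatisfiesQuarticODE (-(n + 1)) (-x) (μ - x ^ 2) (fun z => wfun x p r E (-z)) := by
  set w1 : ℂ → ℂ := fun z => ((derivative r).eval z - (z ^ 2 + x) * r.eval z + p.eval z * (α + β * z)) *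
      Complex.exp (-(z ^ 3 / 3 + x * z))
      + ((derivative p).eval z + (z ^ 2 + x) * p.eval z) * Complex.exp (z ^ 3 / 3 + x * z) * E z with hw1
  set w2 : ℂ → ℂ := fun z => ((derivative (derivative r)).eval z - 2 * (z ^ 2 + x) * (derivative r).eval z
      + ((z ^ 2 + x) ^ 2 - 2 * z) * r.eval z + 2 * (derivative p).eval z * (α + β * z) + β * p.eval z) *
      Complex.exp (-(z ^ 3 / 3 + x * z))
      + ((derivative (derivative p)).eval z + 2 * (z ^ 2 + x) * (derivative p).eval z
      + (2 * z + (z ^ 2 + x) ^ 2) * p.eval z) * Complex.exp (z ^ 3 / 3 + x * z) * E z with hw2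
  have hexp : ∀ z : ℂ, Complex.exp (z ^ 3 / 3 + x * z) * Complex.exp (-2 * (z ^ 3 / 3 + x * z))
      = Complex.exp (-(z ^ 3 / 3 + x * z)) := by
    intro z; rw [← Complex.exp_add]; congr 1; ring
  have hq : ∀ z, HasDerivAt (fun z : ℂ => z ^ 2 + x) (2 * z) z := by
    intro z; simpa using (hasDerivAt_pow 2 z).add_const x
  have hl : ∀ z, HasDerivAt (fun z : ℂ => α + β * z) β z := by
    intro z; simpa using ((hasDerivAt_id z).const_mul β).const_add α
  have h1 : ∀ z, HasDerivAt (wfun x p r E) (w1 z) z := by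
    intro z
    refine HasDerivAt.congr_deriv (((r.hasDerivAt z).mul (theta_deriv x z).neg.cexp).add
      (((p.hasDerivAt z).mul (theta_deriv x z).cexp).mul (hE z))) ?_
    simp only [hw1, Pi.mul_apply, Pi.neg_apply]
    linear_combination (p.eval z * (α + β * z)) * hexp z
  have h2 : ∀ z, HasDerivAt w1 (w2 z) z := by
    intro z
    refine HasDerivAt.congr_deriv ((((((derivative r).hasDerivAt z).sub ((hq z).mul (r.hasDerivAt z))).add
      ((p.hasDerivAt z).mul (hl z))).mul (theta_deriv x z).neg.cexp).add
      (((((derivative p).hasDerivAt z).add ((hq z).mul (p.hasDerivAt z))).mul (theta_deriv x z).cexp).mul (hE z))) ?_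
    simp only [hw2, Pi.mul_apply, Pi.add_apply, Pi.sub_apply, Pi.neg_apply]
    linear_combination (((derivative p).eval z + (z ^ 2 + x) * p.eval z) * (α + β * z)) * hexp z
  have g1 : ∀ z, HasDerivAt (fun z => wfun x p r E (-z)) (-w1 (-z)) z := by
    intro z
    refine HasDerivAt.congr_deriv ((h1 (-z)).comp z (hasDerivAt_neg z)) ?_
    ring
  have g2 : ∀ z, HasDerivAt (fun z => -w1 (-z)) (w2 (-z)) z := by
    intro z
    refine HasDerivAt.congr_deriv ((h2 (-z)).comp z (hasDerivAt_neg z)).neg ?_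
    ring
  refine ⟨fun z => (g1 z).differentiableAt, quartic_of_hasDeriv g1 g2 ?_⟩
  intro z
  simp only [hw2, wfun]
  generalize E (-z) = e
  linear_combination (-Complex.exp (-((-z) ^ 3 / 3 + x * (-z)))) * hr (-z)
    - Complex.exp ((-z) ^ 3 / 3 + x * (-z)) * e * hp (-z)

theorem wfun_ne_zero (x α β : ℂ) (p r : ℂ[X]) (E : ℂ → ℂ) (hdeg : r.degree < p.degree)
    (hab : α ≠ 0 ∨ β ≠ 0)
    (hE : ∀ z, HasDerivAt E ((α + β * z) * Complex.exp (-2 * (z ^ 3 / 3 + x * z))) z) :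
    (fun z => wfun x p r E (-z)) ≠ 0 := by
  intro h0
  have h1 : ∀ z, wfun x p r E z = 0 := by
    intro z; have := congrFun h0 (-z); simpa using this
  set g : ℂ → ℂ := fun z => E z * Complex.exp (2 * (z ^ 3 / 3 + x * z)) with hg
  have hEd : Differentiable ℂ E := fun z => (hE z).differentiableAt
  have hgd : Differentiable ℂ g := by
    simp only [hg]; fun_prop
  have h2 : ∀ z, p.eval z * g z = - r.eval z := by
    intro z
    have h3 := h1 z
    simp only [wfun] at h3
    have e1 : Complex.exp (z ^ 3 / 3 + x * z) * Complex.exp (-(z ^ 3 / 3 + x * z)) = 1 := by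
      rw [← Complex.exp_add]; simp
    have e2 : Complex.exp (2 * (z ^ 3 / 3 + x * z)) = Complex.exp (z ^ 3 / 3 + x * z) ^ 2 := by
      rw [← Complex.exp_nat_mul]; simp
    simp only [hg, e2]
    linear_combination Complex.exp (z ^ 3 / 3 + x * z) * h3 - r.eval z * e1
  have hp0 : p ≠ 0 := ne_zero_of_degree_gt hdeg
  have hlit := (isLittleO_cobounded_of_degree_lt hdeg).tendsto_div_nhds_zero
  have h4 : Tendsto g (cocompact ℂ) (nhds 0) := by
    rw [← Metric.cobounded_eq_cocompact]
    have h5 : Tendsto (fun z => -(r.eval z / p.eval z)) (Bornology.cobounded ℂ) (nhds 0) := by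
      simpa using hlit.neg
    refine h5.congr' ?_
    have h6 : ∀ᶠ z in Bornology.cobounded ℂ, p.eval z ≠ 0 := by
      have hfin : {z | p.IsRoot z}.Finite := Polynomial.finite_setOfPred_isRoot hp0
      have := Bornology.isBounded_def.mp hfin.isBounded
      filter_upwards [this] with z hz
      exact hz
    filter_upwards [h6] with z hz
    field_simp
    linear_combination -h2 z
  have h7 : ∀ z, g z = 0 := fun z => hgd.apply_eq_of_tendsto_cocompact z h4
  have h8 : E = fun _ => 0 := by
    funext z
    exact (mul_eq_zero.mp (h7 z)).resolve_right (Complex.exp_ne_zero _)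
  have h9 : ∀ z : ℂ, α + β * z = 0 := by
    intro z
    have := hE z
    rw [h8] at this
    have := this.unique (hasDerivAt_const z 0)
    exact (mul_eq_zero.mp this).resolve_right (Complex.exp_ne_zero _)
  have a0 := h9 0
  have a1 := h9 1
  simp at a0
  rw [a0] at a1
  simp at a1
  tauto


theorem pow_exp_cubic_tendsto (a x : ℝ) (ha : 0 < a) (j : ℕ) :
    Tendsto (fun t : ℝ => t ^ j * Real.exp (-a * t ^ 3 + x * t)) atTop (nhds 0) := by
  have h := (Real.tendsto_pow_mul_exp_neg_atTop_nhds_zero j)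
  refine squeeze_zero' ?_ ?_ h
  · filter_upwards [eventually_ge_atTop (0 : ℝ)] with t ht
    positivity
  · filter_upwards [eventually_ge_atTop (1 : ℝ), eventually_ge_atTop ((|x| + 1) / a)] with t h1 h2
    gcongr
    rw [div_le_iff₀ ha] at h2
    have h3 : x ≤ |x| := le_abs_self x
    have h4 : (|x| + 1) * t ≤ t * a * t := by gcongr
    have h5 : t * a * t * 1 ≤ t * a * t * t := by gcongr
    nlinarith

theorem poly_exp_cubic_tendsto (a x : ℝ) (ha : 0 < a) (ω : ℂ) (q : ℂ[X]) :
    Tendsto (fun t : ℝ => ‖q.eval ((t : ℂ) * ω)‖ * Real.exp (-a * t ^ 3 + x * t)) atTop (nhds 0) := by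
  induction q using Polynomial.induction_on' with
  | add p q hp hq =>
    have h := hp.add hq
    rw [add_zero] at h
    refine squeeze_zero (fun t => by positivity) (fun t => ?_) h
    rw [← add_mul, eval_add]
    gcongr
    exact norm_add_le _ _
  | monomial j c =>
    have h := (pow_exp_cubic_tendsto a x ha j).const_mul (‖c‖ * ‖ω‖ ^ j)
    rw [mul_zero] at h
    refine h.congr' ?_
    filter_upwards [eventually_ge_atTop (0 : ℝ)] with t ht
    simp only [eval_monomial, norm_mul, norm_pow, Complex.norm_real, Real.norm_of_nonneg ht]
    ring

theorem norm_exp_ray (x t : ℝ) (ω : ℂ) (h3 : ω ^ 3 = 1) (hre : ω.re = -1 / 2) (s : ℝ) :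
    ‖Complex.exp ((s : ℂ) * (((t : ℂ) * ω) ^ 3 / 3 + x * ((t : ℂ) * ω)))‖ = Real.exp (s * (t ^ 3 / 3 - x * t / 2)) := by
  rw [Complex.norm_exp]
  congr 1
  have : (s : ℂ) * (((t : ℂ) * ω) ^ 3 / 3 + x * ((t : ℂ) * ω)) = ((s * (t ^ 3 / 3) : ℝ) : ℂ) + ((s * x * t : ℝ) : ℂ) * ω := by
    rw [mul_pow, h3]; push_cast; ring
  rw [this, Complex.add_re, Complex.ofReal_re, Complex.re_ofReal_mul, hre]
  ring

theorem ray_decay (x α β : ℝ) (p r : ℂ[X]) (E : ℂ → ℂ) (ω : ℂ) (h3 : ω ^ 3 = 1) (hre : ω.re = -1 / 2)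
    (hE : ∀ z : ℂ, HasDerivAt E (((α : ℂ) + β * z) * Complex.exp (-2 * (z ^ 3 / 3 + x * z))) z)
    (hE0 : E 0 = -∫ t in Set.Ioi (0 : ℝ), ω * ((α : ℂ) + β * ((t : ℂ) * ω)) *
      Complex.exp (-2 * (((t : ℂ) * ω) ^ 3 / 3 + x * ((t : ℂ) * ω)))) :
    Tendsto (fun t : ℝ => wfun x p r E ((t : ℂ) * ω)) atTop (nhds 0) := by
  have hω : ‖ω‖ = 1 := by
    have : ‖ω‖ ^ 3 = 1 := by rw [← norm_pow, h3, norm_one]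
    exact (pow_eq_one_iff_of_nonneg (norm_nonneg _) (by norm_num)).mp this
  set f : ℝ → ℂ := fun t => ω * ((α : ℂ) + β * ((t : ℂ) * ω)) *
      Complex.exp (-2 * (((t : ℂ) * ω) ^ 3 / 3 + x * ((t : ℂ) * ω))) with hf
  have hfc : Continuous f := by simp only [hf]; fun_prop
  have hFd : ∀ t : ℝ, HasDerivAt (fun t : ℝ => E ((t : ℂ) * ω)) (f t) t := by
    intro t
    have h1 : HasDerivAt (fun t : ℝ => (t : ℂ) * ω) ω t := by
      simpa using (Complex.ofRealCLM.hasDerivAt (x := t)).mul_const ω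
    refine HasDerivAt.congr_deriv ((hE ((t : ℂ) * ω)).comp t h1) ?_
    simp only [hf]; ring
  set B : ℝ → ℝ := fun s => |α| * (s ^ 0 * Real.exp (-(1 / 6) * s ^ 3 + x * s)) +
    |β| * (s ^ 1 * Real.exp (-(1 / 6) * s ^ 3 + x * s)) with hB
  have hBi : MeasureTheory.IntegrableOn B (Set.Ioi 0) :=
    ((exp_cubic_integrable (1 / 6) x (by norm_num) 0).const_mul _).add
      ((exp_cubic_integrable (1 / 6) x (by norm_num) 1).const_mul _)
  have hB0 : ∀ s, 0 ≤ s → 0 ≤ B s := by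
    intro s hs; simp only [hB]; positivity
  have hfb : ∀ t s : ℝ, 0 ≤ t → t ≤ s → ‖f s‖ ≤ Real.exp (-(1 / 2) * t ^ 3) * B s := by
    intro t s ht hts
    have hs : 0 ≤ s := ht.trans hts
    have e1 := norm_exp_ray x s ω h3 hre (-2)
    push_cast at e1
    simp only [hf, norm_mul, hω, one_mul, e1]
    have e2 : ‖(α : ℂ) + β * ((s : ℂ) * ω)‖ ≤ |α| + |β| * s := by
      refine (norm_add_le _ _).trans (le_of_eq ?_)
      simp [hω, abs_of_nonneg hs]
    have e3 : Real.exp (-2 * (s ^ 3 / 3 - x * s / 2)) ≤ Real.exp (-(1 / 2) * t ^ 3) * Real.exp (-(1 / 6) * s ^ 3 + x * s) := by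
      rw [← Real.exp_add]
      apply Real.exp_le_exp.mpr
      have : t ^ 3 ≤ s ^ 3 := by gcongr
      linarith
    refine (mul_le_mul e2 e3 (Real.exp_pos _).le (by positivity)).trans (le_of_eq ?_)
    simp only [hB]; ring
  have hfi : MeasureTheory.IntegrableOn f (Set.Ioi 0) := by
    refine MeasureTheory.Integrable.mono' hBi hfc.aestronglyMeasurable ?_
    filter_upwards [MeasureTheory.ae_restrict_mem measurableSet_Ioi] with t ht
    have := hfb 0 t le_rfl (le_of_lt ht)
    simpa using this
  have hF0 : Tendsto (fun t : ℝ => E ((t : ℂ) * ω)) atTop (nhds 0) := by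
    have h1 := MeasureTheory.intervalIntegral_tendsto_integral_Ioi 0 hfi tendsto_id
    have h2 : ∀ t : ℝ, ∫ s in (0 : ℝ)..t, f s = E ((t : ℂ) * ω) - E 0 := by
      intro t
      have := intervalIntegral.integral_eq_sub_of_hasDerivAt (a := 0) (b := t) (fun s _ => hFd s)
        (hfc.intervalIntegrable _ _)
      simpa using this
    have h4 : Tendsto (fun t : ℝ => (∫ s in (0 : ℝ)..t, f s) + E 0) atTop (nhds 0) := by
      have := h1.add_const (E 0)
      rw [hE0, add_neg_cancel] at this
      rw [hE0]
      exact this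
    refine h4.congr fun t => ?_
    rw [h2]; ring
  set M : ℝ := ∫ s in Set.Ioi (0 : ℝ), B s with hM
  have hEb : ∀ t : ℝ, 0 ≤ t → ‖E ((t : ℂ) * ω)‖ ≤ Real.exp (-(1 / 2) * t ^ 3) * M := by
    intro t ht
    have hsub : Set.Ioi t ⊆ Set.Ioi (0 : ℝ) := Set.Ioi_subset_Ioi ht
    have h1 := MeasureTheory.integral_Ioi_of_hasDerivAt_of_tendsto' (a := t) (fun s _ => hFd s)
      (hfi.mono_set hsub) hF0
    have h2 : ‖E ((t : ℂ) * ω)‖ = ‖∫ s in Set.Ioi t, f s‖ := by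
      rw [h1]; simp
    rw [h2]
    have h5 : ‖∫ s in Set.Ioi t, f s‖ ≤ ∫ s in Set.Ioi t, Real.exp (-(1 / 2) * t ^ 3) * B s := by
      refine MeasureTheory.norm_integral_le_of_norm_le ((hBi.mono_set hsub).const_mul _) ?_
      filter_upwards [MeasureTheory.ae_restrict_mem measurableSet_Ioi] with s hs
      exact hfb t s ht (le_of_lt hs)
    refine h5.trans ?_
    rw [MeasureTheory.integral_const_mul]
    gcongr
    refine MeasureTheory.setIntegral_mono_set hBi ?_ (Eventually.of_forall hsub)
    filter_upwards [MeasureTheory.ae_restrict_mem measurableSet_Ioi] with s hs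
    exact hB0 s (le_of_lt hs)
  have l1 := poly_exp_cubic_tendsto (1 / 3) (x / 2) (by norm_num) ω r
  have l2 := (poly_exp_cubic_tendsto (1 / 6) (-x / 2) (by norm_num) ω p).mul_const M
  have l3 := l1.add l2
  rw [zero_mul, add_zero] at l3
  refine squeeze_zero_norm' ?_ l3
  filter_upwards [eventually_ge_atTop (0 : ℝ)] with t ht
  refine (norm_add_le _ _).trans ?_
  have e1 := norm_exp_ray x t ω h3 hre (-1)
  have e2 := norm_exp_ray x t ω h3 hre 1
  push_cast at e1 e2
  rw [neg_one_mul] at e1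
  rw [one_mul] at e2
  rw [norm_mul, norm_mul, norm_mul, e1, e2]
  refine add_le_add (le_of_eq ?_) ?_
  · congr 2; ring
  · have h6 := hEb t ht
    calc ‖p.eval ((t : ℂ) * ω)‖ * Real.exp (1 * (t ^ 3 / 3 - x * t / 2)) * ‖E ((t : ℂ) * ω)‖
        ≤ ‖p.eval ((t : ℂ) * ω)‖ * Real.exp (1 * (t ^ 3 / 3 - x * t / 2)) * (Real.exp (-(1 / 2) * t ^ 3) * M) := by
          gcongr
      _ = ‖p.eval ((t : ℂ) * ω)‖ * (Real.exp (1 * (t ^ 3 / 3 - x * t / 2)) * Real.exp (-(1 / 2) * t ^ 3)) * M := by ring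
      _ = _ := by
        rw [← Real.exp_add]
        congr 3
        ring

theorem neg_exp_one : -Complex.exp (Complex.I * (Real.pi / 3)) = om ^ 2 := by
  have h : Complex.exp (Complex.I * (Real.pi / 3)) = Complex.exp (((Real.pi / 3 : ℝ) : ℂ) * Complex.I) := by
    congr 1; push_cast; ring
  rw [h, Complex.exp_mul_I, ← Complex.ofReal_cos, ← Complex.ofReal_sin, Real.cos_pi_div_three,
    Real.sin_pi_div_three, om_sq]
  apply Complex.ext <;> simp
  norm_num

theorem neg_exp_two : -Complex.exp (-Complex.I * (Real.pi / 3)) = om := by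
  have h : Complex.exp (-Complex.I * (Real.pi / 3)) = Complex.exp (((-(Real.pi / 3) : ℝ) : ℂ) * Complex.I) := by
    congr 1; push_cast; ring
  rw [h, Complex.exp_mul_I, ← Complex.ofReal_cos, ← Complex.ofReal_sin, Real.cos_neg, Real.sin_neg,
    Real.cos_pi_div_three, Real.sin_pi_div_three, om]
  apply Complex.ext <;> simp
  norm_num

theorem eigen_of_cond (x μ α β : ℝ) (n : ℂ) (p r : ℂ[X]) (hdeg : r.degree < p.degree)
    (hab : α ≠ 0 ∨ β ≠ 0)
    (hp : ∀ z, (derivative (derivative p)).eval z + 2 * (z ^ 2 + x) * (derivative p).eval z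
      + (μ - 2 * n * z) * p.eval z = 0)
    (hr : ∀ z, (derivative (derivative r)).eval z - 2 * (z ^ 2 + x) * (derivative r).eval z
      + (μ - (2 * n + 4) * z) * r.eval z + 2 * (derivative p).eval z * (α + β * z) + β * p.eval z = 0)
    (hcond : α * YY x - β * YD x / 2 = 0) :
    IsQuarticEigenvalue (-(n + 1)) (-x) (μ - x ^ 2) := by
  set f1 : ℝ → ℂ := fun t => om * ((α : ℂ) + β * ((t : ℂ) * om)) *
      Complex.exp (-2 * (((t : ℂ) * om) ^ 3 / 3 + x * ((t : ℂ) * om))) with hf1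
  set L : ℂ := ∫ t in Set.Ioi (0 : ℝ), f1 t with hL
  have hL1 : L = α * (om * KK 0 x) + β * (om ^ 2 * KK 1 x) := by
    have h1 : ∀ t, f1 t = α * om * kf 0 x t + β * om ^ 2 * kf 1 x t := by
      intro t
      have e : (-2 * (((t : ℂ) * om) ^ 3 / 3 + x * ((t : ℂ) * om))) = -(2 / 3) * (t : ℂ) ^ 3 - 2 * x * om * t := by
        rw [mul_pow, om_cube]; ring
      simp only [hf1, kf, e]
      ring
    rw [hL]
    simp only [h1]
    rw [MeasureTheory.integral_add ((kf_int 0 x).const_mul _) ((kf_int 1 x).const_mul _),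
      MeasureTheory.integral_const_mul, MeasureTheory.integral_const_mul]
    simp only [KK]
    ring
  have hLim : L.im = 0 := by
    rw [hL1, Complex.add_im, Complex.im_ofReal_mul, Complex.im_ofReal_mul]
    simp only [YY, YD] at hcond
    linear_combination hcond
  have hconj : (starRingEnd ℂ) L = L := Complex.conj_eq_iff_im.mpr hLim
  have homc : (starRingEnd ℂ) om = om ^ 2 := by
    rw [om_sq]; apply Complex.ext <;> simp [om]
  have hL2 : ∫ t in Set.Ioi (0 : ℝ), om ^ 2 * ((α : ℂ) + β * ((t : ℂ) * om ^ 2)) *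
      Complex.exp (-2 * (((t : ℂ) * om ^ 2) ^ 3 / 3 + x * ((t : ℂ) * om ^ 2))) = L := by
    rw [← hconj, hL, ← integral_conj]
    congr 1
    funext t
    simp only [hf1, map_mul, ← Complex.exp_conj, map_add, map_neg, map_div₀, map_pow, homc, Complex.conj_ofReal,
      map_ofNat]
  set g : ℂ → ℂ := fun z => ((α : ℂ) + β * z) * Complex.exp (-2 * (z ^ 3 / 3 + x * z)) with hg
  have hgd : Differentiable ℂ g := by simp only [hg]; fun_prop
  obtain ⟨E, hE0, hE⟩ := hgd.isExactOn_univ.with_val_at 0 (-L)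
  have hE' : ∀ z, HasDerivAt E (g z) z := fun z => hE z (Set.mem_univ z)
  obtain ⟨d, o⟩ := wfun_ode x μ n α β p r E hp hr hE'
  refine ⟨fun z => wfun x p r E (-z), d, wfun_ne_zero x α β p r E hdeg (by exact_mod_cast hab) hE', o, ?_, ?_⟩
  · have := ray_decay x α β p r E (om ^ 2) (by rw [← pow_mul, mul_comm, pow_mul, om_cube, one_pow])
      (by rw [om_sq]) hE' (by rw [hL2, hE0])
    refine this.congr fun t => ?_
    rw [← neg_exp_one]; ring_nf
  · have := ray_decay x α β p r E om om_cube (by rw [om]) hE' hE0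
    refine this.congr fun t => ?_
    rw [← neg_exp_two]; ring_nf


/-- Rescaled complexification of a real polynomial. -/
noncomputable def scl (c : ℝ) (P : ℝ[X]) : ℂ[X] :=
  (P.map (algebraMap ℝ ℂ)).comp (C ((c : ℂ)⁻¹) * X)

theorem scl_eval (c : ℝ) (P : ℝ[X]) (z : ℂ) :
    (scl c P).eval z = (P.map (algebraMap ℝ ℂ)).eval ((c : ℂ)⁻¹ * z) := by
  simp [scl]

theorem scl_derivative (c : ℝ) (P : ℝ[X]) :
    derivative (scl c P) = C ((c : ℂ)⁻¹) * scl c (derivative P) := by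
  simp [scl, derivative_comp]

theorem scl_degree (c : ℝ) (hc : 0 < c) (P : ℝ[X]) : (scl c P).degree = P.degree := by
  have hcc : (c : ℂ)⁻¹ ≠ 0 := inv_ne_zero (by exact_mod_cast hc.ne')
  by_cases hP : P = 0
  · simp [hP, scl]
  have hP' : P.map (algebraMap ℝ ℂ) ≠ 0 := by
    rwa [Ne, Polynomial.map_eq_zero]
  have h1 : (scl c P).natDegree = P.natDegree := by
    rw [scl, natDegree_comp, natDegree_C_mul_X _ hcc, mul_one, natDegree_map]
  have h2 : scl c P ≠ 0 := by
    intro h0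
    have h3 : ∀ z, (P.map (algebraMap ℝ ℂ)).eval z = 0 := by
      intro z
      have := scl_eval c P (c * z)
      rw [h0, eval_zero, ← mul_assoc, inv_mul_cancel₀ (by exact_mod_cast hc.ne'), one_mul] at this
      exact this.symm
    exact hP' (Polynomial.funext (by simpa using h3))
  rw [degree_eq_natDegree h2, degree_eq_natDegree hP, h1]

theorem crossing_point (h : ℕ) (c m α β : ℝ) (P r : ℝ[X]) (hc : 0 < c)
    (hPd : P.degree = (2 * h : ℕ)) (hrd : r.degree < (2 * h : ℕ))
    (hP : opG 1 (2 * (2 * h : ℕ)) (1 / c ^ 3) m P = 0)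
    (hr : opG (-1) (2 * (2 * h : ℕ) + 4) (1 / c ^ 3) m r + 2 * derivative P * (C α + C β * X) + C β * P = 0)
    (hab : α ≠ 0 ∨ β ≠ 0)
    (hcond : α * YY (c ^ 2) - β * (YD (c ^ 2) / (2 * c)) = 0) :
    (((-c ^ 2 : ℝ) : ℂ), ((c * m - c ^ 4 : ℝ) : ℂ)) ∈ qesSpectralLocus ((2 * h + 1 : ℕ) : ℂ) ∧
    IsQuarticEigenvalue (-((2 * h + 1 : ℕ) : ℂ)) ((-c ^ 2 : ℝ) : ℂ) ((c * m - c ^ 4 : ℝ) : ℂ) := by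
  have hcc : (c : ℂ) ≠ 0 := by exact_mod_cast hc.ne'
  have hpz : ∀ z : ℂ, (derivative (derivative (scl c P))).eval z
      + 2 * (z ^ 2 + ((c ^ 2 : ℝ) : ℂ)) * (derivative (scl c P)).eval z
      + (((c * m : ℝ) : ℂ) - 2 * ((2 * h : ℕ) : ℂ) * z) * (scl c P).eval z = 0 := by
    intro z
    have h1 := congrArg (fun q : ℝ[X] => (q.map (algebraMap ℝ ℂ)).eval ((c : ℂ)⁻¹ * z)) hP
    simp only [opG, Polynomial.map_add, Polynomial.map_mul, Polynomial.map_sub, Polynomial.map_pow, map_C, map_X,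
      eval_add, eval_mul, eval_sub, eval_pow, eval_C, eval_X, Polynomial.map_one, eval_one, Polynomial.map_zero, eval_zero] at h1
    simp only [scl_derivative, derivative_C_mul, eval_mul, eval_C, scl_eval]
    generalize eval ((c : ℂ)⁻¹ * z) (P.map (algebraMap ℝ ℂ)) = a0 at *
    generalize eval ((c : ℂ)⁻¹ * z) ((derivative P).map (algebraMap ℝ ℂ)) = a1 at *
    generalize eval ((c : ℂ)⁻¹ * z) ((derivative (derivative P)).map (algebraMap ℝ ℂ)) = a2 at *
    simp only [Complex.coe_algebraMap, Algebra.algebraMap_self, RingHom.id_apply] at h1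
    push_cast at h1 ⊢
    field_simp at h1 ⊢
    linear_combination h1
  have hrz : ∀ z : ℂ, (derivative (derivative (scl c r))).eval z
      - 2 * (z ^ 2 + ((c ^ 2 : ℝ) : ℂ)) * (derivative (scl c r)).eval z
      + (((c * m : ℝ) : ℂ) - (2 * ((2 * h : ℕ) : ℂ) + 4) * z) * (scl c r).eval z
      + 2 * (derivative (scl c P)).eval z * (((c ^ 2 * α : ℝ) : ℂ) + ((c * β : ℝ) : ℂ) * z)
      + ((c * β : ℝ) : ℂ) * (scl c P).eval z = 0 := by
    intro z
    have h1 := congrArg (fun q : ℝ[X] => (q.map (algebraMap ℝ ℂ)).eval ((c : ℂ)⁻¹ * z)) hr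
    simp only [opG, Polynomial.map_add, Polynomial.map_mul, Polynomial.map_sub, Polynomial.map_pow, map_C, map_X,
      eval_add, eval_mul, eval_sub, eval_pow, eval_C, eval_X, Polynomial.map_one, eval_one, Polynomial.map_zero, eval_zero,
      Polynomial.map_ofNat, eval_ofNat] at h1
    simp only [scl_derivative, derivative_C_mul, eval_mul, eval_C, scl_eval]
    generalize eval ((c : ℂ)⁻¹ * z) (P.map (algebraMap ℝ ℂ)) = a0 at *
    generalize eval ((c : ℂ)⁻¹ * z) ((derivative P).map (algebraMap ℝ ℂ)) = a1 at *
    generalize eval ((c : ℂ)⁻¹ * z) (r.map (algebraMap ℝ ℂ)) = b0 at *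
    generalize eval ((c : ℂ)⁻¹ * z) ((derivative r).map (algebraMap ℝ ℂ)) = b1 at *
    generalize eval ((c : ℂ)⁻¹ * z) ((derivative (derivative r)).map (algebraMap ℝ ℂ)) = b2 at *
    simp only [Complex.coe_algebraMap, Algebra.algebraMap_self, RingHom.id_apply] at h1
    push_cast at h1 ⊢
    field_simp at h1 ⊢
    linear_combination h1
  have hJ : ((2 * h + 1 : ℕ) : ℂ) = ((2 * h : ℕ) : ℂ) + 1 := by push_cast; ring
  have hb : ((-c ^ 2 : ℝ) : ℂ) = -((c ^ 2 : ℝ) : ℂ) := by push_cast; ring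
  have hl : ((c * m - c ^ 4 : ℝ) : ℂ) = ((c * m : ℝ) : ℂ) - ((c ^ 2 : ℝ) : ℂ) ^ 2 := by push_cast; ring
  have hdeg : (scl c r).degree < (scl c P).degree := by
    rw [scl_degree c hc, scl_degree c hc, hPd]; exact hrd
  rw [hJ, hb, hl]
  refine ⟨⟨scl c P, ne_zero_of_degree_gt hdeg, qes_ode _ _ _ _ hpz⟩, ?_⟩
  refine eigen_of_cond (c ^ 2) (c * m) (c ^ 2 * α) (c * β) _ (scl c P) (scl c r) hdeg ?_ hpz hrz ?_
  · rcases hab with h | h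
    · exact Or.inl (by positivity)
    · exact Or.inr (by positivity)
  · have h2 : c ^ 2 * (α * YY (c ^ 2) - β * (YD (c ^ 2) / (2 * c))) = 0 := by rw [hcond, mul_zero]
    rw [← h2]
    field_simp


theorem arg_im_zero (W A : ℂ) (R φ : ℝ) (k : ℕ) (hW : W = (R : ℂ) * Complex.exp (Complex.I * φ))
    (hk : φ + A.arg = Real.pi * k) : (W * A).im = 0 := by
  have h1 : W * A = ((R * ‖A‖ : ℝ) : ℂ) * Complex.exp (((Real.pi * k : ℝ) : ℂ) * Complex.I) := by
    rw [← hk, hW]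
    nth_rewrite 1 [← Complex.norm_mul_exp_arg_mul_I A]
    push_cast
    rw [add_mul, Complex.exp_add, mul_comm Complex.I (φ : ℂ)]
    ring
  rw [h1, Complex.im_ofReal_mul, Complex.exp_ofReal_mul_I_im, mul_comm Real.pi, Real.sin_nat_mul_pi, mul_zero]

theorem ratio_tendsto (Φ : ℝ → ℝ) (x0 C : ℝ) (hx0 : 1 ≤ x0)
    (hb : ∀ x, x0 ≤ x → |Φ x - 4 / 3 * (x * √x)| ≤ C + x) :
    Tendsto (fun x => Φ x / (x * √x)) atTop (nhds (4 / 3)) := by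
  have hs : Tendsto (fun x : ℝ => √x) atTop atTop := Real.tendsto_sqrt_atTop
  have hxs : Tendsto (fun x : ℝ => x * √x) atTop atTop := tendsto_id.atTop_mul_atTop₀ hs
  have h1 : Tendsto (fun x : ℝ => C / (x * √x) + 1 / √x) atTop (nhds 0) := by
    simpa using (hxs.const_div_atTop C).add (hs.const_div_atTop 1)
  rw [tendsto_iff_norm_sub_tendsto_zero]
  refine squeeze_zero' (Eventually.of_forall fun _ => norm_nonneg _) ?_ h1
  filter_upwards [eventually_ge_atTop x0] with x hx
  have hxp : 0 < x := by linarith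
  have hsp : 0 < √x := Real.sqrt_pos.mpr hxp
  have h2 : Φ x / (x * √x) - 4 / 3 = (Φ x - 4 / 3 * (x * √x)) / (x * √x) := by
    field_simp
  have h3 : C / (x * √x) + 1 / √x = (C + x) / (x * √x) := by field_simp
  rw [h2, h3, norm_div, Real.norm_eq_abs, Real.norm_of_nonneg (by positivity : 0 ≤ x * √x)]
  gcongr
  exact hb x hx

theorem sequence_asymptotics (Φ : ℝ → ℝ) (x0 C : ℝ) (hx0 : 1 ≤ x0) (hc : ContinuousOn Φ (Set.Ici x0))
    (hb : ∀ x, x0 ≤ x → |Φ x - 4 / 3 * (x * √x)| ≤ C + x) :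
    ∃ (X : ℕ → ℝ) (K : ℕ), (∀ k, x0 ≤ X k) ∧ (∀ k, Φ (X k) = Real.pi * ((k + K : ℕ) : ℝ)) ∧
      Tendsto (fun k : ℕ => X k / (((3 / 4 : ℝ) * Real.pi * ((k : ℝ) + 1)) ^ ((2 : ℝ) / 3))) atTop (nhds 1) := by
  have hs : Tendsto (fun x : ℝ => √x) atTop atTop := Real.tendsto_sqrt_atTop
  have hxs : Tendsto (fun x : ℝ => x * √x) atTop atTop := tendsto_id.atTop_mul_atTop₀ hs
  have hrat := ratio_tendsto Φ x0 C hx0 hb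
  have hΦ : Tendsto Φ atTop atTop := by
    refine (hrat.pos_mul_atTop (by norm_num) hxs).congr' ?_
    filter_upwards [eventually_ge_atTop x0] with x hx
    have hxp : 0 < x := by linarith
    have hsp : 0 < √x := Real.sqrt_pos.mpr hxp
    field_simp
  have hivt : Set.Ici (Φ x0) ⊆ Φ '' Set.Ici x0 :=
    isPreconnected_Ici.intermediate_value_Ici (l := atTop) (Set.mem_Ici.mpr le_rfl)
      (le_principal_iff.mpr (eventually_ge_atTop x0)) hc hΦ
  obtain ⟨K, hK⟩ := exists_nat_ge (Φ x0 / Real.pi)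
  have hex : ∀ k : ℕ, ∃ x, x0 ≤ x ∧ Φ x = Real.pi * ((k + K : ℕ) : ℝ) := by
    intro k
    have h1 : Φ x0 ≤ Real.pi * ((k + K : ℕ) : ℝ) := by
      rw [div_le_iff₀ Real.pi_pos] at hK
      push_cast
      have : 0 ≤ (k : ℝ) * Real.pi := by positivity
      nlinarith
    obtain ⟨x, hx, hx2⟩ := hivt h1
    exact ⟨x, hx, hx2⟩
  choose X hX hXΦ using hex
  refine ⟨X, K, hX, hXΦ, ?_⟩
  have hXt : Tendsto X atTop atTop := by
    refine tendsto_atTop.2 fun M => ?_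
    obtain ⟨N, hN⟩ := exists_nat_gt ((7 / 3 * M ^ 2 + C) / Real.pi)
    filter_upwards [eventually_ge_atTop N] with k hk
    by_contra hlt
    push Not at hlt
    have h1 := (abs_le.mp (hb (X k) (hX k))).2
    rw [hXΦ k] at h1
    have h2 : 1 ≤ X k := hx0.trans (hX k)
    have h3 : √(X k) ≤ X k := by
      rw [Real.sqrt_le_left (by linarith)]; nlinarith
    have h4 : X k * √(X k) ≤ X k * X k := by gcongr
    have h5 : X k * X k ≤ M ^ 2 := by nlinarith
    have h6 : X k ≤ X k * X k := by nlinarith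
    rw [div_lt_iff₀ Real.pi_pos] at hN
    have h7 : (N : ℝ) * Real.pi ≤ Real.pi * ((k + K : ℕ) : ℝ) := by
      rw [mul_comm]
      have : (N : ℝ) ≤ ((k + K : ℕ) : ℝ) := by exact_mod_cast (hk.trans (Nat.le_add_right _ _))
      gcongr
    linarith
  have h1 : Tendsto (fun k => Φ (X k) / (X k * √(X k))) atTop (nhds (4 / 3)) := hrat.comp hXt
  have h2 : Tendsto (fun k : ℕ => ((k + K : ℕ) : ℝ) / ((k : ℝ) + 1)) atTop (nhds 1) := by
    have h3 : Tendsto (fun k : ℕ => 1 + ((K : ℝ) - 1) * (1 / ((k : ℝ) + 1))) atTop (nhds 1) := by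
      simpa using (tendsto_one_div_add_atTop_nhds_zero_nat.const_mul ((K : ℝ) - 1)).const_add 1
    refine h3.congr fun k => ?_
    have : (k : ℝ) + 1 ≠ 0 := by positivity
    push_cast
    field_simp
    ring
  have h4 : Tendsto (fun k : ℕ => (4 / 3 * (Φ (X k) / (X k * √(X k)))⁻¹ * (((k + K : ℕ) : ℝ) / ((k : ℝ) + 1))) ^ ((2 : ℝ) / 3))
      atTop (nhds 1) := by
    have h5 := ((h1.inv₀ (by norm_num)).const_mul (4 / 3 : ℝ)).mul h2
    have h6 := h5.rpow_const (p := (2 : ℝ) / 3) (Or.inr (by norm_num))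
    have h7 : (4 / 3 * (4 / 3 : ℝ)⁻¹ * 1) ^ ((2 : ℝ) / 3) = 1 := by norm_num
    rw [h7] at h6
    exact h6
  refine h4.congr' ?_
  filter_upwards [eventually_ge_atTop 1] with k hk
  have hxp : 0 < X k := by linarith [hX k]
  have hsp : 0 < √(X k) := Real.sqrt_pos.mpr hxp
  have hkK : (0 : ℝ) < ((k + K : ℕ) : ℝ) := by exact_mod_cast (by omega)
  have hk1 : (0 : ℝ) < (k : ℝ) + 1 := by positivity
  have hpi := Real.pi_pos
  have e1 : 4 / 3 * (Φ (X k) / (X k * √(X k)))⁻¹ * (((k + K : ℕ) : ℝ) / ((k : ℝ) + 1))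
      = (X k * √(X k)) / (3 / 4 * Real.pi * ((k : ℝ) + 1)) := by
    rw [hXΦ]
    field_simp
  have e2 : (X k * √(X k)) ^ ((2 : ℝ) / 3) = X k := by
    have : X k * √(X k) = X k ^ ((3 : ℝ) / 2) := by
      rw [Real.sqrt_eq_rpow]
      nth_rewrite 1 [← Real.rpow_one (X k)]
      rw [← Real.rpow_add hxp]
      norm_num
    rw [this, ← Real.rpow_mul hxp.le]
    norm_num
  rw [e1, Real.div_rpow (by positivity) (by positivity), e2]

theorem level_crossing_asymptotics (J : ℕ) (hJ : 0 < J) (hodd : Odd J) :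
    ∃ f : ℕ → ℝ × ℝ, Function.Injective f ∧
      (∀ k : ℕ, (f k).1 < 0 ∧
        (((f k).1 : ℂ), ((f k).2 : ℂ)) ∈ qesSpectralLocus (J : ℂ) ∧
        IsQuarticEigenvalue (-(J : ℂ)) ((f k).1 : ℂ) ((f k).2 : ℂ)) ∧
      Tendsto
        (fun k : ℕ =>
          (f k).1 / (-(((3 / 4 : ℝ) * Real.pi * ((k : ℝ) + 1)) ^ ((2 : ℝ) / 3))))
        atTop (nhds 1) := by
  obtain ⟨h, rfl⟩ := hodd
  obtain ⟨e0, m, α, β, P, r, he0, hα, hβ, hab, hPr⟩ := qes_branch h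
  obtain ⟨φ, R, c, hφc, hφb, hφW⟩ := YY_phase
  set x0 : ℝ := max 1 (1 / e0) + 1 with hx0
  have hx01 : 1 ≤ x0 := by have := le_max_left 1 (1 / e0); linarith
  set ee : ℝ → ℝ := fun x => 1 / (√x) ^ 3 with hee
  have hem : ∀ x ∈ Set.Ici x0, ee x ∈ Set.Ioo 0 e0 := by
    intro x hx
    have hx' : x0 ≤ x := hx
    have hx1 : 1 ≤ x := by linarith
    have hs1 : 1 ≤ √x := Real.one_le_sqrt.mpr hx1
    have hxe : 1 / e0 < x := by have := le_max_right 1 (1 / e0); linarith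
    have hss : √x * √x = x := Real.mul_self_sqrt (by linarith)
    refine ⟨by simp only [hee]; positivity, ?_⟩
    simp only [hee]
    rw [one_div_lt (by positivity) he0]
    have : x * 1 ≤ x * √x := by gcongr
    calc 1 / e0 < x := hxe
      _ ≤ x * √x := by linarith
      _ = √x ^ 3 := by rw [← hss]; simp only [hss]; rw [pow_succ, pow_two, hss]
  have heec : ContinuousOn ee (Set.Ici x0) := by
    refine ContinuousOn.div continuousOn_const (by fun_prop) ?_
    intro x hx
    have hx' : x0 ≤ x := hx
    have : 0 < √x := Real.sqrt_pos.mpr (by linarith)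
    positivity
  set A : ℝ → ℂ := fun x => ((α (ee x) : ℝ) : ℂ) - Complex.I * ((β (ee x) : ℝ) : ℂ) with hA
  have hAre : ∀ x, (A x).re = α (ee x) := by intro x; simp [hA]
  have hAim : ∀ x, (A x).im = -β (ee x) := by intro x; simp [hA]
  have hαe : ContinuousOn (fun x => α (ee x)) (Set.Ici x0) := hα.comp heec hem
  have hβe : ContinuousOn (fun x => β (ee x)) (Set.Ici x0) := hβ.comp heec hem
  have hAc : ContinuousOn A (Set.Ici x0) :=
    (Complex.continuous_ofReal.comp_continuousOn hαe).sub
      (continuousOn_const.mul (Complex.continuous_ofReal.comp_continuousOn hβe))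
  have hAs : ∀ x ∈ Set.Ici x0, A x ∈ Complex.slitPlane := by
    intro x hx
    rw [Complex.mem_slitPlane_iff, hAre, hAim]
    rcases hab with hn | hn
    · right; exact neg_ne_zero.mpr (hn _ (hem x hx))
    · left; rw [(hn _ (hem x hx)).1]; norm_num
  set Φ : ℝ → ℝ := fun x => φ x + (A x).arg with hΦ
  have hΦc : ContinuousOn Φ (Set.Ici x0) := by
    refine (hφc.mono (Set.Ici_subset_Ici.mpr hx01)).add ?_
    intro x hx
    exact (Complex.continuousAt_arg (hAs x hx)).comp_continuousWithinAt (hAc x hx)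
  have hΦb : ∀ x, x0 ≤ x → |Φ x - 4 / 3 * (x * √x)| ≤ (c + Real.pi) + x := by
    intro x hx
    have h1 := hφb x (hx01.trans hx)
    have h2 := Complex.abs_arg_le_pi (A x)
    have h3 : Φ x - 4 / 3 * (x * √x) = (φ x - 4 / 3 * (x * √x)) + (A x).arg := by simp only [hΦ]; ring
    rw [h3]
    exact (abs_add_le _ _).trans (by linarith)
  obtain ⟨X, K, hX, hXΦ, hlim⟩ := sequence_asymptotics Φ x0 _ hx01 hΦc hΦb
  refine ⟨fun k => (-(√(X k)) ^ 2, √(X k) * m (ee (X k)) - (√(X k)) ^ 4), ?_, ?_, ?_⟩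
  · intro k l hkl
    have h1 : -(√(X k)) ^ 2 = -(√(X l)) ^ 2 := congrArg Prod.fst hkl
    rw [Real.sq_sqrt (by linarith [hX k]), Real.sq_sqrt (by linarith [hX l])] at h1
    have h2 : X k = X l := by linarith
    have h3 := hXΦ k
    rw [h2, hXΦ l] at h3
    have h4 := mul_left_cancel₀ Real.pi_ne_zero h3
    have h5 : l + K = k + K := by exact_mod_cast h4
    omega
  · intro k
    have hxk : 1 ≤ X k := hx01.trans (hX k)
    have hs : 0 < √(X k) := Real.sqrt_pos.mpr (by linarith)
    have hsq : √(X k) ^ 2 = X k := Real.sq_sqrt (by linarith)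
    obtain ⟨q1, q2, q3, q4⟩ := hPr (ee (X k)) (hem _ (hX k))
    refine ⟨by simp only; nlinarith, ?_⟩
    refine crossing_point h (√(X k)) (m (ee (X k))) (α (ee (X k))) (β (ee (X k))) _ _ hs q1 q2 q3 q4 ?_ ?_
    · rcases hab with hn | hn
      · right; exact hn _ (hem _ (hX k))
      · left; rw [(hn _ (hem _ (hX k))).1]; norm_num
    · have h1 := arg_im_zero _ (A (X k)) (R (X k)) (φ (X k)) _ (hφW (X k) hxk) (hXΦ k)
      rw [Complex.mul_im, hAre, hAim] at h1
      simp only [Complex.add_re, Complex.add_im, Complex.ofReal_re, Complex.mul_re, Complex.mul_im,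
        Complex.I_re, Complex.I_im, Complex.ofReal_im] at h1
      rw [hsq]
      linear_combination h1
  · refine hlim.congr fun k => ?_
    simp only
    rw [Real.sq_sqrt (by linarith [hX k]), neg_div_neg_eq]
end
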